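/- Let u be a weak solution in B₁ whose free boundary is Lipschitz: for every z ∈ ∂{u > 0} ∩ B₁ there exist r > 0, L > 0, a linear isometry e from ℝ^{n−1} × ℝ onto ℝⁿ and an L-Lipschitz function φ : ℝ^{n−1} → ℝ with φ(0) = 0 such that {u > 0} ∩ B_r(z) = {z + e(y,t) : t > φ(y)} ∩ B_r(z). Let x₀ ∈ ∂{u > 0} ∩ B₁, let r_k → 0⁺ and set u_{r_k}(x) := u(x₀ + r_k x)/r_k. Then there exist a subsequence (not relabelled) and a nonnegative Lipschitz continuous function u₀ : ℝⁿ → ℝ such that: u_{r_k} → u₀ uniformly on compact subsets of ℝⁿ; 0 ∈ ∂{u₀ > 0}; u₀ is C² with Δu₀ = 0 on the open set {u₀ > 0}; and −∫_{ℝⁿ} ∇u₀·∇η dx = Q(x₀) ∫_{∂{u₀>0}} η dμH^{n−1} for every η ∈ C_c^∞(ℝⁿ), where ∇u₀ is the a.e. defined gradient of u₀ (i.e. u₀ is a weak solution in all of ℝⁿ with f ≡ 0 and constant boundary datum Q(x₀)). -/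

import Mathlib

open MeasureTheory Metric Set Filter
open scoped ENNReal RealInnerProductSpace Topology NNReal

noncomputable section

variable {n : ℕ}

/-- The Laplacian of `u : ℝⁿ → ℝ`, written with iterated directional derivatives. -/
def lap (u : EuclideanSpace ℝ (Fin n) → ℝ) (x : EuclideanSpace ℝ (Fin n)) : ℝ :=
  ∑ i : Fin n, fderiv ℝ (fun y => fderiv ℝ u y (EuclideanSpace.single i 1)) x
    (EuclideanSpace.single i 1)

/-- The positivity set `{u > 0}` of `u`, within the open unit ball `B₁`. -/
def posSet (u : EuclideanSpace ℝ (Fin n) → ℝ) : Set (EuclideanSpace ℝ (Fin n)) :=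
  {x | x ∈ ball (0 : EuclideanSpace ℝ (Fin n)) 1 ∧ 0 < u x}

/-- `U` coincides, inside some small ball around `z`, with the open region above the graph of an
`L`-Lipschitz function `φ` (vanishing at the origin) in some rotated coordinate frame. -/
def IsLipGraphNear (U : Set (EuclideanSpace ℝ (Fin n))) (z : EuclideanSpace ℝ (Fin n)) : Prop :=
  ∃ (r L : ℝ)
    (e : WithLp 2 (EuclideanSpace ℝ (Fin (n-1)) × ℝ) ≃ₗᵢ[ℝ] EuclideanSpace ℝ (Fin n))
    (φ : EuclideanSpace ℝ (Fin (n-1)) → ℝ),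
    0 < r ∧ 0 < L ∧ LipschitzWith (Real.toNNReal L) φ ∧ φ 0 = 0 ∧
    U ∩ ball z r =
      {p | ∃ y t, φ y < t ∧
        p = z + e ((WithLp.equiv 2 (EuclideanSpace ℝ (Fin (n-1)) × ℝ)).symm (y, t))} ∩ ball z r

/-- A bounded Lipschitz domain of `ℝⁿ`. -/
def IsLipschitzDomain (Ω : Set (EuclideanSpace ℝ (Fin n))) : Prop :=
  Bornology.IsBounded Ω ∧ IsOpen Ω ∧ IsConnected Ω ∧ ∀ x ∈ frontier Ω, IsLipGraphNear Ω x

/-- Near `z`, the set `S` is the graph of a `C^∞` function `ψ` (vanishing at the origin) in some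
rotated coordinate frame: `S` is a smooth hypersurface near `z`. -/
def IsSmoothGraphNear (S : Set (EuclideanSpace ℝ (Fin n))) (z : EuclideanSpace ℝ (Fin n)) : Prop :=
  ∃ (ρ : ℝ)
    (e : WithLp 2 (EuclideanSpace ℝ (Fin (n-1)) × ℝ) ≃ₗᵢ[ℝ] EuclideanSpace ℝ (Fin n))
    (ψ : EuclideanSpace ℝ (Fin (n-1)) → ℝ),
    0 < ρ ∧ ContDiff ℝ (⊤ : ℕ∞) ψ ∧ ψ 0 = 0 ∧
    S ∩ ball z ρ =
      {p | ∃ y t, t = ψ y ∧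
        p = z + e ((WithLp.equiv 2 (EuclideanSpace ℝ (Fin (n-1)) × ℝ)).symm (y, t))} ∩ ball z ρ

/-- `g` is the weak gradient of `u` on the set `s`. -/
def HasWeakGradOn (u : EuclideanSpace ℝ (Fin n) → ℝ)
    (g : EuclideanSpace ℝ (Fin n) → EuclideanSpace ℝ (Fin n))
    (s : Set (EuclideanSpace ℝ (Fin n))) : Prop :=
  ∀ η : EuclideanSpace ℝ (Fin n) → ℝ, ContDiff ℝ (⊤ : ℕ∞) η → HasCompactSupport η → tsupport η ⊆ s →
    ∀ v : EuclideanSpace ℝ (Fin n),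
      ∫ x in s, u x * fderiv ℝ η x v = -∫ x in s, ⟪g x, v⟫ * η x

/-- `u` is a weak solution of the Alt–Caffarelli type problem
`Δu = -f` in `{u>0} ∩ B₁`, `∂_ν u = Q` on `∂{u>0} ∩ B₁` (Definition 2.1). -/
structure IsWeakSolution (f Q u : EuclideanSpace ℝ (Fin n) → ℝ) : Prop where
  contOn : ContinuousOn u (ball 0 1)
  nonneg : ∀ x ∈ ball (0 : EuclideanSpace ℝ (Fin n)) 1, 0 ≤ u x
  c2 : ContDiffOn ℝ 2 u (posSet u)
  eqn : ∀ x ∈ posSet u, lap u x = - f x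
  nondeg : ∀ D : Set (EuclideanSpace ℝ (Fin n)), IsOpen D →
    closure D ⊆ ball (0 : EuclideanSpace ℝ (Fin n)) 1 →
    ∃ c C : ℝ, 0 < c ∧ c ≤ C ∧ ∀ x r, 0 < r → ball x r ⊆ D → x ∈ frontier (posSet u) →
      c ≤ (1/r) * ⨍ y in sphere x r, u y ∂(μH[(n-1:ℝ)]) ∧
      (1/r) * ⨍ y in sphere x r, u y ∂(μH[(n-1:ℝ)]) ≤ C
  locLip : ∀ K : Set (EuclideanSpace ℝ (Fin n)), IsCompact K →
    K ⊆ ball (0 : EuclideanSpace ℝ (Fin n)) 1 → ∃ L : ℝ≥0, LipschitzOnWith L u K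
  weakEq : ∀ η : EuclideanSpace ℝ (Fin n) → ℝ, ContDiff ℝ (⊤ : ℕ∞) η → HasCompactSupport η →
    tsupport η ⊆ ball (0 : EuclideanSpace ℝ (Fin n)) 1 →
    -∫ x in ball (0 : EuclideanSpace ℝ (Fin n)) 1, ⟪gradient u x, gradient η x⟫
      = ∫ x in frontier (posSet u) ∩ ball (0 : EuclideanSpace ℝ (Fin n)) 1,
          Q x * η x ∂(μH[(n-1:ℝ)])
        - ∫ x in posSet u, f x * η x

/-- Euclidean space -/
abbrev EE (n : ℕ) := EuclideanSpace ℝ (Fin n)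


/-! ### Coordinates -/

/-- The point with coordinates `(y, t)` in the frame `e`. -/
def pt {m n : ℕ} (e : WithLp 2 (EE m × ℝ) ≃ₗᵢ[ℝ] EE n) (y : EE m) (t : ℝ) : EE n :=
  e (WithLp.toLp 2 (y, t))

/-- horizontal coordinate -/
def hc {m n : ℕ} (e : WithLp 2 (EE m × ℝ) ≃ₗᵢ[ℝ] EE n) (x : EE n) : EE m := (e.symm x).fst

/-- vertical coordinate -/
def vc {m n : ℕ} (e : WithLp 2 (EE m × ℝ) ≃ₗᵢ[ℝ] EE n) (x : EE n) : ℝ := (e.symm x).snd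

section coords
variable {m n : ℕ} (e : WithLp 2 (EE m × ℝ) ≃ₗᵢ[ℝ] EE n)

@[simp] lemma hc_pt (y : EE m) (t : ℝ) : hc e (pt e y t) = y := by simp [hc, pt]
@[simp] lemma vc_pt (y : EE m) (t : ℝ) : vc e (pt e y t) = t := by simp [vc, pt]
@[simp] lemma pt_hc_vc (x : EE n) : pt e (hc e x) (vc e x) = x := by
  show e (WithLp.toLp 2 ((e.symm x).fst, (e.symm x).snd)) = x
  exact e.apply_symm_apply x

lemma pt_add (y y' : EE m) (t t' : ℝ) : pt e (y + y') (t + t') = pt e y t + pt e y' t' := by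
  simp only [pt, ← map_add]; rfl
lemma pt_sub (y y' : EE m) (t t' : ℝ) : pt e (y - y') (t - t') = pt e y t - pt e y' t' := by
  simp only [pt, ← map_sub]; rfl
lemma pt_smul (c : ℝ) (y : EE m) (t : ℝ) : pt e (c • y) (c * t) = c • pt e y t := by
  simp only [pt, ← map_smul]; rfl
lemma pt_zero : pt e 0 0 = 0 := by
  have := pt_smul e 0 0 0
  simpa using this
lemma norm_pt_sq (y : EE m) (t : ℝ) : ‖pt e y t‖ ^ 2 = ‖y‖ ^ 2 + t ^ 2 := by
  simp [pt, WithLp.prod_norm_sq_eq_of_L2]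
lemma hc_add (x y : EE n) : hc e (x + y) = hc e x + hc e y := by simp [hc]
lemma hc_sub (x y : EE n) : hc e (x - y) = hc e x - hc e y := by simp [hc]
lemma hc_smul (c : ℝ) (x : EE n) : hc e (c • x) = c • hc e x := by simp [hc]
lemma vc_add (x y : EE n) : vc e (x + y) = vc e x + vc e y := by simp [vc]
lemma vc_sub (x y : EE n) : vc e (x - y) = vc e x - vc e y := by simp [vc]
lemma vc_smul (c : ℝ) (x : EE n) : vc e (c • x) = c * vc e x := by simp [vc]

lemma norm_sq_coords (x : EE n) : ‖x‖ ^ 2 = ‖hc e x‖ ^ 2 + vc e x ^ 2 := by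
  conv_lhs => rw [← pt_hc_vc e x]
  exact norm_pt_sq e _ _
lemma norm_hc_le (x : EE n) : ‖hc e x‖ ≤ ‖x‖ := by
  have := norm_sq_coords e x
  nlinarith [sq_nonneg (vc e x), norm_nonneg x, norm_nonneg (hc e x)]
lemma abs_vc_le (x : EE n) : |vc e x| ≤ ‖x‖ := by
  have := norm_sq_coords e x
  apply abs_le_of_sq_le_sq _ (norm_nonneg x)
  nlinarith [sq_nonneg (‖hc e x‖)]
lemma norm_pt_le (y : EE m) (t : ℝ) : ‖pt e y t‖ ≤ ‖y‖ + |t| := by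
  have := norm_pt_sq e y t
  nlinarith [norm_nonneg (pt e y t), norm_nonneg y, abs_nonneg t, sq_abs t,
    mul_nonneg (norm_nonneg y) (abs_nonneg t)]

lemma continuous_pt : Continuous (fun p : EE m × ℝ => pt e p.1 p.2) := by
  unfold pt
  exact e.continuous.comp (WithLp.prod_continuous_toLp 2 _ _)
lemma continuous_hc : Continuous (hc e) := by
  have : LipschitzWith 1 (hc e) := LipschitzWith.of_dist_le_mul fun x y => by
    rw [dist_eq_norm, dist_eq_norm, ← hc_sub]; simpa using norm_hc_le e (x - y)
  exact this.continuous
lemma continuous_vc : Continuous (vc e) := by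
  have : LipschitzWith 1 (vc e) := LipschitzWith.of_dist_le_mul fun x y => by
    rw [dist_eq_norm, dist_eq_norm, ← vc_sub]; simpa using abs_vc_le e (x - y)
  exact this.continuous

/-- parametrization of the graph of `φ` -/
def gr (φ : EE m → ℝ) (y : EE m) : EE n := pt e y (φ y)

lemma continuous_gr {φ : EE m → ℝ} (h : Continuous φ) : Continuous (gr e φ) :=
  (continuous_pt e).comp (continuous_id.prodMk h)

lemma gr_injective (φ : EE m → ℝ) : Function.Injective (gr e φ) := by
  intro x y h
  have := congrArg (hc e) h
  simpa [gr] using this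

lemma measurableEmbedding_gr {φ : EE m → ℝ} (h : Continuous φ) : MeasurableEmbedding (gr e φ) :=
  (continuous_gr e h).measurableEmbedding (gr_injective e φ)

lemma norm_gr_sub_sq (φ : EE m → ℝ) (x y : EE m) :
    ‖gr e φ x - gr e φ y‖ ^ 2 = ‖x - y‖ ^ 2 + (φ x - φ y) ^ 2 := by
  rw [gr, gr, ← pt_sub, norm_pt_sq]

end coords

/-! ### Area formula for graphs -/

lemma haus_le {X Y Z : Type*} [EMetricSpace Y] [EMetricSpace Z] [MeasurableSpace Y]
    [BorelSpace Y] [MeasurableSpace Z] [BorelSpace Z] (f : X → Y) (g : X → Z) (A : Set X) (K : ℝ≥0)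
    (h : ∀ x ∈ A, ∀ y ∈ A, edist (f x) (f y) ≤ K * edist (g x) (g y)) {d : ℝ} (hd : 0 ≤ d) :
    μH[d] (f '' A) ≤ (K : ℝ≥0∞) ^ d * μH[d] (g '' A) := by
  classical
  rcases A.eq_empty_or_nonempty with rfl | ⟨a, ha⟩
  · simp
  have : Nonempty X := ⟨a⟩
  set k : Z → X := Function.invFunOn g A
  have hk : ∀ z ∈ g '' A, k z ∈ A ∧ g (k z) = z := fun z hz =>
    ⟨Function.invFunOn_mem hz, Function.invFunOn_eq hz⟩
  have hL : LipschitzOnWith K (f ∘ k) (g '' A) := by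
    intro z hz z' hz'
    have := h _ (hk z hz).1 _ (hk z' hz').1
    rwa [(hk z hz).2, (hk z' hz').2] at this
  refine le_trans (measure_mono ?_) (hL.hausdorffMeasure_image_le hd)
  rintro _ ⟨x, hx, rfl⟩
  refine ⟨g x, mem_image_of_mem _ hx, ?_⟩
  have h1 := h _ (hk (g x) (mem_image_of_mem _ hx)).1 x hx
  rw [(hk (g x) (mem_image_of_mem _ hx)).2, edist_self, mul_zero] at h1
  exact edist_le_zero.1 h1

/-- the area factor -/
def Jf {m : ℕ} (p : EE m →L[ℝ] ℝ) : ℝ := Real.sqrt (1 + ‖p‖ ^ 2)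

lemma one_le_Jf {m : ℕ} (p : EE m →L[ℝ] ℝ) : 1 ≤ Jf p := by
  rw [Jf, Real.one_le_sqrt]; nlinarith [sq_nonneg ‖p‖]
lemma Jf_pos {m : ℕ} (p : EE m →L[ℝ] ℝ) : 0 < Jf p := lt_of_lt_of_le one_pos (one_le_Jf p)
lemma Jf_sq {m : ℕ} (p : EE m →L[ℝ] ℝ) : Jf p ^ 2 = 1 + ‖p‖ ^ 2 := by
  rw [Jf, Real.sq_sqrt]; positivity
lemma continuous_Jf {m : ℕ} : Continuous (Jf (m := m)) := by unfold Jf; fun_prop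

lemma Jf_le {m : ℕ} (p q : EE m →L[ℝ] ℝ) {δ : ℝ} (h : ‖p - q‖ ≤ δ) : Jf p ≤ (1 + δ) * Jf q := by
  have hδ : 0 ≤ δ := (norm_nonneg _).trans h
  have h1 : ‖p‖ ≤ ‖q‖ + δ := by
    calc ‖p‖ = ‖q + (p - q)‖ := by congr 1; abel
      _ ≤ _ := (norm_add_le _ _).trans (by linarith)
  have h2 := Jf_sq q
  have h3 := one_le_Jf q
  have h4 : ‖q‖ ≤ Jf q := by
    rw [Jf]; apply Real.le_sqrt_of_sq_le; linarith
  have h5 : Jf p ^ 2 ≤ ((1 + δ) * Jf q) ^ 2 := by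
    rw [Jf_sq]
    have : ‖p‖ ^ 2 ≤ (‖q‖ + δ) ^ 2 := by gcongr
    nlinarith [norm_nonneg q, mul_nonneg hδ (norm_nonneg q), mul_le_mul_of_nonneg_left h4 hδ,
      mul_nonneg hδ (sub_nonneg.2 h3), sq_nonneg δ, mul_nonneg hδ hδ, mul_nonneg (sq_nonneg δ) (sub_nonneg.2 h3)]
  exact le_of_sq_le_sq h5 (by positivity) |> fun h => h

lemma muF_haar (m : ℕ) : (μH[(m:ℝ)] : Measure (EE m)).IsAddHaarMeasure := by
  have := isAddHaarMeasure_hausdorffMeasure (E := EE m)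
  simpa using this

lemma area_linear {m n : ℕ} (e : WithLp 2 (EE m × ℝ) ≃ₗᵢ[ℝ] EE n) (p : EE m →L[ℝ] ℝ)
    (s : Set (EE m)) :
    μH[(m:ℝ)] (gr e p '' s) = ENNReal.ofReal (Jf p) * μH[(m:ℝ)] s := by
  have := muF_haar m
  set a : EE m := (InnerProductSpace.toDual ℝ (EE m)).symm p
  have ha : ∀ v, p v = ⟪a, v⟫ := fun v => by simp [a]
  have han : ‖a‖ = ‖p‖ := by simp [a]
  have hJ := one_le_Jf p
  have hJ2 := Jf_sq p
  set J := Jf p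
  set c : ℝ := (1 + J)⁻¹
  set T : EE m →ₗ[ℝ] EE m := LinearMap.transvection (c • (p : EE m →ₗ[ℝ] ℝ)) a
  have hT : ∀ v, T v = v + (c * p v) • a := fun v => by simp [T, LinearMap.transvection.apply]
  have hdet : LinearMap.det T = J := by
    rw [LinearMap.transvection.det]
    have : p a = ‖p‖ ^ 2 := by rw [ha, real_inner_self_eq_norm_sq, han]
    simp only [LinearMap.smul_apply, ContinuousLinearMap.coe_coe, smul_eq_mul, this, c]
    field_simp
    linarith
  have hnorm : ∀ v, ‖T v‖ ^ 2 = ‖v‖ ^ 2 + (p v) ^ 2 := by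
    intro v
    rw [hT, norm_add_sq_real, inner_smul_right, norm_smul, real_inner_comm, ← ha, han, mul_pow,
      Real.norm_eq_abs, sq_abs]
    have : 2 * c + c ^ 2 * ‖p‖ ^ 2 = 1 := by
      have : ‖p‖ ^ 2 = J ^ 2 - 1 := by linarith
      rw [this]; simp only [c]; field_simp; ring
    linear_combination (p v) ^ 2 * this
  have key : ∀ x y, ‖gr e p x - gr e p y‖ = ‖T x - T y‖ := by
    intro x y
    have h1 := norm_gr_sub_sq e p x y
    rw [← map_sub, ← hnorm, map_sub] at h1
    exact (pow_left_inj₀ (norm_nonneg _) (norm_nonneg _) two_ne_zero).1 h1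
  have key' : ∀ x y, edist (gr e p x) (gr e p y) = edist (T x) (T y) := by
    intro x y
    rw [edist_dist, edist_dist, dist_eq_norm, dist_eq_norm, key]
  have e1 : μH[(m:ℝ)] (gr e p '' s) = μH[(m:ℝ)] (T '' s) := by
    apply le_antisymm
    · simpa using haus_le (gr e p) T s 1 (fun x _ y _ => by simp [key']) (d := m) (by positivity)
    · simpa using haus_le T (gr e p) s 1 (fun x _ y _ => by simp [key']) (d := m) (by positivity)
  rw [e1, Measure.addHaar_image_linearMap, hdet, abs_of_pos (by linarith)]

lemma area_piece_dist {m n : ℕ} (e : WithLp 2 (EE m × ℝ) ≃ₗᵢ[ℝ] EE n) (φ : EE m → ℝ)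
    (B : EE m →L[ℝ] ℝ) {δ : ℝ} {x y : EE m}
    (h : |φ x - φ y - B (x - y)| ≤ δ * ‖x - y‖) (hδ : 0 ≤ δ) :
    |‖gr e φ x - gr e φ y‖ - ‖gr e B x - gr e B y‖| ≤ δ * ‖gr e B x - gr e B y‖ := by
  have h1 : (gr e φ x - gr e φ y) - (gr e B x - gr e B y) = pt e 0 (φ x - φ y - B (x - y)) := by
    simp only [gr, ← pt_sub, map_sub]; simp
  have h2 : ‖pt e 0 (φ x - φ y - B (x - y))‖ ≤ |φ x - φ y - B (x - y)| := by
    simpa using norm_pt_le e 0 (φ x - φ y - B (x - y))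
  have h3 : ‖x - y‖ ≤ ‖gr e B x - gr e B y‖ := by
    have := norm_hc_le e (gr e B x - gr e B y)
    rw [hc_sub] at this
    simpa [gr] using this
  calc _ ≤ ‖(gr e φ x - gr e φ y) - (gr e B x - gr e B y)‖ := abs_norm_sub_norm_le _ _
    _ ≤ δ * ‖x - y‖ := by rw [h1]; exact h2.trans h
    _ ≤ _ := by gcongr

lemma area_piece {m n : ℕ} (e : WithLp 2 (EE m × ℝ) ≃ₗᵢ[ℝ] EE n) (φ : EE m → ℝ)
    (B : EE m →L[ℝ] ℝ) {δ : ℝ} (hδ : 0 < δ) (hδ1 : δ < 1) (A : Set (EE m)) (hA : MeasurableSet A)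
    (h1 : ∀ x ∈ A, ‖fderiv ℝ φ x - B‖ ≤ δ)
    (h2 : ∀ x ∈ A, ∀ y ∈ A, |φ x - φ y - B (x - y)| ≤ δ * ‖x - y‖) :
    μH[(m:ℝ)] (gr e φ '' A) ≤ ENNReal.ofReal ((1 + δ) ^ (m + 1)) *
      ∫⁻ y in A, ENNReal.ofReal (Jf (fderiv ℝ φ y)) ∂(μH[(m:ℝ)]) ∧
    ∫⁻ y in A, ENNReal.ofReal (Jf (fderiv ℝ φ y)) ∂(μH[(m:ℝ)]) ≤
      ENNReal.ofReal ((1 + δ) * ((1 - δ)⁻¹) ^ m) * μH[(m:ℝ)] (gr e φ '' A) := by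
  have hd : 0 < 1 - δ := by linarith
  have hJB := Jf_pos B
  constructor
  · have a1 := haus_le (gr e φ) (gr e B) A (Real.toNNReal (1 + δ)) (fun x hx y hy => by
      have := area_piece_dist e φ B (h2 x hx y hy) hδ.le
      rw [abs_le] at this
      rw [edist_dist, edist_dist, dist_eq_norm, dist_eq_norm]
      change _ ≤ ENNReal.ofReal (1 + δ) * _
      rw [← ENNReal.ofReal_mul (by linarith)]
      apply ENNReal.ofReal_le_ofReal; linarith) (d := m) (by positivity)
    rw [area_linear, ENNReal.rpow_natCast] at a1
    refine a1.trans ?_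
    have a2 : ENNReal.ofReal (Jf B) * μH[(m:ℝ)] A ≤ ENNReal.ofReal (1 + δ) *
        ∫⁻ y in A, ENNReal.ofReal (Jf (fderiv ℝ φ y)) ∂(μH[(m:ℝ)]) := by
      rw [← setLIntegral_const, ← lintegral_const_mul' _ _ ENNReal.ofReal_ne_top]
      apply setLIntegral_mono' hA
      intro x hx
      rw [← ENNReal.ofReal_mul (by linarith)]
      apply ENNReal.ofReal_le_ofReal
      apply Jf_le; rw [norm_sub_rev]; exact h1 x hx
    calc _ ≤ ENNReal.ofReal (1 + δ) ^ m * (ENNReal.ofReal (1 + δ) *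
        ∫⁻ y in A, ENNReal.ofReal (Jf (fderiv ℝ φ y)) ∂(μH[(m:ℝ)])) := by
          gcongr; exact le_rfl
      _ = _ := by rw [← mul_assoc, ← pow_succ, ENNReal.ofReal_pow (by linarith)]
  · have a1 := haus_le (gr e B) (gr e φ) A (Real.toNNReal ((1 - δ)⁻¹)) (fun x hx y hy => by
      have := area_piece_dist e φ B (h2 x hx y hy) hδ.le
      rw [abs_le] at this
      rw [edist_dist, edist_dist, dist_eq_norm, dist_eq_norm]
      change _ ≤ ENNReal.ofReal _ * _
      rw [← ENNReal.ofReal_mul (by positivity)]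
      apply ENNReal.ofReal_le_ofReal
      rw [inv_mul_eq_div, le_div_iff₀ hd]; linarith) (d := m) (by positivity)
    rw [area_linear, ENNReal.rpow_natCast] at a1
    have a2 : ∫⁻ y in A, ENNReal.ofReal (Jf (fderiv ℝ φ y)) ∂(μH[(m:ℝ)]) ≤
        ENNReal.ofReal (1 + δ) * (ENNReal.ofReal (Jf B) * μH[(m:ℝ)] A) := by
      rw [← setLIntegral_const, ← lintegral_const_mul' _ _ ENNReal.ofReal_ne_top]
      apply setLIntegral_mono' hA
      intro x hx
      rw [← ENNReal.ofReal_mul (by linarith)]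
      apply ENNReal.ofReal_le_ofReal
      apply Jf_le; exact h1 x hx
    refine a2.trans ?_
    calc _ ≤ ENNReal.ofReal (1 + δ) * (ENNReal.ofReal ((1 - δ)⁻¹) ^ m * μH[(m:ℝ)] (gr e φ '' A)) := by
          exact mul_le_mul' le_rfl a1
      _ = _ := by rw [ENNReal.ofReal_mul (by linarith), ENNReal.ofReal_pow (by positivity), mul_assoc]

lemma measure_le_of_cover {X : Type*} [MeasurableSpace X] (μ ν : Measure X) (C : ℝ≥0∞)
    (T : ℕ → Set X) (hT : ∀ i, MeasurableSet (T i)) (hc : μ (⋃ i, T i)ᶜ = 0)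
    (h : ∀ i A, MeasurableSet A → A ⊆ T i → μ A ≤ C * ν A) (A : Set X) (hA : MeasurableSet A) :
    μ A ≤ C * ν A := by
  have h1 : μ A = μ (⋃ i, A ∩ disjointed T i) := by
    rw [← inter_iUnion, iUnion_disjointed]
    refine le_antisymm ?_ (measure_mono inter_subset_left)
    calc μ A ≤ μ (A ∩ (⋃ i, T i) ∪ (⋃ i, T i)ᶜ) := measure_mono (by
          intro x hx; by_cases hx' : x ∈ ⋃ i, T i
          · exact Or.inl ⟨hx, hx'⟩
          · exact Or.inr hx')
      _ ≤ _ := by refine (measure_union_le _ _).trans ?_; rw [hc, add_zero]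
  have hd : ∀ i, MeasurableSet (A ∩ disjointed T i) := fun i =>
    hA.inter (MeasurableSet.disjointed hT i)
  have hdis : Pairwise (Function.onFun Disjoint fun i => A ∩ disjointed T i) := fun i j hij =>
    (disjoint_disjointed T hij).mono inter_subset_right inter_subset_right
  rw [h1, measure_iUnion hdis hd]
  calc ∑' i, μ (A ∩ disjointed T i) ≤ ∑' i, C * ν (A ∩ disjointed T i) :=
        ENNReal.tsum_le_tsum fun i => h i _ (hd i) (inter_subset_right.trans (disjointed_subset T i))
    _ = C * ν (⋃ i, A ∩ disjointed T i) := by rw [ENNReal.tsum_mul_left, measure_iUnion hdis hd]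
    _ ≤ C * ν A := by gcongr; exact iUnion_subset fun i => inter_subset_left

lemma area_cover {m : ℕ} {K : ℝ≥0} {φ : EE m → ℝ} (hφ : LipschitzWith K φ) {δ : ℝ} (hδ : 0 < δ) :
    ∃ (T : ℕ → Set (EE m)) (B : ℕ → EE m →L[ℝ] ℝ), (∀ i, MeasurableSet (T i)) ∧
      {x | DifferentiableAt ℝ φ x} ⊆ ⋃ i, T i ∧
      ∀ i, (∀ x ∈ T i, ‖fderiv ℝ φ x - B i‖ ≤ δ) ∧
       (∀ x ∈ T i, ∀ y ∈ T i, |φ x - φ y - B i (x - y)| ≤ δ * ‖x - y‖) := by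
  set D := {x | DifferentiableAt ℝ φ x} with hD
  have hDm : MeasurableSet D := measurableSet_of_differentiableAt ℝ φ
  set b := TopologicalSpace.denseSeq (EE m →L[ℝ] ℝ)
  set S : ℕ → Set (EE m) := fun j => D ∩ (fderiv ℝ φ) ⁻¹' (ball (b j) (δ / 3))
  have hSm : ∀ j, MeasurableSet (S j) := fun j => hDm.inter (measurable_fderiv ℝ φ measurableSet_ball)
  have hr : Real.toNNReal (δ / 3) ≠ 0 := by simpa using (by positivity : 0 < δ / 3)
  have := fun j => exists_partition_approximatesLinearOn_of_hasFDerivWithinAt φ (S j) (fderiv ℝ φ)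
    (fun x hx => (hx.1 : DifferentiableAt ℝ φ x).hasFDerivAt.hasFDerivWithinAt)
    (fun _ => Real.toNNReal (δ / 3)) (fun _ => hr)
  choose t A hdis htm hcov happ hA using this
  set T : ℕ × ℕ → Set (EE m) := fun p => S p.1 ∩ t p.1 p.2
  set k := (Nat.pairEquiv).symm
  refine ⟨fun i => T (k i), fun i => b (k i).1, fun i => (hSm _).inter (htm _ _), ?_, ?_⟩
  · intro x hx
    obtain ⟨j, hj⟩ := (TopologicalSpace.denseRange_denseSeq (EE m →L[ℝ] ℝ)).exists_dist_lt
      (fderiv ℝ φ x) (show 0 < δ / 3 by positivity)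
    have hxS : x ∈ S j := ⟨hx, by simpa [mem_ball] using hj⟩
    obtain ⟨l, hl⟩ := mem_iUnion.1 (hcov j hxS)
    exact mem_iUnion.2 ⟨k.symm (j, l), by simp only [Equiv.apply_symm_apply]; exact ⟨hxS, hl⟩⟩
  · intro i
    show (∀ x ∈ T (k i), ‖fderiv ℝ φ x - b (k i).1‖ ≤ δ) ∧ (∀ x ∈ T (k i), ∀ y ∈ T (k i), |φ x - φ y - b (k i).1 (x - y)| ≤ δ * ‖x - y‖)
    generalize k i = p
    obtain ⟨j, l⟩ := p
    refine ⟨fun x hx => ?_, fun x hx y hy => ?_⟩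
    · have : fderiv ℝ φ x ∈ ball (b j) (δ / 3) := hx.1.2
      rw [mem_ball, dist_eq_norm] at this
      linarith
    · have h1 := happ j l x hx y hy
      obtain ⟨z, hz, hz'⟩ := hA j ⟨x, hx.1⟩ l
      have h2 : ‖A j l - b j‖ < δ / 3 := by
        rw [hz']; simpa [dist_eq_norm] using hz.2
      have h3 : ‖(A j l - b j) (x - y)‖ ≤ δ / 3 * ‖x - y‖ :=
        ((A j l - b j).le_opNorm _).trans (by gcongr)
      have h4 : φ x - φ y - b j (x - y) = (φ x - φ y - A j l (x - y)) + (A j l - b j) (x - y) := by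
        simp
      have h5 : ((Real.toNNReal (δ / 3) : ℝ≥0) : ℝ) = δ / 3 := Real.coe_toNNReal _ (by positivity)
      rw [h5, Real.norm_eq_abs] at h1
      rw [Real.norm_eq_abs] at h3
      show |φ x - φ y - b j (x - y)| ≤ _
      rw [h4]
      refine (abs_add_le _ _).trans ?_
      nlinarith [norm_nonneg (x - y)]

theorem area_graph {m n : ℕ} (e : WithLp 2 (EE m × ℝ) ≃ₗᵢ[ℝ] EE n) {K : ℝ≥0} {φ : EE m → ℝ}
    (hφ : LipschitzWith K φ) :
    (μH[(m:ℝ)] : Measure (EE n)).restrict (range (gr e φ)) =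
      Measure.map (gr e φ) ((μH[(m:ℝ)] : Measure (EE m)).withDensity
        (fun y => ENNReal.ofReal (Jf (fderiv ℝ φ y)))) := by
  have := muF_haar m
  have hme := measurableEmbedding_gr e hφ.continuous
  rw [← hme.map_comap]
  congr 1
  set ν := Measure.comap (gr e φ) (μH[(m:ℝ)] : Measure (EE n))
  set ν' := (μH[(m:ℝ)] : Measure (EE m)).withDensity (fun y => ENNReal.ofReal (Jf (fderiv ℝ φ y)))
  have hν : ∀ A, ν A = μH[(m:ℝ)] (gr e φ '' A) := fun A => hme.comap_apply _ A
  have hν' : ∀ A, MeasurableSet A → ν' A = ∫⁻ y in A, ENNReal.ofReal (Jf (fderiv ℝ φ y)) ∂(μH[(m:ℝ)]) :=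
    fun A hA => withDensity_apply _ hA
  have hnull : (μH[(m:ℝ)] : Measure (EE m)) {x | DifferentiableAt ℝ φ x}ᶜ = 0 :=
    hφ.ae_differentiableAt
  have hgl : LipschitzWith (1 + K) (gr e φ) := LipschitzWith.of_dist_le_mul fun x y => by
    rw [dist_eq_norm, gr, gr, ← pt_sub, dist_eq_norm]
    refine (norm_pt_le e _ _).trans ?_
    have := hφ.dist_le_mul x y
    rw [Real.dist_eq, dist_eq_norm] at this
    push_cast; linarith
  have hνnull : ∀ A, (μH[(m:ℝ)] : Measure (EE m)) A = 0 → ν A = 0 := by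
    intro A hA
    rw [hν]
    have := hgl.hausdorffMeasure_image_le (d := m) (by positivity) A
    rw [hA, mul_zero] at this
    exact le_antisymm this bot_le
  have hν'null : ∀ A, (μH[(m:ℝ)] : Measure (EE m)) A = 0 → ν' A = 0 := fun A hA =>
    withDensity_absolutelyContinuous _ _ hA
  have main : ∀ δ : ℝ, 0 < δ → δ < 1 → ∀ A, MeasurableSet A →
      ν A ≤ ENNReal.ofReal ((1 + δ) ^ (m + 1)) * ν' A ∧
      ν' A ≤ ENNReal.ofReal ((1 + δ) * ((1 - δ)⁻¹) ^ m) * ν A := by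
    intro δ hδ hδ1 A hA
    obtain ⟨T, B, hTm, hcov, hT⟩ := area_cover hφ hδ
    have hnull' : (μH[(m:ℝ)] : Measure (EE m)) (⋃ i, T i)ᶜ = 0 :=
      measure_mono_null (compl_subset_compl.2 hcov) hnull
    have P : ∀ i A, MeasurableSet A → A ⊆ T i → _ := fun i A hA hAT =>
      area_piece e φ (B i) hδ hδ1 A hA (fun x hx => (hT i).1 x (hAT hx))
        (fun x hx y hy => (hT i).2 x (hAT hx) y (hAT hy))
    refine ⟨measure_le_of_cover ν ν' _ T hTm (hνnull _ hnull') (fun i A hA hAT => ?_) A hA,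
      measure_le_of_cover ν' ν _ T hTm (hν'null _ hnull') (fun i A hA hAT => ?_) A hA⟩
    · rw [hν, hν' A hA]; exact (P i A hA hAT).1
    · rw [hν, hν' A hA]; exact (P i A hA hAT).2
  have hlim : Tendsto (fun k : ℕ => 1 / ((k:ℝ) + 2)) atTop (𝓝 0) := by
    have := (tendsto_one_div_add_atTop_nhds_zero_nat (𝕜 := ℝ)).comp (tendsto_add_atTop_nat 1)
    refine this.congr fun k => ?_
    simp only [Function.comp_apply]; push_cast; ring
  have hpos : ∀ k : ℕ, 0 < 1 / ((k:ℝ) + 2) := fun k => by positivity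
  have hlt : ∀ k : ℕ, 1 / ((k:ℝ) + 2) < 1 := fun k => by
    rw [div_lt_one (by positivity)]; linarith [Nat.cast_nonneg (α := ℝ) k]
  ext A hA
  apply le_antisymm
  · by_cases htop : ν' A = ∞
    · rw [htop]; exact le_top
    have hl : Tendsto (fun k : ℕ => ENNReal.ofReal ((1 + 1 / ((k:ℝ) + 2)) ^ (m + 1)) * ν' A) atTop
        (𝓝 (ENNReal.ofReal ((1 + 0) ^ (m + 1)) * ν' A)) := by
      refine ENNReal.Tendsto.mul_const (ENNReal.tendsto_ofReal ?_) (Or.inr htop)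
      exact (tendsto_const_nhds.add hlim).pow _
    simp only [add_zero, one_pow, ENNReal.ofReal_one, one_mul] at hl
    exact ge_of_tendsto' hl fun k => (main _ (hpos k) (hlt k) A hA).1
  · by_cases htop : ν A = ∞
    · rw [htop]; exact le_top
    have hl : Tendsto (fun k : ℕ => ENNReal.ofReal ((1 + 1 / ((k:ℝ) + 2)) *
        ((1 - 1 / ((k:ℝ) + 2))⁻¹) ^ m) * ν A) atTop
        (𝓝 (ENNReal.ofReal ((1 + 0) * ((1 - 0)⁻¹) ^ m) * ν A)) := by
      refine ENNReal.Tendsto.mul_const (ENNReal.tendsto_ofReal ?_) (Or.inr htop)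
      exact (tendsto_const_nhds.add hlim).mul (((tendsto_const_nhds.sub hlim).inv₀ (by norm_num)).pow _)
    simp only [add_zero, one_pow, ENNReal.ofReal_one, one_mul, sub_zero, inv_one] at hl
    exact ge_of_tendsto' hl fun k => (main _ (hpos k) (hlt k) A hA).2

/-! ### Harmonic functions -/

/-- A smooth cut-off of one variable. -/
def gl (t : ℝ) : ℝ := expNegInvGlue (1 - t)

lemma gl_contDiff : ContDiff ℝ (⊤ : ℕ∞) gl :=
  expNegInvGlue.contDiff.comp (contDiff_const.sub contDiff_id)

lemma gl_zero {t : ℝ} (h : 1 ≤ t) : gl t = 0 := expNegInvGlue.zero_of_nonpos (by linarith)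
lemma gl_pos {t : ℝ} (h : t < 1) : 0 < gl t := expNegInvGlue.pos_of_pos (by linarith)
lemma gl_nonneg (t : ℝ) : 0 ≤ gl t := expNegInvGlue.nonneg _

def Zl (t : ℝ) : ℝ := ∫ τ in (1:ℝ)..t, gl τ

lemma Zl_hasDerivAt (t : ℝ) : HasDerivAt Zl (gl t) t :=
  (gl_contDiff.continuous).integral_hasStrictDerivAt 1 t |>.hasDerivAt

lemma Zl_contDiff : ContDiff ℝ (⊤ : ℕ∞) Zl := by
  have h : deriv Zl = gl := funext fun t => (Zl_hasDerivAt t).deriv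
  rw [contDiff_infty_iff_deriv, h]
  exact ⟨fun t => (Zl_hasDerivAt t).differentiableAt, gl_contDiff⟩

lemma Zl_zero {t : ℝ} (h : 1 ≤ t) : Zl t = 0 := by
  unfold Zl
  rw [intervalIntegral.integral_congr (g := fun _ => (0:ℝ))]
  · simp
  · intro τ hτ
    rw [uIcc_of_le h] at hτ
    exact gl_zero hτ.1

lemma hasFDerivAt_radial (x : EE n) (c : ℝ) (H : ℝ → ℝ) (H' : ℝ) (z : EE n)
    (h : HasDerivAt H H' (c * ‖z - x‖ ^ 2)) :
    HasFDerivAt (fun z => H (c * ‖z - x‖ ^ 2)) ((H' * (2 * c)) • innerSL ℝ (z - x)) z := by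
  have h1 : HasFDerivAt (fun z : EE n => c * ‖z - x‖ ^ 2) ((2 * c) • innerSL ℝ (z - x)) z := by
    have := ((hasFDerivAt_id z).sub_const x).norm_sq.const_mul c
    refine this.congr_fderiv ?_
    ext v; simp; ring
  refine (h.comp_hasFDerivAt z h1).congr_fderiv ?_
  ext v; simp; ring

lemma lap_radial (x : EE n) (c : ℝ) (H H' H'' : ℝ → ℝ) (h : ∀ t, HasDerivAt H (H' t) t)
    (h' : ∀ t, HasDerivAt H' (H'' t) t) (z : EE n) :
    lap (fun z => H (c * ‖z - x‖ ^ 2)) z =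
      4 * c ^ 2 * ‖z - x‖ ^ 2 * H'' (c * ‖z - x‖ ^ 2) + 2 * c * n * H' (c * ‖z - x‖ ^ 2) := by
  unfold lap
  have e1 : ∀ i : Fin n, (fun y => fderiv ℝ (fun z => H (c * ‖z - x‖ ^ 2)) y
      (EuclideanSpace.single i (1:ℝ))) =
      fun y => (H' (c * ‖y - x‖ ^ 2) * (2 * c)) * (y i - x i) := by
    intro i; ext y
    rw [(hasFDerivAt_radial x c H _ y (h _)).fderiv]
    have : ⟪y - x, EuclideanSpace.single i (1:ℝ)⟫ = y i - x i := by
      rw [EuclideanSpace.inner_single_right]; simp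
    simp only [smul_apply, innerSL_apply_apply, this, smul_eq_mul]
  have e2 : ∀ i : Fin n, fderiv ℝ (fun y => (H' (c * ‖y - x‖ ^ 2) * (2 * c)) * (y i - x i)) z
      (EuclideanSpace.single i (1:ℝ)) =
      H'' (c * ‖z - x‖ ^ 2) * (2 * c) ^ 2 * (z i - x i) ^ 2 + H' (c * ‖z - x‖ ^ 2) * (2 * c) := by
    intro i
    have a1 := (hasFDerivAt_radial x c H' _ z (h' _)).mul_const (2 * c)
    have a2 : HasFDerivAt (fun y : EE n => y i - x i) (EuclideanSpace.proj (𝕜 := ℝ) i : EE n →L[ℝ] ℝ) z :=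
      (EuclideanSpace.proj (𝕜 := ℝ) i : EE n →L[ℝ] ℝ).hasFDerivAt.sub_const _
    rw [(a1.fun_mul a2).fderiv]
    have : ⟪z - x, EuclideanSpace.single i (1:ℝ)⟫ = z i - x i := by
      rw [EuclideanSpace.inner_single_right]; simp
    simp only [smul_apply, innerSL_apply_apply, this, smul_eq_mul,
      add_apply]
    simp
    ring
  simp_rw [e1, e2]
  rw [Finset.sum_add_distrib, ← Finset.mul_sum, EuclideanSpace.norm_sq_eq]
  simp; ring

/-- The (unnormalised) radial bump. -/
def rb (y : EE n) : ℝ := gl (‖y‖ ^ 2)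

lemma rb_contDiff : ContDiff ℝ (⊤ : ℕ∞) (rb : EE n → ℝ) := gl_contDiff.comp (contDiff_norm_sq ℝ)

lemma rb_zero {y : EE n} (h : 1 ≤ ‖y‖) : rb y = 0 := gl_zero (one_le_pow₀ h)
lemma rb_nonneg (y : EE n) : 0 ≤ rb y := gl_nonneg _
lemma rb_pos {y : EE n} (h : ‖y‖ < 1) : 0 < rb y := gl_pos (by nlinarith [norm_nonneg y])

lemma rb_supp : HasCompactSupport (rb : EE n → ℝ) :=
  HasCompactSupport.of_support_subset_isCompact (isCompact_closedBall 0 1) (by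
    intro y hy
    by_contra h
    simp at h
    exact hy (rb_zero h.le))

lemma rb_integrable : Integrable (rb : EE n → ℝ) :=
  rb_contDiff.continuous.integrable_of_hasCompactSupport rb_supp

lemma rb_int_pos : 0 < ∫ y : EE n, rb y := by
  apply rb_contDiff.continuous.integral_pos_of_hasCompactSupport_nonneg_nonzero rb_supp
    rb_nonneg (x := 0)
  exact (rb_pos (by simp)).ne'

def IsWH (v : EE n → ℝ) (V : Set (EE n)) : Prop :=
  ∀ η : EE n → ℝ, ContDiff ℝ (⊤ : ℕ∞) η → HasCompactSupport η → tsupport η ⊆ V →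
    ∫ x, v x * lap η x = 0

/-- The scaled kernel. -/
def kr (x : EE n) (s : ℝ) (z : EE n) : ℝ := (s ^ n)⁻¹ * gl ((s ^ 2)⁻¹ * ‖z - x‖ ^ 2)

def kr' (x : EE n) (s : ℝ) (z : EE n) : ℝ :=
  -(s ^ (n+1))⁻¹ * (n * gl ((s ^ 2)⁻¹ * ‖z - x‖ ^ 2)
    + 2 * ((s ^ 2)⁻¹ * ‖z - x‖ ^ 2) * deriv gl ((s ^ 2)⁻¹ * ‖z - x‖ ^ 2))

lemma gl_hasDerivAt (t : ℝ) : HasDerivAt gl (deriv gl t) t :=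
  ((gl_contDiff.differentiable (by simp)) t).hasDerivAt

lemma kr_hasDerivAt (x z : EE n) {s : ℝ} (hs : 0 < s) :
    HasDerivAt (fun s => kr x s z) (kr' x s z) s := by
  have h1 : HasDerivAt (fun s : ℝ => (s ^ n)⁻¹) (-(n * (s ^ (n+1))⁻¹)) s := by
    refine ((hasDerivAt_pow n s).fun_inv (pow_ne_zero _ hs.ne')).congr_deriv ?_
    rcases n with _ | n
    · simp
    · rw [Nat.add_sub_cancel]; field_simp; ring
  have h2 : HasDerivAt (fun s : ℝ => (s ^ 2)⁻¹ * ‖z - x‖ ^ 2) (-2 * (s ^ 3)⁻¹ * ‖z - x‖ ^ 2) s := by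
    refine (((hasDerivAt_pow 2 s).fun_inv (pow_ne_zero _ hs.ne')).mul_const (‖z - x‖ ^ 2)).congr_deriv ?_
    field_simp
    norm_num
    ring
  refine (h1.fun_mul ((gl_hasDerivAt _).comp s h2)).congr_deriv ?_
  unfold kr'
  simp only [Function.comp_apply]
  field_simp
  ring

lemma kr_wh (x : EE n) {s : ℝ} (hs : 0 < s) (z : EE n) :
    kr' x s z = -(s * (s ^ n)⁻¹ / 2) * lap (fun z => Zl ((s ^ 2)⁻¹ * ‖z - x‖ ^ 2)) z := by
  rw [lap_radial x _ Zl gl (deriv gl) Zl_hasDerivAt gl_hasDerivAt]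
  unfold kr'
  field_simp
  ring

lemma one_le_scaled {x z : EE n} {s : ℝ} (hs : 0 < s) (h : s ≤ ‖z - x‖) :
    1 ≤ (s ^ 2)⁻¹ * ‖z - x‖ ^ 2 := by
  rw [← inv_pow, ← mul_pow]
  apply one_le_pow₀
  rw [inv_mul_eq_div, one_le_div hs]; exact h

lemma wh_kr' {v : EE n → ℝ} {V : Set (EE n)} (hv : IsWH v V) {x : EE n} {s : ℝ} (hs : 0 < s)
    (hV : closedBall x s ⊆ V) : ∫ z, v z * kr' x s z = 0 := by
  have hsup : Function.support (fun z => Zl ((s ^ 2)⁻¹ * ‖z - x‖ ^ 2)) ⊆ closedBall x s := by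
    intro z hz
    by_contra h
    rw [mem_closedBall, not_le, dist_eq_norm] at h
    exact hz (Zl_zero (one_le_scaled hs h.le))
  have := hv (fun z => Zl ((s ^ 2)⁻¹ * ‖z - x‖ ^ 2))
    (Zl_contDiff.comp (contDiff_const.mul ((contDiff_norm_sq ℝ).comp (contDiff_id.sub contDiff_const))))
    (HasCompactSupport.of_support_subset_isCompact (isCompact_closedBall x s) hsup)
    ((closure_minimal hsup isClosed_closedBall).trans hV)
  simp_rw [kr_wh x hs]
  calc _ = ∫ z, (-(s * (s ^ n)⁻¹ / 2)) * (v z * lap (fun z => Zl ((s ^ 2)⁻¹ * ‖z - x‖ ^ 2)) z) := by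
        congr 1; ext z; ring
    _ = 0 := by rw [integral_const_mul, this, mul_zero]

lemma kr_zero {x z : EE n} {s : ℝ} (hs : 0 < s) (h : s ≤ ‖z - x‖) : kr x s z = 0 := by
  unfold kr; rw [gl_zero (one_le_scaled hs h), mul_zero]

lemma deriv_gl_zero {t : ℝ} (h : 1 < t) : deriv gl t = 0 := by
  have : gl =ᶠ[𝓝 t] fun _ => 0 := by
    filter_upwards [lt_mem_nhds h] with a ha using gl_zero ha.le
  rw [this.deriv_eq]; simp

lemma kr'_zero {x z : EE n} {s : ℝ} (hs : 0 < s) (h : s < ‖z - x‖) : kr' x s z = 0 := by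
  have : 1 < (s ^ 2)⁻¹ * ‖z - x‖ ^ 2 := by
    rw [← inv_pow, ← mul_pow]
    apply one_lt_pow₀ _ (by norm_num)
    rw [inv_mul_eq_div, one_lt_div hs]; exact h
  unfold kr'; rw [gl_zero this.le, deriv_gl_zero this]; simp

lemma kr_eq (x : EE n) {s : ℝ} (hs : 0 < s) (z : EE n) :
    kr x s z = (s ^ n)⁻¹ * rb (s⁻¹ • (z - x)) := by
  unfold kr rb
  rw [norm_smul, mul_pow, norm_inv, Real.norm_of_nonneg hs.le, inv_pow]

lemma kr_continuous (x : EE n) (s : ℝ) : Continuous (kr x s) := by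
  unfold kr
  exact continuous_const.mul (gl_contDiff.continuous.comp (by fun_prop))

lemma kr_supp (x : EE n) {s : ℝ} (hs : 0 < s) : HasCompactSupport (kr x s) :=
  HasCompactSupport.of_support_subset_isCompact (isCompact_closedBall x s) (by
    intro y hy
    by_contra h
    rw [mem_closedBall, not_le, dist_eq_norm] at h
    exact hy (kr_zero hs h.le))

lemma int_kr_eq (v : EE n → ℝ) (x : EE n) {s : ℝ} (hs : 0 < s) :
    ∫ z, v z * kr x s z = ∫ y, v (x + s • y) * rb y := by
  have h1 := Measure.integral_comp_smul_of_nonneg (μ := volume) (fun z : EE n => v (x + z) * rb (s⁻¹ • z)) s (hR := hs.le)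
  simp only [inv_smul_smul₀ hs.ne'] at h1
  rw [h1, ← integral_add_left_eq_self (fun z => v z * kr x s z) x]
  simp_rw [kr_eq x hs, add_sub_cancel_left]
  rw [smul_eq_mul, ← integral_const_mul]
  congr 1; ext z
  simp; ring

lemma mean_const {v : EE n → ℝ} {V : Set (EE n)} (hc : Continuous v) (hv : IsWH v V) {x : EE n}
    {s : ℝ} (hs : 0 < s) (hV : closedBall x s ⊆ V) :
    HasDerivAt (fun s => ∫ z, v z * kr x s z) 0 s := by
  have hK : IsCompact (Icc (s/2) (2*s) ×ˢ closedBall x (2*s)) :=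
    isCompact_Icc.prod (isCompact_closedBall _ _)
  have hcont : ContinuousOn (fun p : ℝ × EE n => v p.2 * kr' x p.1 p.2)
      (Icc (s/2) (2*s) ×ˢ closedBall x (2*s)) := by
    have hne : ∀ p ∈ (Icc (s/2) (2*s) ×ˢ closedBall x (2*s)), p.1 ≠ 0 := by
      rintro ⟨a, b⟩ h; have := h.1.1; simp at this ⊢; intro h'; linarith
    have h2 : ContinuousOn (fun p : ℝ × EE n => (p.1 ^ 2)⁻¹ * ‖p.2 - x‖ ^ 2)
      (Icc (s/2) (2*s) ×ˢ closedBall x (2*s)) :=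
      ContinuousOn.mul (ContinuousOn.inv₀ (by fun_prop) fun p hp => pow_ne_zero _ (hne p hp))
        (by fun_prop)
    have hgl := gl_contDiff.continuous
    have hgl' : Continuous (deriv gl) := gl_contDiff.continuous_deriv (by simp)
    unfold kr'
    refine ContinuousOn.mul (by fun_prop) (ContinuousOn.mul
      (ContinuousOn.neg (ContinuousOn.inv₀ (by fun_prop) fun p hp => pow_ne_zero _ (hne p hp))) ?_)
    exact ((continuousOn_const).mul (hgl.comp_continuousOn h2)).add
      ((continuousOn_const.mul h2).mul (hgl'.comp_continuousOn h2))
  obtain ⟨C, hC⟩ := hK.exists_bound_of_continuousOn hcont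
  have hz := wh_kr' hv hs hV
  rw [← hz]
  have hmem : Ioo (s/2) (2*s) ∈ 𝓝 s := Ioo_mem_nhds (by linarith) (by linarith)
  refine (hasDerivAt_integral_of_dominated_loc_of_deriv_le (F := fun s z => v z * kr x s z)
    (F' := fun s z => v z * kr' x s z)
    (bound := (closedBall x (2*s)).indicator fun _ => C) hmem ?_ ?_ ?_ ?_ ?_ ?_).2
  · exact Eventually.of_forall fun t => (hc.mul (kr_continuous x t)).aestronglyMeasurable
  · exact (hc.mul (kr_continuous x s)).integrable_of_hasCompactSupport (kr_supp x hs).mul_left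
  · have hgl := gl_contDiff.continuous
    have hgl' : Continuous (deriv gl) := gl_contDiff.continuous_deriv (by simp)
    apply Continuous.aestronglyMeasurable
    unfold kr'
    fun_prop
  · refine Eventually.of_forall fun z t ht => ?_
    have ht0 : 0 < t := by have := ht.1; linarith
    by_cases hz : z ∈ closedBall x (2*s)
    · rw [indicator_of_mem hz]
      exact hC (t, z) ⟨⟨ht.1.le, ht.2.le⟩, hz⟩
    · rw [indicator_of_notMem hz]
      rw [mem_closedBall, not_le, dist_eq_norm] at hz
      rw [kr'_zero ht0 (by linarith [ht.2])]; simp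
  · exact (integrable_indicator_iff measurableSet_closedBall).2
      (integrableOn_const (measure_closedBall_lt_top.ne))
  · refine Eventually.of_forall fun z t ht => ?_
    have ht0 : 0 < t := by have := ht.1; linarith
    exact (kr_hasDerivAt x z ht0).const_mul (v z)

lemma mean_value {v : EE n → ℝ} {V : Set (EE n)} (hc : Continuous v) (hv : IsWH v V) {x : EE n}
    {s : ℝ} (hs : 0 < s) (hV : closedBall x s ⊆ V) :
    ∫ y, v (x + s • y) * rb y = v x * ∫ y : EE n, rb y := by
  have hconst : ∀ t ∈ Ioc 0 s, ∫ y, v (x + t • y) * rb y = ∫ y, v (x + s • y) * rb y := by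
    intro t ht
    rw [← int_kr_eq v x ht.1, ← int_kr_eq v x hs]
    have hd : ∀ τ ∈ Icc t s, HasDerivAt (fun s => ∫ z, v z * kr x s z) 0 τ := fun τ hτ =>
      mean_const hc hv (ht.1.trans_le hτ.1) ((closedBall_subset_closedBall hτ.2).trans hV)
    exact ((constant_of_has_deriv_right_zero
      (fun τ hτ => (hd τ hτ).continuousAt.continuousWithinAt)
      (fun τ hτ => (hd τ ⟨hτ.1, hτ.2.le⟩).hasDerivWithinAt)) s ⟨ht.2, le_rfl⟩).symm
  have hcont : Continuous fun t : ℝ => ∫ y, v (x + t • y) * rb y := by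
    have := continuous_parametric_integral_of_continuous (μ := (volume : Measure (EE n)))
      (f := fun (t : ℝ) y => v (x + t • y) * rb y) (by
        have := rb_contDiff (n := n) |>.continuous
        simp only [Function.uncurry_def]
        fun_prop) (s := closedBall 0 1) (isCompact_closedBall 0 1)
    convert this using 2 with t
    symm
    apply setIntegral_eq_integral_of_forall_compl_eq_zero
    intro y hy
    simp at hy
    rw [rb_zero hy.le, mul_zero]
  have h0 : Tendsto (fun t : ℝ => ∫ y, v (x + t • y) * rb y) (𝓝[>] 0) (𝓝 (v x * ∫ y : EE n, rb y)) := by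
    have := hcont.tendsto 0
    simp only [zero_smul, add_zero, integral_const_mul] at this
    exact this.mono_left nhdsWithin_le_nhds
  refine tendsto_nhds_unique (tendsto_const_nhds.congr' ?_) h0
  filter_upwards [Ioc_mem_nhdsGT hs] with t ht using (hconst t ht).symm

/-- Strong maximum principle, local form. -/
lemma wh_zero {v : EE n → ℝ} {V : Set (EE n)} (hc : Continuous v) (hv : IsWH v V) {x : EE n}
    {s : ℝ} (hs : 0 < s) (hV : closedBall x s ⊆ V) (h0 : ∀ x, 0 ≤ v x) (hx : v x = 0)
    {z : EE n} (hz : z ∈ ball x s) : v z = 0 := by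
  have h := mean_value hc hv hs hV
  rw [hx, zero_mul, ← int_kr_eq v x hs] at h
  have hnn : ∀ z, 0 ≤ v z * kr x s z := fun z => by
    rw [kr_eq x hs]
    exact mul_nonneg (h0 z) (mul_nonneg (by positivity) (rb_nonneg _))
  have hcc : Continuous fun z => v z * kr x s z := hc.mul (kr_continuous x s)
  have hi : Integrable fun z => v z * kr x s z :=
    hcc.integrable_of_hasCompactSupport (kr_supp x hs).mul_left
  have := (integral_eq_zero_iff_of_nonneg hnn hi).1 h
  have h2 := congrFun ((hcc.ae_eq_iff_eq volume continuous_const).1 this) z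
  have h3 : 0 < kr x s z := by
    rw [kr_eq x hs]
    refine mul_pos (by positivity) (rb_pos ?_)
    rw [norm_smul, norm_inv, Real.norm_of_nonneg hs.le, inv_mul_eq_div, div_lt_one hs,
      ← dist_eq_norm]
    exact hz
  exact (mul_eq_zero.1 h2).resolve_right h3.ne'

/-- Liouville. -/
lemma liouville {v : EE n → ℝ} {L : ℝ≥0} (hL : LipschitzWith L v) (hv : IsWH v univ)
    (ℓ : EE n →L[ℝ] ℝ) (N : EE n) (hN : ℓ N < 0) (h0 : ∀ x, ℓ x < 0 → v x = 0) (x : EE n) : v x = 0 := by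
  obtain ⟨Lr, hLr⟩ := rb_contDiff (n := n) |>.lipschitzWith_of_hasCompactSupport rb_supp (by simp)
  have hc := hL.continuous
  have hrbc := rb_contDiff (n := n) |>.continuous
  have key : ∀ a x : EE n, v (x + a) - v x = v a - v 0 := by
    intro a x
    set d : EE n → ℝ := fun x => v (x + a) - v x with hd
    have hdc : Continuous d := by fun_prop
    have hdb : ∀ x, |d x| ≤ L * ‖a‖ := fun x => by
      have := hL.dist_le_mul (x + a) x
      simpa [Real.dist_eq] using this
    have hdm : ∀ x (s : ℝ), 0 < s → ∫ y, d (s • y) * rb (y - s⁻¹ • x) = d x * ∫ y : EE n, rb y := by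
      intro x s hs
      rw [← integral_add_right_eq_self _ (s⁻¹ • x)]
      simp only [smul_add, smul_inv_smul₀ hs.ne', add_sub_cancel_right]
      have m1 := mean_value hc hv hs (subset_univ (closedBall x s))
      have m2 := mean_value hc hv hs (subset_univ (closedBall (x + a) s))
      have hi : ∀ x : EE n, Integrable fun y => v (x + s • y) * rb y := fun x =>
        Continuous.integrable_of_hasCompactSupport (by fun_prop) rb_supp.mul_left
      simp only [hd]
      rw [sub_mul, ← m1, ← m2, ← integral_sub (hi _) (hi _)]
      congr 1; ext y
      rw [show s • y + x + a = x + a + s • y by abel, add_comm (s • y) x]; ring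
    have hest : ∀ s : ℝ, ‖x‖ < s → |d x - d 0| * ∫ y : EE n, rb y ≤
        (L * ‖a‖ * Lr * ‖x‖ * (volume (closedBall (0 : EE n) 2)).toReal) * s⁻¹ := by
      intro s hsx
      have hs : 0 < s := (norm_nonneg x).trans_lt hsx
      have hi : ∀ x : EE n, Integrable fun y => d (s • y) * rb (y - s⁻¹ • x) := fun x => by
        refine Continuous.integrable_of_hasCompactSupport (by fun_prop) ?_
        apply HasCompactSupport.mul_left
        exact (rb_supp.comp_homeomorph (Homeomorph.subRight (s⁻¹ • x)))
      rw [← abs_of_pos (rb_int_pos (n := n)), ← abs_mul, sub_mul, ← hdm x s hs, ← hdm 0 s hs,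
        ← integral_sub (hi _) (hi _)]
      have : ∀ y, ‖d (s • y) * rb (y - s⁻¹ • x) - d (s • y) * rb (y - s⁻¹ • (0 : EE n))‖ ≤
          (closedBall (0 : EE n) 2).indicator (fun _ => L * ‖a‖ * (Lr * (s⁻¹ * ‖x‖))) y := by
        intro y
        have hsm : ‖s⁻¹ • x‖ = s⁻¹ * ‖x‖ := by rw [norm_smul, norm_inv, Real.norm_of_nonneg hs.le]
        by_cases hy : y ∈ closedBall (0 : EE n) 2
        · rw [indicator_of_mem hy, ← mul_sub, norm_mul]
          have := hLr.dist_le_mul (y - s⁻¹ • x) (y - s⁻¹ • (0 : EE n))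
          rw [dist_eq_norm, dist_eq_norm] at this
          gcongr
          · exact hdb _
          · refine this.trans ?_
            simp [norm_smul, abs_of_pos hs]
        · rw [indicator_of_notMem hy]
          simp at hy
          have h1 : s⁻¹ * ‖x‖ ≤ 1 := by rw [inv_mul_eq_div, div_le_one hs]; exact hsx.le
          rw [rb_zero, rb_zero]
          · simp
          · simp; linarith
          · have := norm_sub_norm_le y (s⁻¹ • x)
            linarith
      have h2 := norm_integral_le_of_norm_le (μ := volume) ?_ (Eventually.of_forall this)
      · rw [integral_indicator measurableSet_closedBall, setIntegral_const, Real.norm_eq_abs] at h2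
        refine h2.trans (le_of_eq ?_)
        simp [Measure.real]; ring
      · exact (integrable_indicator_iff measurableSet_closedBall).2
          (integrableOn_const (measure_closedBall_lt_top.ne))
    have hlim : |d x - d 0| * ∫ y : EE n, rb y ≤ 0 := by
      have : Tendsto (fun s : ℝ => (L * ‖a‖ * Lr * ‖x‖ * (volume (closedBall (0 : EE n) 2)).toReal) * s⁻¹)
        atTop (𝓝 0) := by
        simpa using (tendsto_inv_atTop_zero (𝕜 := ℝ)).const_mul (L * ‖a‖ * Lr * ‖x‖ * (volume (closedBall (0 : EE n) 2)).toReal)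
      refine ge_of_tendsto this ?_
      filter_upwards [eventually_gt_atTop ‖x‖] with s hs using hest s hs
    have h3 : |d x - d 0| ≤ 0 := by
      by_contra h; push Not at h
      exact absurd hlim (not_le.2 (mul_pos h rb_int_pos))
    have := abs_nonpos_iff.1 h3
    simp [hd] at this
    linarith
  -- choose a far point in the half space
  obtain ⟨c, hc1⟩ : ∃ c : ℝ, ℓ x + c * ℓ N < 0 ∧ c * ℓ N < 0 := by
    refine ⟨(|ℓ x| + 1) / (-ℓ N), ?_⟩
    have : (|ℓ x| + 1) / (-ℓ N) * ℓ N = -(|ℓ x| + 1) := by field_simp [hN.ne]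
    rw [this]
    constructor <;> linarith [le_abs_self (ℓ x), abs_nonneg (ℓ x)]
  have k1 := key x (c • N)
  rw [h0 (c • N) (by simp; exact hc1.2), h0 (c • N + x) (by simp; linarith [hc1.1])] at k1
  have hN0 := key N 0
  -- v x = v 0 for all x, and v N = 0
  have k2 := key N (c • N)
  rw [h0 (c • N) (by simp; exact hc1.2), h0 (c • N + N) (by simp; linarith [hc1.2]), h0 N hN] at k2
  linarith

lemma lap_congr {u v : EE n → ℝ} {x : EE n} (h : u =ᶠ[𝓝 x] v) : lap u x = lap v x := by
  unfold lap
  congr 1; ext i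
  have : (fun y => fderiv ℝ u y (EuclideanSpace.single i (1:ℝ))) =ᶠ[𝓝 x]
      fun y => fderiv ℝ v y (EuclideanSpace.single i (1:ℝ)) := by
    filter_upwards [h.fderiv (𝕜 := ℝ)] with y hy
    rw [hy]
  rw [this.fderiv_eq]

lemma kr_contDiff (x : EE n) (s : ℝ) : ContDiff ℝ (⊤ : ℕ∞) (kr x s) := by
  unfold kr
  exact   (contDiff_const (c := (s ^ n)⁻¹)).mul (gl_contDiff.comp ((contDiff_const (c := (s ^ 2)⁻¹)).mul
    ((contDiff_norm_sq ℝ).comp (contDiff_id.sub contDiff_const))))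

lemma lap_kr (x : EE n) (s : ℝ) (z : EE n) :
    lap (kr 0 s) (x - z) = lap (kr x s) z := by
  have h1 : ∀ t, HasDerivAt (fun t => (s ^ n)⁻¹ * gl t) ((s ^ n)⁻¹ * deriv gl t) t :=
    fun t => (gl_hasDerivAt t).const_mul _
  have h2 : ∀ t, HasDerivAt (fun t => (s ^ n)⁻¹ * deriv gl t) ((s ^ n)⁻¹ * deriv (deriv gl) t) t :=
    fun t => by
      have hd : ContDiff ℝ (⊤ : ℕ∞) (deriv gl) := (contDiff_infty_iff_deriv.1 gl_contDiff).2
      exact ((hd.differentiable (by simp)) t).hasDerivAt.const_mul _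
  have := lap_radial (0 : EE n) (s ^ 2)⁻¹ _ _ _ h1 h2 (x - z)
  have h3 := lap_radial x (s ^ 2)⁻¹ _ _ _ h1 h2 z
  rw [sub_zero, norm_sub_rev] at this
  exact this.trans h3.symm

lemma wh_smooth {v : EE n → ℝ} {V : Set (EE n)} (hc : Continuous v) (hv : IsWH v V)
    (hV : IsOpen V) : ContDiffOn ℝ 2 v V ∧ ∀ x ∈ V, lap v x = 0 := by
  have hli : LocallyIntegrable v volume := hc.locallyIntegrable
  have key : ∀ x ∈ V, ContDiffAt ℝ 2 v x ∧ lap v x = 0 := by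
    intro x hx
    obtain ⟨s, hs, hsV⟩ := Metric.isOpen_iff.1 hV x hx
    set t := s / 3 with ht
    have ht0 : 0 < t := by positivity
    set c := ∫ y : EE n, rb y with hcdef
    have hc0 : c ≠ 0 := rb_int_pos.ne'
    set W : EE n → ℝ := convolution v (kr 0 t) (ContinuousLinearMap.mul ℝ ℝ) volume with hW
    have hks : HasCompactSupport (kr (0 : EE n) t) := kr_supp 0 ht0
    have hkc := kr_contDiff (0 : EE n) t
    have hWc : ContDiff ℝ (⊤ : ℕ∞) W := hks.contDiff_convolution_right _ hli hkc
    have hvW : v =ᶠ[𝓝 x] fun y => c⁻¹ * W y := by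
      filter_upwards [ball_mem_nhds x ht0] with y hy
      have hm := mean_value hc hv ht0 (x := y) ((closedBall_subset_ball' (ε₂ := s) (by
        rw [mem_ball] at hy; linarith)).trans hsV)
      rw [← int_kr_eq v y ht0] at hm
      have : W y = ∫ z, v z * kr y t z := by
        simp only [hW, convolution_def]
        congr 1; ext z
        simp [kr, norm_sub_rev y z]
      rw [this, hm, ← hcdef]; field_simp
    have hfd : ∀ (g : EE n → ℝ), HasCompactSupport g → ContDiff ℝ (⊤ : ℕ∞) g → ∀ y a,
        fderiv ℝ (convolution v g (ContinuousLinearMap.mul ℝ ℝ) volume) y a =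
        convolution v (fun z => fderiv ℝ g z a) (ContinuousLinearMap.mul ℝ ℝ) volume y := by
      intro g hg hgc y a
      rw [(hg.hasFDerivAt_convolution_right (ContinuousLinearMap.mul ℝ ℝ) hli
        (hgc.of_le (by simp)) y).fderiv]
      rw [convolution_precompR_apply _ hli (hg.fderiv (𝕜 := ℝ)) (hgc.continuous_fderiv (by simp))]
    have hsupp : ∀ (g : EE n → ℝ), HasCompactSupport g → ∀ a, HasCompactSupport (fun z => fderiv ℝ g z a) :=
      fun g hg a => hg.fderiv_apply (𝕜 := ℝ) a
    have hcd : ∀ (g : EE n → ℝ), ContDiff ℝ (⊤ : ℕ∞) g → ∀ a, ContDiff ℝ (⊤ : ℕ∞) (fun z => fderiv ℝ g z a) :=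
      fun g hg a => (hg.fderiv_right (m := (⊤ : ℕ∞)) (by simp)).clm_apply contDiff_const
    refine ⟨((contDiff_const.mul (hWc.of_le (by norm_cast))).contDiffAt).congr_of_eventuallyEq hvW, ?_⟩
    rw [lap_congr hvW]
    have e1 : lap (fun y => c⁻¹ * W y) x = c⁻¹ * lap W x := by
      unfold lap
      rw [Finset.mul_sum]
      congr 1; ext i
      have : (fun y => fderiv ℝ (fun y => c⁻¹ * W y) y (EuclideanSpace.single i (1:ℝ))) =
          fun y => c⁻¹ * fderiv ℝ W y (EuclideanSpace.single i (1:ℝ)) := by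
        ext y
        rw [fderiv_const_mul ((hWc.differentiable (by simp)) y)]; simp
      rw [this, fderiv_const_mul (((hcd W hWc _).differentiable (by simp)) x)]; simp
    have e2 : lap W x = ∫ z, v z * lap (kr 0 t) (x - z) := by
      unfold lap
      have hi : ∀ i : Fin n, Integrable fun z => v z * fderiv ℝ (fun y => fderiv ℝ (kr (0 : EE n) t) y
          (EuclideanSpace.single i (1:ℝ))) (x - z) (EuclideanSpace.single i (1:ℝ)) := by
        intro i
        have q1 := hsupp _ (hsupp _ hks (EuclideanSpace.single i (1:ℝ))) (EuclideanSpace.single i (1:ℝ))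
        have q2 := hcd _ (hcd _ hkc (EuclideanSpace.single i (1:ℝ))) (EuclideanSpace.single i (1:ℝ))
        exact (hc.mul (q2.continuous.comp (continuous_const.sub continuous_id))).integrable_of_hasCompactSupport
          ((q1.comp_homeomorph (Homeomorph.subLeft x)).mul_left)
      simp_rw [Finset.mul_sum]
      rw [integral_finsetSum _ fun i _ => hi i]
      congr 1; ext i
      have : (fun y => fderiv ℝ W y (EuclideanSpace.single i (1:ℝ))) = convolution v
          (fun z => fderiv ℝ (kr 0 t) z (EuclideanSpace.single i (1:ℝ))) (ContinuousLinearMap.mul ℝ ℝ) volume := by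
        ext y; exact hfd _ hks hkc y _
      rw [this, hfd _ (hsupp _ hks _) (hcd _ hkc _)]
      rfl
    rw [e1, e2]
    simp_rw [lap_kr]
    rw [hv (kr x t) (kr_contDiff x t) (kr_supp x ht0), mul_zero]
    refine (closure_minimal (fun y hy => ?_) isClosed_closedBall).trans
      ((closedBall_subset_ball (show t < s by linarith)).trans hsV)
    by_contra h
    rw [mem_closedBall, not_le, dist_eq_norm] at h
    exact hy (kr_zero ht0 h.le)
  exact ⟨fun x hx => (key x hx).1.contDiffWithinAt, fun x hx => (key x hx).2⟩

/-! ### Calculus of Lipschitz functions -/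

/-- Standard basis vector. -/
abbrev bs (i : Fin n) : EE n := EuclideanSpace.single i (1:ℝ)

/-- Directional derivative. -/
def dd (v : EE n) (w : EE n → ℝ) (x : EE n) : ℝ := fderiv ℝ w x v

/-- Product of gradients. -/
def gd (w ζ : EE n → ℝ) (x : EE n) : ℝ := ∑ i : Fin n, dd (bs i) w x * dd (bs i) ζ x

lemma lap_eq (w : EE n → ℝ) (x : EE n) : lap w x = ∑ i : Fin n, dd (bs i) (dd (bs i) w) x := rfl

lemma inner_gradient (w ζ : EE n → ℝ) (x : EE n) : ⟪gradient w x, gradient ζ x⟫ = gd w ζ x := by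
  unfold gd dd
  rw [PiLp.inner_apply]
  congr 1; ext i
  have : ∀ w : EE n → ℝ, fderiv ℝ w x (bs i) = gradient w x i := by
    intro w
    rw [← inner_gradient_left]
    rw [EuclideanSpace.inner_single_right]; simp
  rw [this, this]
  simp [mul_comm]

lemma measurable_dd (v : EE n) (w : EE n → ℝ) : Measurable (dd v w) :=
  measurable_fderiv_apply_const ℝ w v

lemma dd_le {L : ℝ≥0} {w : EE n → ℝ} (hw : LipschitzWith L w) (v x : EE n) : |dd v w x| ≤ L * ‖v‖ :=
  ((fderiv ℝ w x).le_opNorm v).trans (by gcongr; exact norm_fderiv_le_of_lipschitz ℝ hw)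

lemma dd_le' {L : ℝ≥0} {w : EE n → ℝ} (hw : LipschitzWith L w) (i : Fin n) (x : EE n) :
    |dd (bs i) w x| ≤ L := by simpa using dd_le hw (bs i) x

lemma measurable_gd (w ζ : EE n → ℝ) : Measurable (gd w ζ) :=
  Finset.measurable_fun_sum _ fun i _ => (measurable_dd _ w).mul (measurable_dd _ ζ)

lemma gd_comm (w ζ : EE n → ℝ) (x : EE n) : gd w ζ x = gd ζ w x := by
  unfold gd; congr 1; ext i; ring

lemma gd_le {L M : ℝ≥0} {w ζ : EE n → ℝ} (hw : LipschitzWith L w) (hz : LipschitzWith M ζ) (x : EE n) :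
    |gd w ζ x| ≤ n * (L * M) := by
  unfold gd
  refine (Finset.abs_sum_le_sum_abs _ _).trans ?_
  calc _ ≤ ∑ i : Fin n, (L * M : ℝ) := by
        refine Finset.sum_le_sum fun i _ => ?_
        rw [abs_mul]
        exact mul_le_mul (dd_le' hw i x) (dd_le' hz i x) (abs_nonneg _) L.2
    _ = _ := by simp

/-- Smooth compactly supported functions. -/
def SC (η : EE n → ℝ) : Prop := ContDiff ℝ (⊤ : ℕ∞) η ∧ HasCompactSupport η

/-- Lipschitz compactly supported functions. -/
def LC (ζ : EE n → ℝ) : Prop := (∃ C : ℝ≥0, LipschitzWith C ζ) ∧ HasCompactSupport ζ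

lemma SC.lc {η : EE n → ℝ} (h : SC η) : LC η :=
  ⟨h.1.lipschitzWith_of_hasCompactSupport h.2 (by simp), h.2⟩

lemma SC.dd {η : EE n → ℝ} (h : SC η) (v : EE n) : SC (dd v η) :=
  ⟨(h.1.fderiv_right (m := (⊤ : ℕ∞)) (by simp)).clm_apply contDiff_const, h.2.fderiv_apply (𝕜 := ℝ) v⟩

lemma SC.diff {η : EE n → ℝ} (h : SC η) (x : EE n) : DifferentiableAt ℝ η x :=
  h.1.differentiable (by simp) x

lemma LC.cont {η : EE n → ℝ} (h : LC η) : Continuous η := h.1.choose_spec.continuous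
lemma SC.cont {η : EE n → ℝ} (h : SC η) : Continuous η := h.1.continuous

lemma tsupport_dd (v : EE n) (w : EE n → ℝ) : tsupport (dd v w) ⊆ tsupport w := by
  refine (closure_minimal ?_ (isClosed_tsupport w))
  intro x hx
  apply support_fderiv_subset ℝ
  intro h
  apply hx
  simp [_root_.dd, h]

lemma dd_zero_of_notMem {v : EE n} {w : EE n → ℝ} {x : EE n} (h : x ∉ tsupport w) : dd v w x = 0 :=
  image_eq_zero_of_notMem_tsupport fun h' => h (tsupport_dd v w h')

lemma lap_zero_of_notMem {w : EE n → ℝ} {x : EE n} (h : x ∉ tsupport w) : lap w x = 0 := by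
  rw [lap_eq]
  exact Finset.sum_eq_zero fun i _ => dd_zero_of_notMem fun h' => h (tsupport_dd _ w h')

lemma SC.lap {η : EE n → ℝ} (h : SC η) : SC (lap η) := by
  constructor
  · have : _root_.lap η = fun x => ∑ i : Fin n, _root_.dd (bs i) (_root_.dd (bs i) η) x := by
      ext x; exact lap_eq η x
    rw [this]
    exact ContDiff.sum fun i _ => ((h.dd _).dd _).1
  · refine HasCompactSupport.intro h.2 fun x hx => lap_zero_of_notMem hx

lemma LC.mul_lip {ζ w : EE n → ℝ} (h : LC ζ) {L : ℝ≥0} (hw : LipschitzWith L w) :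
    LC (fun x => ζ x * w x) := by
  obtain ⟨⟨C, hC⟩, hs⟩ := h
  refine ⟨?_, hs.mul_right⟩
  obtain ⟨M, hM⟩ := hC.continuous.bounded_above_of_compact_support hs
  obtain ⟨B, hB⟩ := (hs : IsCompact (tsupport ζ)).exists_bound_of_continuousOn hw.continuous.continuousOn
  have main : ∀ x y, x ∈ tsupport ζ → |ζ x * w x - ζ y * w y| ≤ (C * |B| + |M| * L) * dist x y := by
    intro x y hx
    have h1 := hC.dist_le_mul x y
    have h2 := hw.dist_le_mul x y
    rw [Real.dist_eq] at h1 h2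
    have h3 : |w x| ≤ |B| := (hB x hx).trans (le_abs_self B)
    have h4 : |ζ y| ≤ |M| := (hM y).trans (le_abs_self M)
    calc |ζ x * w x - ζ y * w y| = |(ζ x - ζ y) * w x + ζ y * (w x - w y)| := by ring_nf
      _ ≤ |ζ x - ζ y| * |w x| + |ζ y| * |w x - w y| := by
        rw [← abs_mul, ← abs_mul]; exact abs_add_le _ _
      _ ≤ (C * dist x y) * |B| + |M| * (L * dist x y) := by gcongr
      _ = _ := by ring
  refine ⟨Real.toNNReal (C * |B| + |M| * L), LipschitzWith.of_dist_le_mul fun x y => ?_⟩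
  rw [Real.coe_toNNReal _ (by positivity), Real.dist_eq]
  by_cases hx : x ∈ tsupport ζ
  · exact main x y hx
  by_cases hy : y ∈ tsupport ζ
  · rw [abs_sub_comm, dist_comm]; exact main y x hy
  rw [image_eq_zero_of_notMem_tsupport hx, image_eq_zero_of_notMem_tsupport hy]
  simp; positivity

lemma tsupport_mul_subset_left' {ζ w : EE n → ℝ} : tsupport (fun x => ζ x * w x) ⊆ tsupport ζ :=
  tsupport_mul_subset_left

/-- integrable products -/
lemma integrable_mul_bdd {b f : EE n → ℝ} (hb : Integrable b) (hf : Measurable f) {C : ℝ}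
    (hC : ∀ x, |f x| ≤ C) : Integrable fun x => b x * f x := by
  exact hb.mul_bdd (c := C) hf.aestronglyMeasurable (Eventually.of_forall hC)

lemma LC.integrable {ζ : EE n → ℝ} (h : LC ζ) : Integrable ζ :=
  h.cont.integrable_of_hasCompactSupport h.2

lemma integrable_of_bdd_supp {f : EE n → ℝ} (hf : AEStronglyMeasurable f volume) {C : ℝ} {K : Set (EE n)}
    (hK : IsCompact K) (hC : ∀ x, |f x| ≤ C) (h0 : ∀ x, x ∉ K → f x = 0) : Integrable f := by
  have h1 : IntegrableOn f K := by
    refine Measure.integrableOn_of_bounded (hK.measure_lt_top.ne) hf (M := C)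
      (Eventually.of_forall hC)
  rw [← integrableOn_univ]
  exact h1.of_forall_sdiff_eq_zero MeasurableSet.univ fun x hx => h0 x hx.2

lemma LC.integrable_dd {ζ : EE n → ℝ} (h : LC ζ) (v : EE n) : Integrable (dd v ζ) := by
  obtain ⟨⟨C, hC⟩, hs⟩ := h
  exact integrable_of_bdd_supp (measurable_dd v ζ).aestronglyMeasurable hs (dd_le hC v)
    fun x hx => dd_zero_of_notMem hx

lemma ibp {w ζ : EE n → ℝ} {L : ℝ≥0} (hw : LipschitzWith L w) (hz : LC ζ) (v : EE n) :
    ∫ x, w x * dd v ζ x = -∫ x, dd v w x * ζ x := by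
  obtain ⟨⟨C, hC⟩, hs⟩ := hz
  have := LipschitzWith.integral_lineDeriv_mul_eq (μ := volume) hw hC hs v
  have e1 : ∫ x, dd v w x * ζ x = ∫ x, lineDeriv ℝ w x v * ζ x := by
    apply integral_congr_ae
    filter_upwards [hw.ae_differentiableAt (μ := volume)] with x hx
    rw [hx.lineDeriv_eq_fderiv]; rfl
  have e2 : ∫ x, w x * dd v ζ x = -∫ x, lineDeriv ℝ ζ x (-v) * w x := by
    rw [← integral_neg]
    apply integral_congr_ae
    filter_upwards [hC.ae_differentiableAt (μ := volume)] with x hx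
    rw [hx.lineDeriv_eq_fderiv]; simp [dd]; ring
  rw [e1, e2, this]

lemma dd_mul {w ζ : EE n → ℝ} {x : EE n} (hw : DifferentiableAt ℝ w x) (hz : DifferentiableAt ℝ ζ x)
    (v : EE n) : dd v (fun x => w x * ζ x) x = w x * dd v ζ x + ζ x * dd v w x := by
  unfold dd
  rw [fderiv_fun_mul hw hz]; simp

lemma gd_mul {w ζ θ : EE n → ℝ} {x : EE n} (hw : DifferentiableAt ℝ w x) (hz : DifferentiableAt ℝ ζ x) :
    gd θ (fun x => w x * ζ x) x = w x * gd θ ζ x + ζ x * gd θ w x := by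
  unfold gd
  simp_rw [dd_mul hw hz, Finset.mul_sum, ← Finset.sum_add_distrib]
  congr 1; ext i; ring

lemma integral_mul_lap {w η : EE n → ℝ} {L : ℝ≥0} (hw : LipschitzWith L w) (hη : SC η) :
    ∫ x, w x * lap η x = -∫ x, gd w η x := by
  simp_rw [lap_eq, gd, Finset.mul_sum]
  have h1 : ∀ i : Fin n, Integrable fun x => w x * dd (bs i) (dd (bs i) η) x := fun i =>
    (hw.continuous.mul ((hη.dd _).dd _).cont).integrable_of_hasCompactSupport ((hη.dd _).dd _).2.mul_left
  have h2 : ∀ i : Fin n, Integrable fun x => dd (bs i) w x * dd (bs i) η x := fun i => by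
    have := integrable_mul_bdd (hη.dd (bs i)).lc.integrable (measurable_dd (bs i) w) (dd_le' hw i)
    simpa [mul_comm] using this
  rw [integral_finsetSum _ fun i _ => h1 i, integral_finsetSum _ fun i _ => h2 i, ← Finset.sum_neg_distrib]
  congr 1; ext i
  exact ibp hw (hη.dd _).lc _

lemma abs_le_of_lip {w : EE n → ℝ} {L : ℝ≥0} (hw : LipschitzWith L w) (x : EE n) :
    |w x| ≤ |w 0| + L * ‖x‖ := by
  have := hw.dist_le_mul x 0
  rw [Real.dist_eq, dist_zero_right] at this
  have h2 := abs_add_le (w x - w 0) (w 0)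
  simp only [sub_add_cancel] at h2
  linarith

lemma lip_limit {f : ℕ → EE n → ℝ} {f0 : EE n → ℝ} {L : ℝ≥0} (hf : ∀ k, LipschitzWith L (f k))
    (hlim : ∀ x, Tendsto (fun k => f k x) atTop (𝓝 (f0 x))) : LipschitzWith L f0 := by
  refine LipschitzWith.of_dist_le_mul fun x y => ?_
  exact le_of_tendsto ((hlim x).dist (hlim y)) (Eventually.of_forall fun k => (hf k).dist_le_mul x y)

/-- Weak convergence of derivatives, smooth test. -/
lemma weak_conv_smooth {f : ℕ → EE n → ℝ} {f0 : EE n → ℝ} {L : ℝ≥0} (hf : ∀ k, LipschitzWith L (f k))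
    (hlim : ∀ x, Tendsto (fun k => f k x) atTop (𝓝 (f0 x))) {b : EE n → ℝ} (hb : SC b) (v : EE n) :
    Tendsto (fun k => ∫ x, b x * dd v (f k) x) atTop (𝓝 (∫ x, b x * dd v f0 x)) := by
  have hf0 := lip_limit hf hlim
  have e : ∀ {w : EE n → ℝ}, LipschitzWith L w → ∫ x, b x * dd v w x = -∫ x, w x * dd v b x := by
    intro w hw
    rw [ibp hw hb.lc, neg_neg]; congr 1; ext x; ring
  rw [e hf0]
  simp_rw [fun k => e (hf k)]
  refine Tendsto.neg ?_
  obtain ⟨M, hM⟩ := (hlim 0).norm.bddAbove_range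
  have hbi : Integrable fun x => |dd v b x| * (M + L * ‖x‖) :=
    Continuous.integrable_of_hasCompactSupport (by
      have := (hb.dd v).cont
      fun_prop) (((hb.dd v).2.norm).mul_right)
  refine tendsto_integral_of_dominated_convergence _ (fun k => ?_) hbi (fun k => ?_) ?_
  · exact ((hf k).continuous.mul (hb.dd v).cont).aestronglyMeasurable
  · refine Eventually.of_forall fun x => ?_
    rw [norm_mul, mul_comm]
    have h1 : |f k 0| ≤ M := hM ⟨k, rfl⟩
    have := abs_le_of_lip (hf k) x
    exact mul_le_mul_of_nonneg_left (this.trans (by linarith)) (abs_nonneg _)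
  · exact Eventually.of_forall fun x => (hlim x).mul_const _

/-- Weak convergence of derivatives. -/
lemma weak_conv {f : ℕ → EE n → ℝ} {f0 : EE n → ℝ} {L : ℝ≥0} (hf : ∀ k, LipschitzWith L (f k))
    (hlim : ∀ x, Tendsto (fun k => f k x) atTop (𝓝 (f0 x))) {b : EE n → ℝ} (hb : Integrable b) (v : EE n) :
    Tendsto (fun k => ∫ x, b x * dd v (f k) x) atTop (𝓝 (∫ x, b x * dd v f0 x)) := by
  have hf0 := lip_limit hf hlim
  rw [Metric.tendsto_atTop]
  intro ε hε
  set C : ℝ := L * ‖v‖ + 1 with hC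
  have hC0 : 0 < C := by positivity
  obtain ⟨g, hg1, hg2, hg3⟩ := (memLp_one_iff_integrable.2 hb).exist_eLpNorm_sub_le (by simp) le_rfl
    (show 0 < ε / (4 * C) by positivity)
  have hg : SC g := ⟨hg2, hg1⟩
  have hgi := hg.lc.integrable
  have hest : ∀ {w : EE n → ℝ}, LipschitzWith L w →
      |(∫ x, b x * dd v w x) - ∫ x, g x * dd v w x| ≤ ε / 4 := by
    intro w hw
    have i1 := integrable_mul_bdd hb (measurable_dd v w) (dd_le hw v)
    have i2 := integrable_mul_bdd hgi (measurable_dd v w) (dd_le hw v)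
    rw [← integral_sub i1 i2]
    have i3 : Integrable fun x => ‖b x - g x‖ := (hb.sub hgi).norm
    have h1 : ∫ x, ‖b x - g x‖ ≤ ε / (4 * C) := by
      have h2 := integral_norm_eq_lintegral_enorm (hb.sub hgi).aestronglyMeasurable
      rw [← eLpNorm_one_eq_lintegral_enorm] at h2
      have h3 : ∫ x, ‖b x - g x‖ = (eLpNorm (b - g) 1 volume).toReal := h2
      rw [h3]
      exact ENNReal.toReal_le_of_le_ofReal (by positivity) hg3
    calc |∫ x, (b x * dd v w x - g x * dd v w x)| ≤ ∫ x, C * ‖b x - g x‖ := by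
          rw [← Real.norm_eq_abs]
          refine norm_integral_le_of_norm_le (i3.const_mul C) (Eventually.of_forall fun x => ?_)
          rw [← sub_mul, norm_mul, mul_comm]
          exact mul_le_mul_of_nonneg_right ((dd_le hw v x).trans (by linarith)) (norm_nonneg _)
      _ = C * ∫ x, ‖b x - g x‖ := integral_const_mul _ _
      _ ≤ C * (ε / (4 * C)) := by gcongr
      _ = ε / 4 := by field_simp
  obtain ⟨N, hN⟩ := Metric.tendsto_atTop.1 (weak_conv_smooth hf hlim hg v) (ε / 4) (by positivity)
  refine ⟨N, fun k hk => ?_⟩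
  have h1 := hN k hk
  have h2 := hest (hf k)
  have h3 := hest hf0
  rw [Real.dist_eq] at h1 ⊢
  rw [abs_lt] at h1 ⊢
  rw [abs_le] at h2 h3
  constructor <;> linarith [h1.1, h1.2, h2.1, h2.2, h3.1, h3.2]

/-- Mollification. -/
lemma mollify {ζ : EE n → ℝ} (h : LC ζ) {U : Set (EE n)} (hU : IsOpen U) (hs : tsupport ζ ⊆ U) :
    ∃ (ζk : ℕ → EE n → ℝ) (C : ℝ≥0) (K : Set (EE n)), IsCompact K ∧ K ⊆ U ∧
      (∀ k, SC (ζk k) ∧ tsupport (ζk k) ⊆ K ∧ LipschitzWith C (ζk k)) ∧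
      (∀ x, Tendsto (fun k => ζk k x) atTop (𝓝 (ζ x))) := by
  have hcont := h.cont
  have hintg := h.integrable
  obtain ⟨⟨C, hC⟩, hcs⟩ := h
  obtain ⟨δ, hδ, hδU⟩ := IsCompact.exists_cthickening_subset_open hcs hU hs
  set r : ℕ → ℝ := fun k => δ * (1 / ((k : ℝ) + 1)) with hr
  have hr0 : ∀ k, 0 < r k := fun k => by positivity
  have hrδ : ∀ k, r k ≤ δ := fun k => by
    have : (1 / ((k : ℝ) + 1)) ≤ 1 := by
      rw [div_le_one (by positivity)]; linarith [(Nat.cast_nonneg k : (0:ℝ) ≤ k)]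
    nlinarith
  have hrlim : Tendsto r atTop (𝓝 0) := by
    have := (tendsto_one_div_add_atTop_nhds_zero_nat (𝕜 := ℝ)).const_mul δ
    rw [mul_zero] at this
    exact this
  let φ : ℕ → ContDiffBump (0 : EE n) := fun k => ⟨r k / 2, r k, by have := hr0 k; positivity, by have := hr0 k; linarith⟩
  let L := ContinuousLinearMap.lsmul ℝ ℝ (E := ℝ)
  have hsup : ∀ k, Function.support (convolution ((φ k).normed volume) ζ L volume) ⊆
      cthickening δ (tsupport ζ) := by
    intro k x hx
    obtain ⟨a, ha, b, hb, hab⟩ := support_convolution_subset L hx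
    rw [(φ k).support_normed_eq] at ha
    refine mem_cthickening_of_dist_le x b δ _ (subset_tsupport _ hb) ?_
    rw [← hab, dist_eq_norm]
    simp at ha ⊢
    exact (ha.le : ‖a‖ ≤ r k).trans (hrδ k)
  have hcomp : IsCompact (cthickening δ (tsupport ζ)) := IsCompact.cthickening hcs
  refine ⟨fun k => convolution ((φ k).normed volume) ζ L volume, C, _, hcomp, hδU, ?_, ?_⟩
  · intro k
    refine ⟨⟨?_, ?_⟩, ?_, ?_⟩
    · exact (φ k).hasCompactSupport_normed.contDiff_convolution_left L (φ k).contDiff_normed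
        hintg.locallyIntegrable
    · exact HasCompactSupport.of_support_subset_isCompact hcomp (hsup k)
    · exact closure_minimal (hsup k) isClosed_cthickening
    · refine LipschitzWith.of_dist_le_mul fun x y => ?_
      have hi : ∀ x : EE n, Integrable fun t => (φ k).normed volume t * ζ (x - t) := fun x =>
        ((φ k).continuous_normed.mul (hcont.comp (continuous_const.sub continuous_id))).integrable_of_hasCompactSupport
          (φ k).hasCompactSupport_normed.mul_right
      rw [Real.dist_eq]
      simp only [convolution_def, L, ContinuousLinearMap.lsmul_apply, smul_eq_mul]
      rw [← integral_sub (hi x) (hi y)]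
      calc _ ≤ ∫ t, (φ k).normed volume t * (C * dist x y) := by
            rw [← Real.norm_eq_abs]
            refine norm_integral_le_of_norm_le ((φ k).integrable_normed.mul_const _)
              (Eventually.of_forall fun t => ?_)
            rw [← mul_sub, norm_mul, Real.norm_of_nonneg ((φ k).nonneg_normed t)]
            refine mul_le_mul_of_nonneg_left ?_ ((φ k).nonneg_normed t)
            have := hC.dist_le_mul (x - t) (y - t)
            rwa [dist_sub_right, Real.dist_eq] at this
        _ = C * dist x y := by rw [integral_mul_const, (φ k).integral_normed, one_mul]
  · intro x
    exact ContDiffBump.convolution_tendsto_right_of_continuous (φ := φ) hrlim hcont x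

/-- translation -/
lemma dd_comp_add (v a : EE n) (w : EE n → ℝ) (x : EE n) : dd v (fun x => w (x + a)) x = dd v w (x + a) := by
  unfold dd; rw [fderiv_comp_add_right]

lemma gd_comp_add (a : EE n) (w ζ : EE n → ℝ) (x : EE n) :
    gd (fun x => w (x + a)) (fun x => ζ (x + a)) x = gd w ζ (x + a) := by
  unfold gd; simp_rw [dd_comp_add]

lemma lip_comp_add {L : ℝ≥0} {w : EE n → ℝ} (hw : LipschitzWith L w) (a : EE n) :
    LipschitzWith L (fun x => w (x + a)) := by
  refine LipschitzWith.of_dist_le_mul fun x y => ?_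
  simpa using hw.dist_le_mul (x + a) (y + a)

/-- difference quotient converges a.e. -/
lemma dq_tendsto {w : EE n → ℝ} {x : EE n} (hw : DifferentiableAt ℝ w x) (N : EE n) {h : ℕ → ℝ}
    (hh : ∀ k, 0 < h k) (hlim : Tendsto h atTop (𝓝 0)) :
    Tendsto (fun k => (w (x + h k • N) - w x) / h k) atTop (𝓝 (dd N w x)) := by
  have h1 := (hw.hasFDerivAt.hasLineDerivAt N)
  have h2 := h1.tendsto_slope_zero_right.comp
    (tendsto_nhdsWithin_iff.2 ⟨hlim, Eventually.of_forall hh⟩)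
  refine h2.congr fun k => ?_
  simp [div_eq_inv_mul]

/-! ### Arzela-Ascoli -/

lemma arzela {f : ℕ → EE n → ℝ} {L : ℝ≥0} {M : ℝ} (hf : ∀ k, LipschitzWith L (f k))
    (h0 : ∀ k, |f k 0| ≤ M) : ∃ (σ : ℕ → ℕ) (f0 : EE n → ℝ), StrictMono σ ∧ LipschitzWith L f0 ∧
      ∀ K : Set (EE n), IsCompact K → TendstoUniformlyOn (fun k => f (σ k)) f0 atTop K := by
  set S : Set C(EE n, ℝ) := {g | LipschitzWith L g ∧ |g 0| ≤ M} with hS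
  have himg : ContinuousMap.toFun '' S = {g : EE n → ℝ | (∀ x y, |g x - g y| ≤ L * dist x y) ∧ |g 0| ≤ M} := by
    ext g
    constructor
    · rintro ⟨g, hg, rfl⟩
      exact ⟨fun x y => by simpa [Real.dist_eq] using hg.1.dist_le_mul x y, hg.2⟩
    · rintro ⟨h1, h2⟩
      have h3 : LipschitzWith L g := LipschitzWith.of_dist_le_mul fun x y => by
        rw [Real.dist_eq]; exact h1 x y
      exact ⟨⟨g, h3.continuous⟩, ⟨h3, h2⟩, rfl⟩
  have hcpt : IsCompact (ContinuousMap.toFun '' S) := by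
    rw [himg]
    refine (isCompact_univ_pi (s := fun x : EE n => Icc (-(M + L * ‖x‖)) (M + L * ‖x‖))
      (fun x => isCompact_Icc)).of_isClosed_subset ?_ ?_
    · have : {g : EE n → ℝ | (∀ x y, |g x - g y| ≤ L * dist x y) ∧ |g 0| ≤ M} =
          (⋂ x, ⋂ y, {g : EE n → ℝ | |g x - g y| ≤ L * dist x y}) ∩ {g | |g 0| ≤ M} := by
        ext g; simp
      rw [this]
      refine IsClosed.inter (isClosed_iInter fun x => isClosed_iInter fun y => ?_) ?_
      · exact isClosed_le (by fun_prop) continuous_const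
      · exact isClosed_le (by fun_prop) continuous_const
    · rintro g ⟨h1, h2⟩ x -
      have h3 := h1 x 0
      rw [dist_zero_right] at h3
      have h4 := abs_add_le (g x - g 0) (g 0)
      simp only [sub_add_cancel] at h4
      rw [mem_Icc, ← abs_le]
      linarith
  have hSc : IsCompact S := ArzelaAscoli.isCompact_of_equicontinuous S hcpt
    (LipschitzWith.uniformEquicontinuous _ L (fun c => c.2.1)).equicontinuous
  obtain ⟨g, hg, σ, hσ, hlim⟩ := hSc.isSeqCompact
    (x := fun k => (⟨f k, (hf k).continuous⟩ : C(EE n, ℝ))) (fun k => ⟨hf k, h0 k⟩)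
  refine ⟨σ, g, hσ, hg.1, fun K hK => ?_⟩
  exact ContinuousMap.tendsto_iff_forall_isCompact_tendstoUniformlyOn.1 hlim K hK

/-! ### Half-space solutions -/

/-- Hausdorff measure on the parameter space. -/
abbrev mF (m : ℕ) : Measure (EE m) := μH[(m:ℝ)]

instance mF_haar (m : ℕ) : (mF m).IsAddHaarMeasure := muF_haar m

section half
variable {m : ℕ} (e : WithLp 2 (EE m × ℝ) ≃ₗᵢ[ℝ] EE n)

/-- coordinates as a continuous linear equivalence -/
def ptL : (EE m × ℝ) ≃L[ℝ] EE n :=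
  (WithLp.prodContinuousLinearEquiv 2 ℝ (EE m) ℝ).symm.trans e.toContinuousLinearEquiv

lemma ptL_apply (p : EE m × ℝ) : ptL e p = pt e p.1 p.2 := rfl

lemma exists_kappa : ∃ κ : ℝ≥0∞, κ ≠ 0 ∧ κ ≠ ⊤ ∧
    (volume : Measure (EE n)) = κ • Measure.map (ptL e) ((mF m).prod volume) := by
  have : (Measure.map (ptL e) ((mF m).prod volume)).IsAddHaarMeasure :=
    (ptL e).isAddHaarMeasure_map _
  have h := Measure.isAddLeftInvariant_eq_smul (volume : Measure (EE n))
    (Measure.map (ptL e) ((mF m).prod volume))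
  refine ⟨_, ?_, ENNReal.coe_ne_top, h⟩
  have := Measure.addHaarScalarFactor_pos_of_isAddHaarMeasure (volume : Measure (EE n))
    (Measure.map (ptL e) ((mF m).prod volume))
  exact ENNReal.coe_ne_zero.2 this.ne'

/-- The constant relating the measures. -/
def kap : ℝ := (exists_kappa e).choose.toReal

lemma kap_pos : 0 < kap e :=
  ENNReal.toReal_pos (exists_kappa e).choose_spec.1 (exists_kappa e).choose_spec.2.1

lemma integral_coords (F : EE n → ℝ) (hF : Continuous F) (hs : HasCompactSupport F) :
    ∫ x, F x = kap e * ∫ y, ∫ t, F (pt e y t) ∂(volume : Measure ℝ) ∂(mF m) := by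
  have h := (exists_kappa e).choose_spec.2.2
  conv_lhs => rw [h]
  rw [integral_smul_measure, smul_eq_mul]
  congr 1
  have hme : MeasurableEmbedding (ptL e) := (ptL e).toHomeomorph.measurableEmbedding
  rw [hme.integral_map]
  rw [integral_prod]
  · rfl
  · have hc : Continuous fun p => F (ptL e p) := hF.comp (ptL e).continuous
    exact hc.integrable_of_hasCompactSupport (hs.comp_homeomorph (ptL e).toHomeomorph)

/-- the unit vertical vector -/
def Nv : EE n := pt e 0 1

lemma norm_Nv : ‖Nv e‖ = 1 := by
  have := norm_pt_sq e 0 1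
  simp at this
  rcases this with h | h
  · exact h
  · have := norm_nonneg (pt e 0 1); linarith

lemma pt_add_Nv (y : EE m) (t s : ℝ) : pt e y t + s • Nv e = pt e y (t + s) := by
  unfold Nv
  rw [← pt_smul, ← pt_add]; simp

lemma inner_pt (y y' : EE m) (t t' : ℝ) : ⟪pt e y t, pt e y' t'⟫ = ⟪y, y'⟫ + t * t' := by
  unfold pt
  rw [e.inner_map_map, WithLp.prod_inner_apply]
  simp [mul_comm]

/-- the defining function of the half-space above the graph of `p` -/
def ell (p : EE m →L[ℝ] ℝ) : EE n →L[ℝ] ℝ :=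
  innerSL ℝ (pt e (-(InnerProductSpace.toDual ℝ (EE m)).symm p) 1)

lemma ell_pt (p : EE m →L[ℝ] ℝ) (y : EE m) (t : ℝ) : ell e p (pt e y t) = t - p y := by
  simp [ell, inner_pt]; ring

lemma ell_Nv (p : EE m →L[ℝ] ℝ) : ell e p (Nv e) = 1 := by
  unfold Nv; rw [ell_pt]; simp

lemma sum_ell (p : EE m →L[ℝ] ℝ) : ∑ i : Fin n, (ell e p (bs i)) ^ 2 = 1 + ‖p‖ ^ 2 := by
  have h1 : ∀ i : Fin n, ell e p (bs i) = (pt e (-(InnerProductSpace.toDual ℝ (EE m)).symm p) 1) i := by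
    intro i
    simp only [ell, innerSL_apply_apply]
    rw [EuclideanSpace.inner_single_right]; simp
  simp_rw [h1]
  have := EuclideanSpace.norm_sq_eq (pt e (-(InnerProductSpace.toDual ℝ (EE m)).symm p) 1)
  rw [norm_pt_sq] at this
  simp at this
  rw [← this]; ring

/-- the half-space solution -/
def hs (p : EE m →L[ℝ] ℝ) (x : EE n) : ℝ := max (ell e p x) 0

lemma hs_lip (p : EE m →L[ℝ] ℝ) : LipschitzWith ‖ell e p‖₊ (hs e p) :=
  (ell e p).lipschitz.max_const 0

lemma dd_hs_zero (p : EE m →L[ℝ] ℝ) {b : EE n} (hb : ell e p b = 0) (x : EE n) : dd b (hs e p) x = 0 := by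
  unfold dd
  by_cases h : DifferentiableAt ℝ (hs e p) x
  · rw [← h.lineDeriv_eq_fderiv, lineDeriv]
    have : (fun t : ℝ => hs e p (x + t • b)) = fun _ => hs e p x := by
      ext t; simp [hs, hb]
    rw [this]; simp
  · rw [fderiv_zero_of_not_differentiableAt h]; simp

lemma dd_add_smul (a b : EE n) (c : ℝ) (w : EE n → ℝ) (x : EE n) :
    dd (a + c • b) w x = dd a w x + c * dd b w x := by simp [dd]

lemma dd_symm {η : EE n → ℝ} (h : SC η) (u v : EE n) (x : EE n) : dd u (dd v η) x = dd v (dd u η) x := by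
  have hsym : IsSymmSndFDerivAt ℝ η x := (h.1.contDiffAt).isSymmSndFDerivAt (by simp; norm_cast)
  have hd : DifferentiableAt ℝ (fderiv ℝ η) x :=
    (h.1.fderiv_right (m := (⊤ : ℕ∞)) (by simp)).differentiable (by simp) x
  have e1 : ∀ u v, dd u (dd v η) x = fderiv ℝ (fderiv ℝ η) x u v := by
    intro u v
    unfold dd
    rw [fderiv_clm_apply hd (by fun_prop)]
    simp
  rw [e1, e1, hsym.eq]

lemma int_hs_dd (p : EE m →L[ℝ] ℝ) {ζ : EE n → ℝ} (hz : SC ζ) (v : EE n) :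
    ∫ x, hs e p x * dd v ζ x = ell e p v * ∫ x, hs e p x * dd (Nv e) ζ x := by
  have h1 : v = (v - ell e p v • Nv e) + ell e p v • Nv e := by simp
  have h2 : ell e p (v - ell e p v • Nv e) = 0 := by simp [ell_Nv]
  have i1 : ∀ a : EE n, Integrable fun x => hs e p x * dd a ζ x := fun a =>
    ((hs_lip e p).continuous.mul (hz.dd a).cont).integrable_of_hasCompactSupport (hz.dd a).2.mul_left
  calc _ = ∫ x, (hs e p x * dd (v - ell e p v • Nv e) ζ x + ell e p v * (hs e p x * dd (Nv e) ζ x)) := by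
        congr 1; ext x
        conv_lhs => rw [h1, dd_add_smul]
        ring
    _ = _ := by
      rw [integral_add (i1 _) ((i1 _).const_mul _), ibp (hs_lip e p) hz.lc, integral_const_mul]
      simp [dd_hs_zero e p h2]

lemma one_dim {g g' g'' : ℝ → ℝ} (h1 : ∀ t, HasDerivAt g (g' t) t) (h2 : ∀ t, HasDerivAt g' (g'' t) t)
    (hg'' : Continuous g'') (hs : HasCompactSupport g) (c : ℝ) :
    ∫ t, max (t - c) 0 * g'' t = g c := by
  have e1 : g' = deriv g := funext fun t => (h1 t).deriv.symm
  have e2 : g'' = deriv g' := funext fun t => (h2 t).deriv.symm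
  have hs' : HasCompactSupport g' := e1 ▸ hs.deriv
  have hs'' : HasCompactSupport g'' := e2 ▸ hs'.deriv
  have hintg : ∫ t, max (t - c) 0 * g'' t = ∫ t in Ioi c, (t - c) * g'' t := by
    rw [← integral_indicator measurableSet_Ioi]
    congr 1; ext t
    by_cases h : t ∈ Ioi c
    · rw [indicator_of_mem h, max_eq_left (by have : c < t := h; linarith)]
    · rw [indicator_of_notMem h, max_eq_right (by simp at h; linarith), zero_mul]
  rw [hintg]
  have hd : ∀ t, HasDerivAt (fun t => (t - c) * g' t - g t) ((t - c) * g'' t) t := by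
    intro t
    refine ((((hasDerivAt_id t).sub_const c).mul (h2 t)).sub (h1 t)).congr_deriv ?_
    simp
  have hF : HasCompactSupport (fun t => (t - c) * g' t - g t) := hs'.mul_left.sub hs
  have hci : Integrable fun t => (t - c) * g'' t :=
    Continuous.integrable_of_hasCompactSupport (by fun_prop) hs''.mul_left
  have := integral_Ioi_of_hasDerivAt_of_tendsto' (a := c) (m := 0) (fun t _ => hd t) hci.integrableOn (by
    have h := hF.is_zero_at_infty
    exact h.mono_left atTop_le_cocompact)
  rw [this]; simp

lemma int_hs_NN (p : EE m →L[ℝ] ℝ) {η : EE n → ℝ} (hη : SC η) :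
    ∫ x, hs e p x * dd (Nv e) (dd (Nv e) η) x = kap e * ∫ y, η (gr e p y) ∂(mF m) := by
  have hc2 := ((hη.dd (Nv e)).dd (Nv e))
  rw [integral_coords e (fun x => hs e p x * dd (Nv e) (dd (Nv e) η) x) ((hs_lip e p).continuous.mul hc2.cont) hc2.2.mul_left]
  congr 2; ext y
  have hd : ∀ {ζ : EE n → ℝ}, SC ζ → ∀ t, HasDerivAt (fun t => ζ (pt e y t)) (dd (Nv e) ζ (pt e y t)) t := by
    intro ζ hζ t
    have h1 : HasDerivAt (fun t => pt e y t) (Nv e) t := by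
      have : (fun t => pt e y t) = fun t : ℝ => pt e y 0 + t • Nv e := by
        ext1 t; rw [pt_add_Nv]; simp
      rw [this]
      simpa using ((hasDerivAt_id t).smul_const (Nv e)).const_add (pt e y 0)
    exact (hζ.diff _).hasFDerivAt.comp_hasDerivAt t h1
  have hcont : Continuous fun t => pt e y t := (continuous_pt e).comp (by fun_prop : Continuous fun t : ℝ => (y, t))
  have := one_dim (hd hη) (hd (hη.dd _)) (hc2.cont.comp hcont) (by
    obtain ⟨R, hR⟩ := hη.2.isBounded.subset_closedBall 0
    refine HasCompactSupport.intro (isCompact_closedBall (0:ℝ) R) fun t ht => ?_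
    apply image_eq_zero_of_notMem_tsupport
    intro h
    have h1 := hR h
    rw [mem_closedBall, dist_zero_right] at h1
    apply ht
    rw [mem_closedBall, dist_zero_right]
    have := abs_vc_le e (pt e y t)
    rw [vc_pt] at this
    exact this.trans h1) (p y)
  simp only [hs, ell_pt]
  exact this

lemma halfspace (p : EE m →L[ℝ] ℝ) {η : EE n → ℝ} (hη : SC η) :
    ∫ x, hs e p x * lap η x = kap e * (1 + ‖p‖ ^ 2) * ∫ y, η (gr e p y) ∂(mF m) := by
  simp_rw [lap_eq, Finset.mul_sum]
  have h1 : ∀ i : Fin n, Integrable fun x => hs e p x * dd (bs i) (dd (bs i) η) x := fun i =>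
    ((hs_lip e p).continuous.mul ((hη.dd _).dd _).cont).integrable_of_hasCompactSupport ((hη.dd _).dd _).2.mul_left
  rw [integral_finsetSum _ fun i _ => h1 i]
  have h2 : ∀ i : Fin n, ∫ x, hs e p x * dd (bs i) (dd (bs i) η) x =
      (ell e p (bs i)) ^ 2 * (kap e * ∫ y, η (gr e p y) ∂(mF m)) := by
    intro i
    rw [int_hs_dd e p (hη.dd _)]
    simp_rw [dd_symm hη (Nv e) (bs i)]
    rw [int_hs_dd e p (hη.dd _), int_hs_NN e p hη]; ring
  simp_rw [h2]
  rw [← Finset.sum_mul, sum_ell]; ring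

end half

/-! ### Local solutions over Lipschitz graphs and scaling -/

/-- `w` is a nonnegative Lipschitz function vanishing below the graph of `φ` in `ball 0 R`, whose
Laplacian there is the measure `q` on the graph minus `g`. -/
structure LS {m : ℕ} (e : WithLp 2 (EE m × ℝ) ≃ₗᵢ[ℝ] EE n) (L K : ℝ≥0) (ε R : ℝ) (w : EE n → ℝ)
    (φ q : EE m → ℝ) (g : EE n → ℝ) : Prop where
  lip : LipschitzWith L w
  nn : ∀ x, 0 ≤ w x
  lipφ : LipschitzWith K φ
  qi : LocallyIntegrable q (mF m)
  gm : Measurable g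
  gb : ∀ x, |g x| ≤ ε
  zero : ∀ y t, pt e y t ∈ ball (0 : EE n) R → t ≤ φ y → w (pt e y t) = 0
  eqn : ∀ η : EE n → ℝ, SC η → tsupport η ⊆ ball 0 R →
    ∫ x, w x * lap η x = (∫ y, q y * η (gr e φ y) ∂(mF m)) - ∫ x, g x * η x

lemma int_cv {E : Type*} [NormedAddCommGroup E] [InnerProductSpace ℝ E] [FiniteDimensional ℝ E]
    [MeasurableSpace E] [BorelSpace E] (μ : Measure E) [μ.IsAddHaarMeasure] (F : E → ℝ) (x0 : E) {h : ℝ}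
    (hh : 0 < h) : ∫ x, F x ∂μ = h ^ (Module.finrank ℝ E) * ∫ x, F (x0 + h • x) ∂μ := by
  have h1 := Measure.integral_comp_smul_of_nonneg μ (fun x => F (x0 + x)) h (hR := hh.le)
  rw [h1, integral_add_left_eq_self F x0, smul_eq_mul, mul_inv_cancel_left₀ (by positivity)]

lemma locInt_comp {E : Type*} [NormedAddCommGroup E] [InnerProductSpace ℝ E] [FiniteDimensional ℝ E]
    [MeasurableSpace E] [BorelSpace E] {μ : Measure E} [μ.IsAddHaarMeasure] {F : E → ℝ}
    (hF : LocallyIntegrable F μ) (x0 : E) {h : ℝ}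
    (hh : 0 < h) : LocallyIntegrable (fun x => F (x0 + h • x)) μ := by
  rw [locallyIntegrable_iff]
  intro K hK
  have hc : Continuous fun x : E => x0 + h • x := by fun_prop
  have hS : IsCompact ((fun x : E => x0 + h • x) '' K) := hK.image hc
  have h1 := (locallyIntegrable_iff.1 hF) _ hS
  rw [← integrable_indicator_iff hS.measurableSet] at h1
  have h2 := (h1.comp_add_left x0).comp_smul hh.ne'
  rw [← integrable_indicator_iff hK.measurableSet]
  refine h2.congr (Eventually.of_forall fun x => ?_)
  by_cases hx : x ∈ K
  · simp only [indicator_of_mem hx]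
    exact indicator_of_mem (mem_image_of_mem _ hx) _
  · rw [indicator_of_notMem hx]
    refine indicator_of_notMem ?_ _
    rintro ⟨y, hy, hyx⟩
    have : y = x := by
      have := add_left_cancel hyx
      exact smul_right_injective E hh.ne' this
    exact hx (this ▸ hy)

/-- rescaled test function -/
lemma SC.resc {η : EE n → ℝ} (hη : SC η) (x0 : EE n) {h : ℝ} (hh : 0 < h) :
    SC (fun z => η (h⁻¹ • (z - x0))) := by
  refine ⟨hη.1.comp (by fun_prop), ?_⟩
  have : HasCompactSupport (η ∘ ((Homeomorph.addRight (-x0)).trans (Homeomorph.smulOfNeZero h⁻¹ (inv_ne_zero hh.ne')))) :=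
    hη.2.comp_homeomorph _
  have h2 : (fun z => η (h⁻¹ • (z - x0))) = (η ∘ ((Homeomorph.addRight (-x0)).trans (Homeomorph.smulOfNeZero h⁻¹ (inv_ne_zero hh.ne')))) := by
    ext z
    simp [sub_eq_add_neg]
  rw [h2]; exact this

lemma tsupport_resc (η : EE n → ℝ) (x0 : EE n) {h : ℝ} :
    tsupport (fun z => η (h⁻¹ • (z - x0))) ⊆ (fun z => h⁻¹ • (z - x0)) ⁻¹' tsupport η := by
  refine closure_minimal (fun z hz => ?_) ((isClosed_tsupport η).preimage (by fun_prop))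
  exact subset_tsupport _ hz

lemma dd_resc (b : EE n) {w : EE n → ℝ} (x0 : EE n) {h : ℝ} (z : EE n) (hw : Differentiable ℝ w) :
    dd b (fun z => w (h⁻¹ • (z - x0))) z = h⁻¹ * dd b w (h⁻¹ • (z - x0)) := by
  unfold dd
  have h1 : HasFDerivAt (fun z : EE n => h⁻¹ • (z - x0)) (h⁻¹ • ContinuousLinearMap.id ℝ (EE n)) z := by
    exact ((hasFDerivAt_id z).sub_const x0).fun_const_smul h⁻¹
  have h2 := ((hw (h⁻¹ • (z - x0))).hasFDerivAt.comp z h1).fderiv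
  have h3 : (fun z => w (h⁻¹ • (z - x0))) = w ∘ (fun z : EE n => h⁻¹ • (z - x0)) := rfl
  rw [h3, h2]; simp

lemma lap_resc {η : EE n → ℝ} (hη : SC η) (x0 : EE n) {h : ℝ} (z : EE n) :
    lap (fun z => η (h⁻¹ • (z - x0))) z = h⁻¹ ^ 2 * lap η (h⁻¹ • (z - x0)) := by
  rw [lap_eq, lap_eq, Finset.mul_sum]
  refine Finset.sum_congr rfl fun i _ => ?_
  have h1 : dd (bs i) (fun z => η (h⁻¹ • (z - x0))) = fun z => h⁻¹ * dd (bs i) η (h⁻¹ • (z - x0)) :=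
    funext fun z => dd_resc _ _ _ hη.diff
  rw [h1]
  have h2 : dd (bs i) (fun z => h⁻¹ * dd (bs i) η (h⁻¹ • (z - x0))) z =
      h⁻¹ * dd (bs i) (fun z => dd (bs i) η (h⁻¹ • (z - x0))) z := by
    unfold dd
    rw [fderiv_const_mul]
    · rfl
    · exact (Differentiable.comp (hη.dd (bs i)).diff (by fun_prop : Differentiable ℝ fun z : EE n => h⁻¹ • (z - x0))) z
  rw [h2, dd_resc _ _ _ (hη.dd (bs i)).diff]; ring

section LSsec
variable {m : ℕ} {e : WithLp 2 (EE m × ℝ) ≃ₗᵢ[ℝ] EE n} {L K : ℝ≥0} {ε R : ℝ} {w : EE n → ℝ}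
    {φ q : EE m → ℝ} {g : EE n → ℝ}

lemma dim_eq (e : WithLp 2 (EE m × ℝ) ≃ₗᵢ[ℝ] EE n) : n = m + 1 := by
  have := (ptL e).toLinearEquiv.finrank_eq
  simpa using this.symm

lemma gr_scale (e : WithLp 2 (EE m × ℝ) ≃ₗᵢ[ℝ] EE n) (φ : EE m → ℝ) (y₀ y : EE m) {h : ℝ} (hh : 0 < h) :
    gr e φ (y₀ + h • y) = gr e φ y₀ + h • gr e (fun y => (φ (y₀ + h • y) - φ y₀) / h) y := by
  unfold gr
  rw [← pt_smul, ← pt_add]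
  congr 1
  field_simp; ring

lemma LS.scale (H : LS e L K ε R w φ q g) (y₀ : EE m) {h R' : ℝ} (hh : 0 < h)
    (hR : ‖gr e φ y₀‖ + h * R' ≤ R) :
    LS e L K (h * ε) R' (fun x => w (gr e φ y₀ + h • x) / h) (fun y => (φ (y₀ + h • y) - φ y₀) / h)
      (fun y => q (y₀ + h • y)) (fun x => h * g (gr e φ y₀ + h • x)) where
  lip := by
    refine LipschitzWith.of_dist_le_mul fun x y => ?_
    have := H.lip.dist_le_mul (gr e φ y₀ + h • x) (gr e φ y₀ + h • y)
    rw [dist_add_left, dist_smul₀, Real.norm_of_nonneg hh.le] at this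
    rw [Real.dist_eq] at this ⊢
    rw [← sub_div, abs_div, abs_of_pos hh, div_le_iff₀ hh]
    linarith
  nn x := div_nonneg (H.nn _) hh.le
  lipφ := by
    refine LipschitzWith.of_dist_le_mul fun x y => ?_
    have := H.lipφ.dist_le_mul (y₀ + h • x) (y₀ + h • y)
    rw [dist_add_left, dist_smul₀, Real.norm_of_nonneg hh.le] at this
    rw [Real.dist_eq] at this ⊢
    rw [← sub_div, abs_div, abs_of_pos hh, div_le_iff₀ hh]
    rw [show φ (y₀ + h • x) - φ y₀ - (φ (y₀ + h • y) - φ y₀) = φ (y₀ + h • x) - φ (y₀ + h • y) by ring]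
    linarith
  qi := locInt_comp H.qi y₀ hh
  gm := (H.gm.comp (by fun_prop)).const_mul h
  gb x := by
    rw [abs_mul, abs_of_pos hh]
    exact mul_le_mul_of_nonneg_left (H.gb _) hh.le
  zero y t hy ht := by
    have h1 : gr e φ y₀ + h • pt e y t = pt e (y₀ + h • y) (φ y₀ + h * t) := by
      unfold gr; rw [← pt_smul, ← pt_add]
    rw [h1, H.zero, zero_div]
    · rw [← h1, mem_ball_zero_iff]
      rw [mem_ball_zero_iff] at hy
      calc _ ≤ ‖gr e φ y₀‖ + ‖h • pt e y t‖ := norm_add_le _ _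
        _ < ‖gr e φ y₀‖ + h * R' := by
          rw [norm_smul, Real.norm_of_nonneg hh.le]
          gcongr
        _ ≤ R := hR
    · rw [le_div_iff₀ hh] at ht; linarith
  eqn η hη hs := by
    set x0 := gr e φ y₀ with hx0
    have hη' := hη.resc x0 hh
    have hinv : ∀ x : EE n, h⁻¹ • (x0 + h • x - x0) = x := by
      intro x; rw [add_sub_cancel_left, smul_smul, inv_mul_cancel₀ hh.ne', one_smul]
    have key := H.eqn _ hη' (by
      refine (tsupport_resc η x0).trans fun z hz => ?_
      have h1 : h⁻¹ • (z - x0) ∈ ball (0 : EE n) R' := hs hz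
      rw [mem_ball_zero_iff, norm_smul, norm_inv, Real.norm_of_nonneg hh.le, inv_mul_lt_iff₀ hh] at h1
      rw [mem_ball_zero_iff]
      calc ‖z‖ = ‖x0 + (z - x0)‖ := by simp
        _ ≤ ‖x0‖ + ‖z - x0‖ := norm_add_le _ _
        _ < ‖x0‖ + h * R' := by gcongr
        _ ≤ R := hR)
    rw [int_cv volume _ x0 hh, int_cv volume (fun x => g x * _) x0 hh, int_cv (mF m) _ y₀ hh] at key
    simp only [lap_resc hη, hinv, hx0 ▸ gr_scale e φ y₀ _ hh] at key
    simp only [finrank_euclideanSpace, Fintype.card_fin] at key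
    have hn : n = m + 1 := dim_eq e
    have hpow : h ^ n = h ^ m * h := by rw [hn, pow_succ]
    rw [hpow] at key
    have hm : h ^ m ≠ 0 := by positivity
    have e1 : ∫ x, w (x0 + h • x) / h * lap η x = h * ∫ x, w (x0 + h • x) * (h⁻¹ ^ 2 * lap η x) := by
      rw [← integral_const_mul]; congr 1; ext x; field_simp
    have e2 : ∫ x, h * g (x0 + h • x) * η x = h * ∫ x, g (x0 + h • x) * η x := by
      rw [← integral_const_mul]; congr 1; ext x; ring
    rw [e1, e2]
    apply mul_left_cancel₀ hm
    linarith

end LSsec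

/-! ### Lipschitz test functions -/

lemma dct_loc {E ι : Type*} [NormedAddCommGroup E] [ProperSpace E]
    [MeasurableSpace E] [BorelSpace E] {μ : Measure E} {l : Filter ι} [l.IsCountablyGenerated]
    {q : E → ℝ} (hq : LocallyIntegrable q μ) {Fk : ι → E → ℝ} {F : E → ℝ} {B ρ : ℝ}
    (hm : ∀ᶠ k in l, AEStronglyMeasurable (Fk k) μ)
    (hB : ∀ᶠ k in l, ∀ x, |Fk k x| ≤ B) (h0 : ∀ᶠ k in l, ∀ x, ρ < ‖x‖ → Fk k x = 0)
    (hlim : ∀ᵐ x ∂μ, q x = 0 ∨ Tendsto (fun k => Fk k x) l (𝓝 (F x))) :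
    Tendsto (fun k => ∫ x, q x * Fk k x ∂μ) l (𝓝 (∫ x, q x * F x ∂μ)) := by
  have hintg : Integrable ((closedBall (0 : E) ρ).indicator q) μ := by
    rw [integrable_indicator_iff measurableSet_closedBall]
    exact locallyIntegrable_iff.1 hq _ (isCompact_closedBall 0 ρ)
  refine tendsto_integral_filter_of_dominated_convergence
    (fun x => B * |(closedBall (0 : E) ρ).indicator q x|) ?_ ?_ (hintg.abs.const_mul B) ?_
  · filter_upwards [hm] with k hk
    exact hq.aestronglyMeasurable.mul hk
  · filter_upwards [hB, h0] with k hk hk0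
    refine Eventually.of_forall fun x => ?_
    by_cases hx : x ∈ closedBall (0 : E) ρ
    · rw [indicator_of_mem hx, Real.norm_eq_abs, abs_mul, mul_comm]
      exact mul_le_mul_of_nonneg_right (hk x) (abs_nonneg _)
    · rw [indicator_of_notMem hx, hk0 x (by simpa using hx)]; simp
  · filter_upwards [hlim] with x hx
    rcases hx with hx | hx
    · simp [hx, tendsto_const_nhds]
    · exact hx.const_mul _

lemma locInt_bdd {g : EE n → ℝ} {ε : ℝ} (hm : Measurable g) (hb : ∀ x, |g x| ≤ ε) :
    LocallyIntegrable g volume := by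
  rw [locallyIntegrable_iff]
  intro K hK
  exact Measure.integrableOn_of_bounded (hK.measure_lt_top.ne) hm.aestronglyMeasurable (M := ε)
      (Eventually.of_forall hb)

section LSsec
variable {m : ℕ} {e : WithLp 2 (EE m × ℝ) ≃ₗᵢ[ℝ] EE n} {L K : ℝ≥0} {ε R : ℝ} {w : EE n → ℝ}
    {φ q : EE m → ℝ} {g : EE n → ℝ}

lemma norm_le_gr (e : WithLp 2 (EE m × ℝ) ≃ₗᵢ[ℝ] EE n) (φ : EE m → ℝ) (y : EE m) : ‖y‖ ≤ ‖gr e φ y‖ := by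
  simpa [gr] using norm_hc_le e (gr e φ y)

lemma gd_int {w ζ : EE n → ℝ} {C : ℝ≥0} (hw : LipschitzWith L w) (hz : LipschitzWith C ζ) {S : Set (EE n)}
    (hS : IsCompact S) (hs : tsupport ζ ⊆ S) :
    (∀ i : Fin n, Integrable (S.indicator (dd (bs i) w))) ∧
    ∫ x, gd w ζ x = ∑ i : Fin n, ∫ x, S.indicator (dd (bs i) w) x * dd (bs i) ζ x := by
  have h1 : ∀ i : Fin n, Integrable (S.indicator (dd (bs i) w)) := by
    intro i
    refine integrable_of_bdd_supp (C := L) ((measurable_dd _ w).indicator hS.measurableSet).aestronglyMeasurable hS (fun x => ?_)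
      fun x hx => indicator_of_notMem hx _
    by_cases hx : x ∈ S
    · rw [indicator_of_mem hx]; exact dd_le' hw i x
    · rw [indicator_of_notMem hx]; simp
  refine ⟨h1, ?_⟩
  rw [← integral_finsetSum]
  · congr 1; ext x
    unfold gd
    refine Finset.sum_congr rfl fun i _ => ?_
    by_cases hx : x ∈ S
    · rw [indicator_of_mem hx]
    · rw [indicator_of_notMem hx, dd_zero_of_notMem fun h => hx (hs h)]; simp
  · intro i _
    exact integrable_mul_bdd (h1 i) (measurable_dd _ ζ) (dd_le' hz i)

lemma LS.test (H : LS e L K ε R w φ q g) {ζ : EE n → ℝ} (hz : LC ζ) (hs : tsupport ζ ⊆ ball 0 R) :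
    -∫ x, gd w ζ x = (∫ y, q y * ζ (gr e φ y) ∂(mF m)) - ∫ x, g x * ζ x := by
  obtain ⟨ζk, C, S, hS, hSR, hk, hlim⟩ := mollify hz isOpen_ball hs
  have hzS : tsupport ζ ⊆ S := by
    refine closure_minimal (fun x hx => ?_) hS.isClosed
    by_contra hxS
    apply hx
    refine tendsto_nhds_unique (hlim x) ?_
    have : (fun k => ζk k x) = fun _ => 0 := by
      ext k
      exact image_eq_zero_of_notMem_tsupport fun h => hxS ((hk k).2.1 h)
    rw [this]; exact tendsto_const_nhds
  have hzC : LipschitzWith C ζ := lip_limit (fun k => (hk k).2.2) hlim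
  have h1 : ∀ k, -∫ x, gd w (ζk k) x = (∫ y, q y * ζk k (gr e φ y) ∂(mF m)) - ∫ x, g x * ζk k x := by
    intro k
    rw [← integral_mul_lap H.lip (hk k).1]
    exact H.eqn _ (hk k).1 ((hk k).2.1.trans hSR)
  have h2 : Tendsto (fun k => -∫ x, gd w (ζk k) x) atTop (𝓝 (-∫ x, gd w ζ x)) := by
    refine Tendsto.neg ?_
    rw [(gd_int H.lip hzC hS hzS).2]
    simp_rw [fun k => (gd_int H.lip (hk k).2.2 hS (hk k).2.1).2]
    refine tendsto_finsetSum _ fun i _ => ?_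
    exact weak_conv (fun k => (hk k).2.2) hlim ((gd_int H.lip hzC hS hzS).1 i) _
  have hball : ∀ k x, |R| < ‖x‖ → ζk k x = 0 := by
    intro k x hx
    refine image_eq_zero_of_notMem_tsupport fun h => ?_
    have := hSR ((hk k).2.1 h)
    rw [mem_ball_zero_iff] at this
    linarith [le_abs_self R]
  have hbd : ∀ k x, |ζk k x| ≤ C * (2 * |R| + 1) := by
    intro k x
    by_cases hx : |R| < ‖x‖
    · rw [hball k x hx, abs_zero]; positivity
    · have h3 := (hk k).2.2.dist_le_mul x ((|R| + 1) • Nv e)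
      have hN : ‖(|R| + 1) • Nv e‖ = |R| + 1 := by
        rw [norm_smul, norm_Nv, mul_one, Real.norm_of_nonneg (by positivity)]
      rw [hball k ((|R| + 1) • Nv e) (by rw [hN]; linarith), Real.dist_eq, sub_zero] at h3
      refine h3.trans ?_
      gcongr
      rw [dist_eq_norm]
      refine (norm_sub_le _ _).trans ?_
      rw [hN]; linarith
  have h3 : Tendsto (fun k => ∫ y, q y * ζk k (gr e φ y) ∂(mF m)) atTop (𝓝 (∫ y, q y * ζ (gr e φ y) ∂(mF m))) := by
    refine dct_loc H.qi (Fk := fun k y => ζk k (gr e φ y)) (F := fun y => ζ (gr e φ y)) (B := C * (2 * |R| + 1)) (ρ := |R|) ?_ ?_ ?_ ?_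
    · exact Eventually.of_forall fun k =>
        ((hk k).1.cont.comp (continuous_gr e H.lipφ.continuous)).aestronglyMeasurable
    · exact Eventually.of_forall fun k y => hbd k _
    · exact Eventually.of_forall fun k y hy => hball k _ (hy.trans_le (norm_le_gr e φ y))
    · exact Eventually.of_forall fun y => Or.inr (hlim _)
  have h4 : Tendsto (fun k => ∫ x, g x * ζk k x) atTop (𝓝 (∫ x, g x * ζ x)) := by
    refine dct_loc (locInt_bdd H.gm H.gb) (B := C * (2 * |R| + 1)) (ρ := |R|) ?_ ?_ ?_ ?_
    · exact Eventually.of_forall fun k => (hk k).1.cont.aestronglyMeasurable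
    · exact Eventually.of_forall fun k y => hbd k _
    · exact Eventually.of_forall fun k y hy => hball k _ hy
    · exact Eventually.of_forall fun y => Or.inr (hlim _)
  simp_rw [h1] at h2
  exact tendsto_nhds_unique h2 (h3.sub h4)

end LSsec

/-! ### Limits of local solutions and blow-up at almost every point -/

section LSsec
variable {m : ℕ} {e : WithLp 2 (EE m × ℝ) ≃ₗᵢ[ℝ] EE n} {L K : ℝ≥0} {ε R : ℝ} {w : EE n → ℝ}
    {φ q : EE m → ℝ} {g : EE n → ℝ}

/-- a bound for a compactly supported continuous function and its support radius -/
lemma bdd_supp {η : EE n → ℝ} (hc : Continuous η) (hs : HasCompactSupport η) :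
    ∃ B ρ : ℝ, 0 < B ∧ 0 < ρ ∧ (∀ x, |η x| ≤ B) ∧ (tsupport η ⊆ ball 0 ρ) ∧ ∀ x, ρ < ‖x‖ → η x = 0 := by
  obtain ⟨M, hM⟩ := hc.bounded_above_of_compact_support hs
  obtain ⟨ρ, hρ⟩ := hs.isBounded.subset_ball 0
  refine ⟨|M| + 1, |ρ| + 1, by positivity, by positivity, fun x => ?_, ?_, fun x hx => ?_⟩
  · exact (hM x).trans (by linarith [le_abs_self M])
  · exact hρ.trans (ball_subset_ball (by linarith [le_abs_self ρ]))
  · refine image_eq_zero_of_notMem_tsupport fun h => ?_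
    have := hρ h
    rw [mem_ball_zero_iff] at this
    linarith [le_abs_self ρ]

lemma gr_tendsto (e : WithLp 2 (EE m × ℝ) ≃ₗᵢ[ℝ] EE n) {φk : ℕ → EE m → ℝ} {φ0 : EE m → ℝ} {y : EE m}
    (hlim : Tendsto (fun k => φk k y) atTop (𝓝 (φ0 y))) :
    Tendsto (fun k => gr e (φk k) y) atTop (𝓝 (gr e φ0 y)) := by
  unfold gr
  exact ((continuous_pt e).tendsto (y, φ0 y)).comp (tendsto_const_nhds.prodMk_nhds hlim)

lemma graph_conv (e : WithLp 2 (EE m × ℝ) ≃ₗᵢ[ℝ] EE n) {φk : ℕ → EE m → ℝ} {φ0 : EE m → ℝ}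
    (hφc : ∀ k, Continuous (φk k)) (hlim : ∀ y, Tendsto (fun k => φk k y) atTop (𝓝 (φ0 y)))
    {b : EE m → ℝ} (hb : LocallyIntegrable b (mF m)) {η : EE n → ℝ} (hc : Continuous η)
    (hs : HasCompactSupport η) :
    Tendsto (fun k => ∫ y, b y * η (gr e (φk k) y) ∂(mF m)) atTop (𝓝 (∫ y, b y * η (gr e φ0 y) ∂(mF m))) := by
  obtain ⟨B, ρ, hB, hρ, h1, -, h3⟩ := bdd_supp hc hs
  refine dct_loc hb (Fk := fun k y => η (gr e (φk k) y)) (B := B) (ρ := ρ) ?_ ?_ ?_ ?_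
  · exact Eventually.of_forall fun k => (hc.comp (continuous_gr e (hφc k))).aestronglyMeasurable
  · exact Eventually.of_forall fun k y => h1 _
  · exact Eventually.of_forall fun k y hy => h3 _ (hy.trans_le (norm_le_gr e _ y))
  · exact Eventually.of_forall fun y => Or.inr ((hc.tendsto _).comp (gr_tendsto e (hlim y)))

/-- limits of `∫ w_k ζ` -/
lemma lip_int_conv {wk : ℕ → EE n → ℝ} {w0 : EE n → ℝ} (hL : ∀ k, LipschitzWith L (wk k)) (h0 : ∀ k, wk k 0 = 0)
    (hlim : ∀ x, Tendsto (fun k => wk k x) atTop (𝓝 (w0 x))) {ζ : EE n → ℝ} (hz : Continuous ζ)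
    (hs : HasCompactSupport ζ) :
    Tendsto (fun k => ∫ x, wk k x * ζ x) atTop (𝓝 (∫ x, w0 x * ζ x)) := by
  refine tendsto_integral_of_dominated_convergence (fun x => L * ‖x‖ * |ζ x|) ?_ ?_ ?_ ?_
  · exact fun k => ((hL k).continuous.mul hz).aestronglyMeasurable
  · exact Continuous.integrable_of_hasCompactSupport (by fun_prop) hs.abs.mul_left
  · intro k
    refine Eventually.of_forall fun x => ?_
    rw [Real.norm_eq_abs, abs_mul]
    gcongr
    have := abs_le_of_lip (hL k) x
    simpa [h0 k] using this
  · exact Eventually.of_forall fun x => (hlim x).mul_const _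

lemma LS_lim {εk Rk : ℕ → ℝ} {wk gk : ℕ → EE n → ℝ} {φk qk : ℕ → EE m → ℝ} {w0 : EE n → ℝ}
    (Hk : ∀ k, LS e L K (εk k) (Rk k) (wk k) (φk k) (qk k) (gk k))
    (hε : Tendsto εk atTop (𝓝 0)) (hR : Tendsto Rk atTop atTop) (h0 : ∀ k, wk k 0 = 0)
    (hw : ∀ x, Tendsto (fun k => wk k x) atTop (𝓝 (w0 x)))
    {η : EE n → ℝ} (hη : SC η) {c : ℝ}
    (hq : Tendsto (fun k => ∫ y, qk k y * η (gr e (φk k) y) ∂(mF m)) atTop (𝓝 c)) :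
    ∫ x, w0 x * lap η x = c := by
  have h1 := lip_int_conv (fun k => (Hk k).lip) h0 hw hη.lap.cont hη.lap.2
  obtain ⟨B, ρ, hB, hρ, hη1, hη2, -⟩ := bdd_supp hη.cont hη.2
  have h2 : Tendsto (fun k => ∫ x, gk k x * η x) atTop (𝓝 0) := by
    refine squeeze_zero_norm (a := fun k => εk k * ∫ x, |η x|) (fun k => ?_) (by simpa using hε.mul_const _)
    rw [← integral_const_mul]
    refine norm_integral_le_of_norm_le (hη.lc.integrable.abs.const_mul _) (Eventually.of_forall fun x => ?_)
    rw [Real.norm_eq_abs, abs_mul]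
    exact mul_le_mul_of_nonneg_right ((Hk k).gb x) (abs_nonneg _)
  have h3 := hq.sub h2
  rw [sub_zero] at h3
  refine tendsto_nhds_unique h1 (h3.congr' ?_)
  filter_upwards [hR.eventually_ge_atTop ρ] with k hk
  exact ((Hk k).eqn η hη (hη2.trans (ball_subset_ball hk))).symm

lemma LS_lim_zero {εk Rk : ℕ → ℝ} {wk gk : ℕ → EE n → ℝ} {φk qk : ℕ → EE m → ℝ} {w0 : EE n → ℝ} {φ0 : EE m → ℝ}
    (Hk : ∀ k, LS e L K (εk k) (Rk k) (wk k) (φk k) (qk k) (gk k))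
    (hR : Tendsto Rk atTop atTop)
    (hw : ∀ x, Tendsto (fun k => wk k x) atTop (𝓝 (w0 x)))
    (hφ : ∀ y, Tendsto (fun k => φk k y) atTop (𝓝 (φ0 y))) (y : EE m) (t : ℝ) (ht : t < φ0 y) :
    w0 (pt e y t) = 0 := by
  refine tendsto_nhds_unique (hw _) (tendsto_const_nhds.congr' ?_)
  filter_upwards [hR.eventually_gt_atTop ‖pt e y t‖, (hφ y).eventually (lt_mem_nhds ht)] with k h1 h2
  exact ((Hk k).zero y t (by simpa using h1) h2.le).symm

lemma LS_lim_zero' {w0 : EE n → ℝ} {φ0 : EE m → ℝ} (hc : Continuous w0)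
    (h : ∀ y t, t < φ0 y → w0 (pt e y t) = 0) (y : EE m) (t : ℝ) (ht : t ≤ φ0 y) :
    w0 (pt e y t) = 0 := by
  have hcl : IsClosed {s : ℝ | w0 (pt e y s) = 0} :=
    isClosed_eq (hc.comp ((continuous_pt e).comp (by fun_prop : Continuous fun s : ℝ => (y, s)))) continuous_const
  have : closure (Iio (φ0 y)) ⊆ {s : ℝ | w0 (pt e y s) = 0} := closure_minimal (fun s hs => h y s hs) hcl
  rw [closure_Iio] at this
  exact this ht

lemma half_unique (p : EE m →L[ℝ] ℝ) {w0 : EE n → ℝ} (hL : LipschitzWith L w0) {c : ℝ}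
    (heq : ∀ η : EE n → ℝ, SC η → ∫ x, w0 x * lap η x = c * ∫ y, η (gr e p y) ∂(mF m))
    (hz : ∀ y t, t < p y → w0 (pt e y t) = 0) (x : EE n) :
    w0 x = c / (kap e * (1 + ‖p‖ ^ 2)) * hs e p x := by
  set a := c / (kap e * (1 + ‖p‖ ^ 2)) with ha
  have hpos : 0 < kap e * (1 + ‖p‖ ^ 2) := mul_pos (kap_pos e) (by positivity)
  have hlip2 : LipschitzWith (‖a‖₊ * ‖ell e p‖₊) (fun x => a * hs e p x) :=
    (lipschitzWith_smul a).comp (hs_lip e p)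
  have := liouville (v := fun x => w0 x - a * hs e p x) (hL.sub hlip2) (fun η h1 h2 _ => by
    have hη : SC η := ⟨h1, h2⟩
    simp_rw [sub_mul]
    rw [integral_sub, heq η hη]
    · simp_rw [mul_assoc]
      rw [integral_const_mul, halfspace e p hη, ← mul_assoc, ha, div_mul_cancel₀ _ hpos.ne', sub_self]
    · exact (hL.continuous.mul hη.lap.cont).integrable_of_hasCompactSupport hη.lap.2.mul_left
    · exact (hlip2.continuous.mul hη.lap.cont).integrable_of_hasCompactSupport hη.lap.2.mul_left)
    (ell e p) (-Nv e) (by simp [ell_Nv]) (fun x hx => by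
      have h1 : hs e p x = 0 := max_eq_right hx.le
      rw [h1, mul_zero, sub_zero]
      rw [← pt_hc_vc e x] at hx ⊢
      rw [ell_pt] at hx
      exact hz _ _ (by linarith)) x
  linarith

/-- Lebesgue points, rescaled -/
lemma leb_scale {y₀ : EE m}
    (hleb : Tendsto (fun r => ⨍ y in closedBall y₀ r, ‖q y - q y₀‖ ∂(mF m)) (𝓝[>] 0) (𝓝 0))
    {h : ℕ → ℝ} (hh : ∀ j, 0 < h j) (hlim : Tendsto h atTop (𝓝 0)) {ρ : ℝ} (hρ : 0 < ρ) :
    Tendsto (fun j => ∫ y in closedBall 0 ρ, ‖q (y₀ + h j • y) - q y₀‖ ∂(mF m)) atTop (𝓝 0) := by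
  have h1 : Tendsto (fun j => h j * ρ) atTop (𝓝[>] 0) := by
    rw [tendsto_nhdsWithin_iff]
    exact ⟨by simpa using hlim.mul_const ρ, Eventually.of_forall fun j => mul_pos (hh j) hρ⟩
  have h2 := (hleb.comp h1).const_mul ((mF m).real (closedBall (0 : EE m) ρ))
  rw [mul_zero] at h2
  refine h2.congr fun j => ?_
  simp only [Function.comp]
  have hVpos : 0 < (mF m).real (closedBall (0 : EE m) ρ) :=
    ENNReal.toReal_pos (measure_closedBall_pos _ _ hρ).ne' (isCompact_closedBall _ _).measure_lt_top.ne
  have hV : (mF m).real (closedBall y₀ (h j * ρ)) = (h j) ^ m * (mF m).real (closedBall (0 : EE m) ρ) := by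
    unfold Measure.real
    rw [Measure.addHaar_closedBall_mul _ _ (hh j).le hρ.le, ENNReal.toReal_mul, ENNReal.toReal_ofReal (by have := hh j; positivity)]
    simp
  rw [setAverage_eq, hV, smul_eq_mul, ← integral_indicator measurableSet_closedBall,
    ← integral_indicator measurableSet_closedBall, int_cv (mF m) _ y₀ (hh j)]
  simp only [finrank_euclideanSpace, Fintype.card_fin]
  have e1 : ∀ y, (closedBall y₀ (h j * ρ)).indicator (fun y => ‖q y - q y₀‖) (y₀ + h j • y) =
      (closedBall (0 : EE m) ρ).indicator (fun y => ‖q (y₀ + h j • y) - q y₀‖) y := by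
    intro y
    have : y₀ + h j • y ∈ closedBall y₀ (h j * ρ) ↔ y ∈ closedBall (0 : EE m) ρ := by
      rw [mem_closedBall, mem_closedBall, dist_zero_right, dist_eq_norm, add_sub_cancel_left, norm_smul,
        Real.norm_of_nonneg (hh j).le, mul_le_mul_iff_right₀ (hh j)]
    by_cases hy : y ∈ closedBall (0 : EE m) ρ
    · rw [indicator_of_mem hy, indicator_of_mem (this.2 hy)]
    · rw [indicator_of_notMem hy, indicator_of_notMem (fun h => hy (this.1 h))]
  simp_rw [e1]
  have hm : (h j) ^ m ≠ 0 := pow_ne_zero _ (hh j).ne'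
  field_simp

lemma q_conv (hqi : LocallyIntegrable q (mF m)) (hφ : Continuous φ) {y₀ : EE m}
    (hleb : Tendsto (fun r => ⨍ y in closedBall y₀ r, ‖q y - q y₀‖ ∂(mF m)) (𝓝[>] 0) (𝓝 0))
    {p : EE m →L[ℝ] ℝ} (hd : HasFDerivAt φ p y₀)
    {h : ℕ → ℝ} (hh : ∀ j, 0 < h j) (hlim : Tendsto h atTop (𝓝 0)) {η : EE n → ℝ} (hη : SC η) :
    Tendsto (fun j => ∫ y, q (y₀ + h j • y) * η (gr e (fun y => (φ (y₀ + h j • y) - φ y₀) / h j) y) ∂(mF m)) atTop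
      (𝓝 (q y₀ * ∫ y, η (gr e p y) ∂(mF m))) := by
  obtain ⟨B, ρ, hB, hρ, hη1, -, hη3⟩ := bdd_supp hη.cont hη.2
  have hcφ : ∀ j, Continuous (fun y => (φ (y₀ + h j • y) - φ y₀) / h j) := fun j =>
    ((hφ.comp (by fun_prop)).sub continuous_const).div_const _
  have hφlim : ∀ y, Tendsto (fun j => (φ (y₀ + h j • y) - φ y₀) / h j) atTop (𝓝 (p y)) := by
    intro y
    have := dq_tendsto hd.differentiableAt y hh hlim
    rwa [dd, hd.fderiv] at this
  have h1 := graph_conv e hcφ hφlim (locallyIntegrable_const (q y₀)) hη.cont hη.2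
  rw [integral_const_mul] at h1
  have h2 : Tendsto (fun j => ∫ y, (q (y₀ + h j • y) - q y₀) * η (gr e (fun y => (φ (y₀ + h j • y) - φ y₀) / h j) y) ∂(mF m)) atTop (𝓝 0) := by
    refine squeeze_zero_norm (a := fun j => B * ∫ y in closedBall 0 ρ, ‖q (y₀ + h j • y) - q y₀‖ ∂(mF m)) (fun j => ?_)
      (by simpa using (leb_scale hleb hh hlim hρ).const_mul B)
    rw [← integral_indicator measurableSet_closedBall, ← integral_const_mul]
    have hli : LocallyIntegrable (fun y => q (y₀ + h j • y) - q y₀) (mF m) :=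
      (locInt_comp hqi y₀ (hh j)).sub (locallyIntegrable_const _)
    refine norm_integral_le_of_norm_le (Integrable.const_mul ?_ B) (Eventually.of_forall fun y => ?_)
    · rw [integrable_indicator_iff measurableSet_closedBall]
      exact (locallyIntegrable_iff.1 hli _ (isCompact_closedBall 0 ρ)).norm
    · by_cases hy : y ∈ closedBall (0 : EE m) ρ
      · rw [indicator_of_mem hy, norm_mul, mul_comm]
        exact mul_le_mul_of_nonneg_right (hη1 _) (norm_nonneg _)
      · rw [indicator_of_notMem hy, hη3]
        · simp
        · exact lt_of_lt_of_le (by simpa using hy) (norm_le_gr e _ y)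
  have h3 := h1.add h2
  rw [add_zero] at h3
  refine h3.congr fun j => ?_
  have hintg : ∀ {b : EE m → ℝ}, LocallyIntegrable b (mF m) → Integrable (fun y => b y * η (gr e (fun y => (φ (y₀ + h j • y) - φ y₀) / h j) y)) (mF m) := by
    intro b hb
    have hcc : Continuous fun y => η (gr e (fun y => (φ (y₀ + h j • y) - φ y₀) / h j) y) :=
      hη.cont.comp (continuous_gr e (hcφ j))
    refine (hb.integrable_smul_right_of_hasCompactSupport hcc (HasCompactSupport.intro (isCompact_closedBall 0 ρ) fun y hy => ?_))
    exact hη3 _ (lt_of_lt_of_le (by simpa using hy) (norm_le_gr e _ y))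
  have i2 := hintg (b := fun y => q (y₀ + h j • y) - q y₀) ((locInt_comp hqi y₀ (hh j)).sub (locallyIntegrable_const _))
  rw [← integral_add (hintg (locallyIntegrable_const (q y₀))) i2]
  congr 1; ext y; ring

lemma LS.blow (H : LS e L K ε R w φ q g) {y₀ : EE m} (hy₀ : gr e φ y₀ ∈ ball (0 : EE n) R)
    (hleb : Tendsto (fun r => ⨍ y in closedBall y₀ r, ‖q y - q y₀‖ ∂(mF m)) (𝓝[>] 0) (𝓝 0))
    {p : EE m →L[ℝ] ℝ} (hd : HasFDerivAt φ p y₀) {h : ℕ → ℝ} (hh : ∀ j, 0 < h j) (hlim : Tendsto h atTop (𝓝 0)) :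
    Tendsto (fun j => w (gr e φ y₀ + h j • Nv e) / h j) atTop (𝓝 (q y₀ / (kap e * (1 + ‖p‖ ^ 2)))) := by
  refine tendsto_of_subseq_tendsto fun ns hns => ?_
  set x0 := gr e φ y₀ with hx0
  have hw0 : w x0 = 0 := H.zero y₀ (φ y₀) hy₀ le_rfl
  have hlim' : Tendsto (fun j => h (ns j)) atTop (𝓝 0) := hlim.comp hns
  rw [mem_ball_zero_iff] at hy₀
  have HS : ∀ j, LS e L K _ _ _ _ _ _ := fun j => H.scale y₀ (hh (ns j)) (R' := (R - ‖x0‖) / h (ns j)) (by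
    rw [mul_div_cancel₀ _ (hh _).ne']; simp [hx0])
  obtain ⟨σ, w0, hσ, hLw, hcv⟩ := arzela (M := 0) (fun j => (HS j).lip) (fun j => by
    simp only [smul_zero, add_zero]
    rw [← hx0, hw0]; simp)
  refine ⟨σ, ?_⟩
  have hpw : ∀ x, Tendsto (fun j => w (x0 + h (ns (σ j)) • x) / h (ns (σ j))) atTop (𝓝 (w0 x)) := fun x =>
    (hcv {x} isCompact_singleton).tendsto_at rfl
  have hl2 : Tendsto (fun j => h (ns (σ j))) atTop (𝓝 0) := hlim'.comp hσ.tendsto_atTop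
  have hl3 : Tendsto (fun j => (R - ‖x0‖) / h (ns (σ j))) atTop atTop := by
    simp_rw [div_eq_mul_inv]
    refine Tendsto.const_mul_atTop (by linarith) ?_
    exact Tendsto.inv_tendsto_nhdsGT_zero (tendsto_nhdsWithin_iff.2 ⟨hl2, Eventually.of_forall fun j => hh _⟩)
  have hφlim : ∀ y, Tendsto (fun j => (φ (y₀ + h (ns (σ j)) • y) - φ y₀) / h (ns (σ j))) atTop (𝓝 (p y)) := by
    intro y
    have := dq_tendsto hd.differentiableAt y (fun j => hh (ns (σ j))) hl2
    rwa [dd, hd.fderiv] at this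
  have key := half_unique (e := e) p hLw (c := q y₀) (fun η hη => by
    refine LS_lim (fun j => HS (σ j)) (by simpa using hl2.mul_const ε) hl3 (fun j => by simp [← hx0, hw0]) hpw hη ?_
    exact q_conv H.qi H.lipφ.continuous hleb hd (fun j => hh (ns (σ j))) hl2 hη)
    (LS_lim_zero (fun j => HS (σ j)) hl3 hpw hφlim) (Nv e)
  have h2 := hpw (Nv e)
  rw [key, hs, ell_Nv] at h2
  simpa using h2

/-- differentiation of `w` at almost every point of the graph -/
lemma LS.blow_ae (H : LS e L K ε R w φ q g) : ∀ᵐ y₀ ∂(mF m), gr e φ y₀ ∈ ball (0 : EE n) R →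
    ∀ h : ℕ → ℝ, (∀ j, 0 < h j) → Tendsto h atTop (𝓝 0) →
    Tendsto (fun j => w (gr e φ y₀ + h j • Nv e) / h j) atTop
      (𝓝 (q y₀ / (kap e * (1 + ‖fderiv ℝ φ y₀‖ ^ 2)))) := by
  have h1 : ∀ᵐ y₀ ∂(mF m), DifferentiableAt ℝ φ y₀ := H.lipφ.ae_differentiableAt
  have h2 := (Besicovitch.vitaliFamily (mF m)).ae_tendsto_average_norm_sub H.qi
  filter_upwards [h1, h2] with y₀ h1 h2 hy h hh hlim
  exact H.blow hy (h2.comp (Besicovitch.tendsto_filterAt (mF m) y₀)) h1.hasFDerivAt hh hlim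

end LSsec

/-! ### A Rellich type identity -/

lemma ibp2 {v w η : EE n → ℝ} {L M : ℝ≥0} (hv : LipschitzWith M v) (hw : LipschitzWith L w) (hη : SC η) :
    ∫ x, w x * gd v η x = -(∫ x, v x * gd w η x) - ∫ x, v x * w x * lap η x := by
  have hi1 : ∀ {a b : EE n → ℝ} {A : ℝ≥0} (_ : Continuous a) (_ : LipschitzWith A b) (i : Fin n),
      Integrable fun x => a x * (dd (bs i) η x * dd (bs i) b x) := by
    intro a b A ha hb i
    have h1 : Integrable fun x => a x * dd (bs i) η x :=
      (ha.mul (hη.dd _).cont).integrable_of_hasCompactSupport (hη.dd _).2.mul_left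
    have := integrable_mul_bdd h1 (measurable_dd (bs i) b) (dd_le' hb i)
    exact this.congr (Eventually.of_forall fun x => by ring)
  have hi2 : ∀ i : Fin n, Integrable fun x => v x * (w x * dd (bs i) (dd (bs i) η) x) := fun i =>
    (hv.continuous.mul (hw.continuous.mul ((hη.dd _).dd _).cont)).integrable_of_hasCompactSupport
      (((hη.dd _).dd _).2.mul_left.mul_left)
  have hi3 : ∀ i : Fin n, ∫ x, w x * (dd (bs i) η x * dd (bs i) v x) =
      -(∫ x, v x * (dd (bs i) η x * dd (bs i) w x)) - ∫ x, v x * (w x * dd (bs i) (dd (bs i) η) x) := by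
    intro i
    have h1 := ibp hv ((hη.dd (bs i)).lc.mul_lip hw) (bs i)
    have h2 : ∫ x, v x * dd (bs i) (fun x => dd (bs i) η x * w x) x =
        ∫ x, (v x * (dd (bs i) η x * dd (bs i) w x) + v x * (w x * dd (bs i) (dd (bs i) η) x)) := by
      refine integral_congr_ae ?_
      filter_upwards [hw.ae_differentiableAt] with x hx
      rw [dd_mul ((hη.dd _).diff x) hx]; ring
    rw [h2, integral_add (hi1 hv.continuous hw i) (hi2 i)] at h1
    have h3 : ∫ x, w x * (dd (bs i) η x * dd (bs i) v x) = ∫ x, dd (bs i) v x * (dd (bs i) η x * w x) := by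
      congr 1; ext x; ring
    rw [h3]; linarith
  have e1 : ∀ (a b : EE n → ℝ) (x : EE n), a x * gd b η x = ∑ i : Fin n, a x * (dd (bs i) η x * dd (bs i) b x) := by
    intro a b x
    rw [gd, Finset.mul_sum]; exact Finset.sum_congr rfl fun i _ => by ring
  have e2 : ∀ x, v x * w x * lap η x = ∑ i : Fin n, v x * (w x * dd (bs i) (dd (bs i) η) x) := by
    intro x
    rw [lap_eq, Finset.mul_sum]; exact Finset.sum_congr rfl fun i _ => by ring
  simp_rw [e1, e2]
  rw [integral_finsetSum _ fun i _ => hi1 hw.continuous hv i, integral_finsetSum _ fun i _ => hi1 hv.continuous hw i,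
    integral_finsetSum _ fun i _ => hi2 i, ← Finset.sum_neg_distrib, ← Finset.sum_sub_distrib]
  exact Finset.sum_congr rfl fun i _ => hi3 i

lemma integrable_mul_gd {w η a : EE n → ℝ} {L : ℝ≥0} (hw : LipschitzWith L w) (hη : SC η) (ha : Continuous a) :
    Integrable fun x => a x * gd w η x := by
  unfold gd
  simp_rw [Finset.mul_sum]
  refine integrable_finsetSum _ fun i _ => ?_
  have h1 : Integrable fun x => a x * dd (bs i) η x :=
      (ha.mul (hη.dd _).cont).integrable_of_hasCompactSupport (hη.dd _).2.mul_left
  have := integrable_mul_bdd h1 (measurable_dd (bs i) w) (dd_le' hw i)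
  exact this.congr (Eventually.of_forall fun x => by ring)

lemma LC.comp_add {ζ : EE n → ℝ} (h : LC ζ) (a : EE n) : LC (fun x => ζ (x + a)) := by
  refine ⟨⟨_, lip_comp_add h.1.choose_spec a⟩, ?_⟩
  exact h.2.comp_homeomorph (Homeomorph.addRight a)

lemma LC.integrable_gd {w ζ : EE n → ℝ} {L : ℝ≥0} (hw : LipschitzWith L w) (hz : LC ζ) : Integrable (gd w ζ) := by
  refine integrable_finsetSum _ fun i _ => ?_
  have := integrable_mul_bdd (hz.integrable_dd (bs i)) (measurable_dd (bs i) w) (dd_le' hw i)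
  exact this.congr (Eventually.of_forall fun x => by ring)

section LSsec
variable {m : ℕ} {e : WithLp 2 (EE m × ℝ) ≃ₗᵢ[ℝ] EE n} {L K : ℝ≥0} {ε R : ℝ} {w : EE n → ℝ}
    {φ q : EE m → ℝ} {g : EE n → ℝ}

lemma gr_add_Nv (φ : EE m → ℝ) (y : EE m) (s : ℝ) : gr e φ y + s • Nv e = pt e y (φ y + s) := by
  unfold gr; exact pt_add_Nv e _ _ _

lemma LS.fd_identity (H : LS e L K ε R w φ q g) {η : EE n → ℝ} (hη : SC η) {ρ : ℝ}
    (hs : tsupport η ⊆ ball 0 ρ) (hR : ρ + 1 ≤ R) {h : ℝ} (hh : 0 < h) (hh1 : h ≤ 1) :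
    ∫ y, q y * (η (gr e φ y) * w (gr e φ y + h • Nv e)) ∂(mF m) =
      -2 * (∫ x, w (x + h • Nv e) * gd w η x) - (∫ x, w (x + h • Nv e) * w x * lap η x)
      + ∫ x, g x * (η x * w (x + h • Nv e) - η (x + -(h • Nv e)) * w (x + -(h • Nv e))) := by
  have hlwh : LipschitzWith L (fun x => w (x + h • Nv e)) := lip_comp_add H.lip _
  have hz1 : LC (fun x => η x * w (x + h • Nv e)) := hη.lc.mul_lip hlwh
  have hz0 : LC (fun x => η x * w x) := hη.lc.mul_lip H.lip
  have hz2 : LC (fun x => η (x + -(h • Nv e)) * w (x + -(h • Nv e))) := hz0.comp_add _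
  have hNn : ‖h • Nv e‖ = h := by rw [norm_smul, norm_Nv, mul_one, Real.norm_of_nonneg hh.le]
  have T1 := H.test hz1 (tsupport_mul_subset_left'.trans (hs.trans (ball_subset_ball (by linarith))))
  have T2 := H.test hz2 (by
    have h1 : tsupport (fun x => η (x + -(h • Nv e)) * w (x + -(h • Nv e))) ⊆ (fun x => x + -(h • Nv e)) ⁻¹' tsupport η := by
      refine closure_minimal (fun x hx => ?_) ((isClosed_tsupport η).preimage (by fun_prop))
      refine subset_tsupport _ fun h0 => hx ?_
      simp only [h0, zero_mul]
    refine h1.trans fun x hx => ?_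
    have h2 := hs hx
    rw [mem_ball_zero_iff] at h2 ⊢
    calc ‖x‖ = ‖(x + -(h • Nv e)) + h • Nv e‖ := by simp
      _ ≤ _ := norm_add_le _ _
      _ < R := by rw [hNn]; linarith)
  have hG : ∀ y, q y * (η (gr e φ y + -(h • Nv e)) * w (gr e φ y + -(h • Nv e))) = 0 := by
    intro y
    by_cases hx : gr e φ y + -(h • Nv e) ∈ tsupport η
    · have h2 := hs hx
      have h3 : gr e φ y + -(h • Nv e) = pt e y (φ y + -h) := by
        rw [← gr_add_Nv, neg_smul]
      rw [h3] at h2 ⊢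
      rw [H.zero _ _ (ball_subset_ball (by linarith) h2) (by linarith)]; simp
    · rw [image_eq_zero_of_notMem_tsupport hx]; simp
  simp_rw [hG, integral_zero] at T2
  have S2 : ∫ x, gd w (fun x => η (x + -(h • Nv e)) * w (x + -(h • Nv e))) x =
      ∫ x, gd (fun x => w (x + h • Nv e)) (fun x => η x * w x) x := by
    rw [← integral_add_right_eq_self _ (h • Nv e)]
    congr 1; ext x
    rw [← gd_comp_add]; simp
  have D1 : (∫ x, gd (fun x => w (x + h • Nv e)) (fun x => η x * w x) x) - ∫ x, gd w (fun x => η x * w (x + h • Nv e)) x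
      = (∫ x, w x * gd (fun x => w (x + h • Nv e)) η x) - ∫ x, w (x + h • Nv e) * gd w η x := by
    rw [← integral_sub (LC.integrable_gd hlwh hz0) (LC.integrable_gd H.lip hz1),
      ← integral_sub (integrable_mul_gd hlwh hη H.lip.continuous) (integrable_mul_gd H.lip hη hlwh.continuous)]
    refine integral_congr_ae ?_
    filter_upwards [H.lip.ae_differentiableAt, hlwh.ae_differentiableAt] with x hx hxh
    rw [gd_mul (hη.diff x) hx, gd_mul (hη.diff x) hxh, gd_comm w]
    ring
  rw [ibp2 hlwh H.lip hη] at D1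
  have I1 : ∀ {ζ : EE n → ℝ}, LC ζ → Integrable fun x => g x * ζ x := by
    intro ζ hz
    exact (integrable_mul_bdd hz.integrable H.gm H.gb).congr (Eventually.of_forall fun x => mul_comm _ _)
  have G1 : ∫ x, g x * (η x * w (x + h • Nv e) - η (x + -(h • Nv e)) * w (x + -(h • Nv e))) =
      (∫ x, g x * (η x * w (x + h • Nv e))) - ∫ x, g x * (η (x + -(h • Nv e)) * w (x + -(h • Nv e))) := by
    rw [← integral_sub (I1 hz1) (I1 hz2)]
    congr 1; ext x; ring
  rw [G1]
  rw [S2] at T2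
  linarith

lemma LS.rellich (L : ℝ≥0) {η : EE n → ℝ} (hη : SC η) {ρ : ℝ} (hρ : 0 < ρ)
    (hs : tsupport η ⊆ ball 0 ρ) : ∃ C : ℝ, ∀ (K : ℝ≥0) (ε R : ℝ) (w : EE n → ℝ) (φ q : EE m → ℝ) (g : EE n → ℝ),
    LS e L K ε R w φ q g → ρ + 1 ≤ R → w 0 = 0 →
    |(-2 * (∫ x, dd (Nv e) w x * gd w η x) - ∫ x, dd (Nv e) w x * (w x * lap η x)) -
      ∫ y, q y * (η (gr e φ y) * (q y / (kap e * (1 + ‖fderiv ℝ φ y‖ ^ 2)))) ∂(mF m)| ≤ C * ε := by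
  obtain ⟨⟨M, hM⟩, -⟩ := hη.lc
  obtain ⟨B, hB⟩ := hη.cont.bounded_above_of_compact_support hη.2
  have hB0 : 0 ≤ B := (norm_nonneg _).trans (hB 0)
  set C1 : ℝ := 2 * B * L + M * L * (ρ + 2) with hC1
  have hC10 : 0 ≤ C1 := by positivity
  refine ⟨C1 * volume.real (closedBall (0 : EE n) (ρ + 1)), fun K ε R w φ q g H hR hw0 => ?_⟩
  have hε : 0 ≤ ε := (abs_nonneg _).trans (H.gb 0)
  set h : ℕ → ℝ := fun j => 1 / ((j : ℝ) + 1) with hh_def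
  have hh : ∀ j, 0 < h j := fun j => by positivity
  have hh1 : ∀ j, h j ≤ 1 := fun j => by
    rw [hh_def]; simp only []
    rw [div_le_one (by positivity)]; linarith [(Nat.cast_nonneg j : (0:ℝ) ≤ j)]
  have hlim : Tendsto h atTop (𝓝 0) := tendsto_one_div_add_atTop_nhds_zero_nat
  have hη0 : ∀ x, ρ < ‖x‖ → η x = 0 := fun x hx => image_eq_zero_of_notMem_tsupport fun h => by
    have := hs h
    rw [mem_ball_zero_iff] at this; linarith
  have hDb : ∀ j x, |(w (x + h j • Nv e) - w x) / h j| ≤ L := by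
    intro j x
    rw [abs_div, abs_of_pos (hh j), div_le_iff₀ (hh j)]
    have := H.lip.dist_le_mul (x + h j • Nv e) x
    rw [Real.dist_eq, dist_eq_norm, add_sub_cancel_left, norm_smul, norm_Nv, mul_one, Real.norm_of_nonneg (hh j).le] at this
    exact this
  -- the divided identity
  have key : ∀ j, |(-2 * (∫ x, (w (x + h j • Nv e) - w x) / h j * gd w η x) - ∫ x, (w (x + h j • Nv e) - w x) / h j * (w x * lap η x)) -
      ∫ y, q y * (η (gr e φ y) * (w (gr e φ y + h j • Nv e) / h j)) ∂(mF m)| ≤ C1 * volume.real (closedBall (0 : EE n) (ρ + 1)) * ε := by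
    intro j
    have F1 := H.fd_identity hη hs hR (hh j) (hh1 j)
    have F0 := ibp2 H.lip H.lip hη
    have hlwh : LipschitzWith L (fun x => w (x + h j • Nv e)) := lip_comp_add H.lip _
    have hNn : ‖h j • Nv e‖ = h j := by rw [norm_smul, norm_Nv, mul_one, Real.norm_of_nonneg (hh j).le]
    have a1 : ∫ x, (w (x + h j • Nv e) - w x) / h j * gd w η x = (h j)⁻¹ * ((∫ x, w (x + h j • Nv e) * gd w η x) - ∫ x, w x * gd w η x) := by
      rw [← integral_sub (integrable_mul_gd H.lip hη hlwh.continuous) (integrable_mul_gd H.lip hη H.lip.continuous), ← integral_const_mul]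
      congr 1; ext x; rw [div_eq_inv_mul]; ring
    have i2 : ∀ {a : EE n → ℝ}, Continuous a → Integrable fun x => a x * w x * lap η x := fun ha =>
      ((ha.mul H.lip.continuous).mul hη.lap.cont).integrable_of_hasCompactSupport hη.lap.2.mul_left
    have a2 : ∫ x, (w (x + h j • Nv e) - w x) / h j * (w x * lap η x) = (h j)⁻¹ * ((∫ x, w (x + h j • Nv e) * w x * lap η x) - ∫ x, w x * w x * lap η x) := by
      rw [← integral_sub (i2 hlwh.continuous) (i2 H.lip.continuous), ← integral_const_mul]
      congr 1; ext x; rw [div_eq_inv_mul]; ring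
    have a3 : ∫ y, q y * (η (gr e φ y) * (w (gr e φ y + h j • Nv e) / h j)) ∂(mF m) = (h j)⁻¹ * ∫ y, q y * (η (gr e φ y) * w (gr e φ y + h j • Nv e)) ∂(mF m) := by
      rw [← integral_const_mul]
      congr 1; ext x; rw [div_eq_inv_mul]; ring
    rw [a1, a2, a3, F1]
    set I := ∫ x, g x * (η x * w (x + h j • Nv e) - η (x + -(h j • Nv e)) * w (x + -(h j • Nv e))) with hI
    have hIb : |I| ≤ h j * (C1 * volume.real (closedBall (0 : EE n) (ρ + 1)) * ε) := by
      have e0 : I = ∫ x in closedBall (0 : EE n) (ρ + 1), g x * (η x * w (x + h j • Nv e) - η (x + -(h j • Nv e)) * w (x + -(h j • Nv e))) := by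
        rw [hI, setIntegral_eq_integral_of_forall_compl_eq_zero]
        intro x hx
        have hx' : ρ + 1 < ‖x‖ := by simpa using hx
        rw [hη0 x (by linarith), hη0 (x + -(h j • Nv e))]
        · simp
        · have := norm_sub_norm_le x (h j • Nv e)
          rw [hNn, sub_eq_add_neg x] at this
          linarith [hh1 j]
      rw [e0, ← Real.norm_eq_abs]
      refine (norm_setIntegral_le_of_norm_le_const (C := ε * (h j * C1)) (isCompact_closedBall _ _).measure_lt_top (fun x hx => ?_)).trans (le_of_eq (by ring))
      rw [norm_mul]
      refine mul_le_mul (H.gb x) ?_ (norm_nonneg _) hε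
      rw [mem_closedBall, dist_zero_right] at hx
      have b1 : |w (x + h j • Nv e) - w (x + -(h j • Nv e))| ≤ 2 * L * h j := by
        have := H.lip.dist_le_mul (x + h j • Nv e) (x + -(h j • Nv e))
        rw [Real.dist_eq, dist_eq_norm, add_sub_add_left_eq_sub, sub_neg_eq_add] at this
        refine this.trans ?_
        have h3 := norm_add_le (h j • Nv e) (h j • Nv e)
        rw [hNn] at h3
        calc (L:ℝ) * _ ≤ L * (h j + h j) := by gcongr
          _ = _ := by ring
      have b2 : |η x - η (x + -(h j • Nv e))| ≤ M * h j := by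
        have := hM.dist_le_mul x (x + -(h j • Nv e))
        rw [Real.dist_eq, dist_eq_norm] at this
        simpa [hNn, norm_smul, norm_Nv, abs_of_pos (hh j)] using this
      have b3 : |w (x + -(h j • Nv e))| ≤ L * (ρ + 2) := by
        have := abs_le_of_lip H.lip (x + -(h j • Nv e))
        rw [hw0, abs_zero, zero_add] at this
        refine this.trans ?_
        gcongr
        refine (norm_add_le _ _).trans ?_
        rw [norm_neg, hNn]; linarith [hh1 j]
      have b4 : η x * w (x + h j • Nv e) - η (x + -(h j • Nv e)) * w (x + -(h j • Nv e)) =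
        η x * (w (x + h j • Nv e) - w (x + -(h j • Nv e))) + (η x - η (x + -(h j • Nv e))) * w (x + -(h j • Nv e)) := by ring
      rw [b4, Real.norm_eq_abs]
      calc _ ≤ |η x| * |w (x + h j • Nv e) - w (x + -(h j • Nv e))| + |η x - η (x + -(h j • Nv e))| * |w (x + -(h j • Nv e))| := by
            rw [← abs_mul, ← abs_mul]; exact abs_add_le _ _
        _ ≤ B * (2 * L * h j) + (M * h j) * (L * (ρ + 2)) := by
            have hMh : 0 ≤ (M : ℝ) * h j := mul_nonneg M.2 (hh j).le
            have := hB x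
            rw [Real.norm_eq_abs] at this
            gcongr
        _ = h j * C1 := by rw [hC1]; ring
    have e5 : (-2 * ((h j)⁻¹ * ((∫ x, w (x + h j • Nv e) * gd w η x) - ∫ x, w x * gd w η x)) -
        (h j)⁻¹ * ((∫ x, w (x + h j • Nv e) * w x * lap η x) - ∫ x, w x * w x * lap η x) -
        (h j)⁻¹ * (-2 * (∫ x, w (x + h j • Nv e) * gd w η x) - (∫ x, w (x + h j • Nv e) * w x * lap η x) + I)) = -((h j)⁻¹ * I) := by
      have : ∫ x, w x * w x * lap η x = -2 * ∫ x, w x * gd w η x := by linarith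
      rw [this]; ring
    rw [e5, abs_neg, abs_mul, abs_inv, abs_of_pos (hh j), inv_mul_le_iff₀ (hh j)]
    exact hIb
  -- pass to the limit
  have hDlim : ∀ᵐ x, Tendsto (fun j => (w (x + h j • Nv e) - w x) / h j) atTop (𝓝 (dd (Nv e) w x)) := by
    filter_upwards [H.lip.ae_differentiableAt] with x hx
    exact dq_tendsto hx _ hh hlim
  have hDc : ∀ j, Continuous fun x => (w (x + h j • Nv e) - w x) / h j := fun j =>
    (((lip_comp_add H.lip _).continuous).sub H.lip.continuous).div_const _
  have L0 : ∀ {F : EE n → ℝ}, Integrable F → Tendsto (fun j => ∫ x, (w (x + h j • Nv e) - w x) / h j * F x) atTop (𝓝 (∫ x, dd (Nv e) w x * F x)) := by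
    intro F hF
    refine tendsto_integral_of_dominated_convergence (fun x => L * |F x|) (fun j => (hDc j).aestronglyMeasurable.mul hF.1) (hF.abs.const_mul _) ?_ ?_
    · intro j
      refine Eventually.of_forall fun x => ?_
      rw [norm_mul]
      exact mul_le_mul_of_nonneg_right (hDb j x) (norm_nonneg _)
    · filter_upwards [hDlim] with x hx
      exact hx.mul_const _
  have L1 := L0 (LC.integrable_gd H.lip hη.lc)
  have L2 := L0 (F := fun x => w x * lap η x) ((H.lip.continuous.mul hη.lap.cont).integrable_of_hasCompactSupport hη.lap.2.mul_left)
  have hbR : ∀ {x}, ¬ (ρ < ‖x‖) → x ∈ ball (0 : EE n) R := fun hx => by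
    rw [mem_ball_zero_iff]; linarith [not_lt.1 hx]
  have L3 : Tendsto (fun j => ∫ y, q y * (η (gr e φ y) * (w (gr e φ y + h j • Nv e) / h j)) ∂(mF m)) atTop
      (𝓝 (∫ y, q y * (η (gr e φ y) * (q y / (kap e * (1 + ‖fderiv ℝ φ y‖ ^ 2)))) ∂(mF m))) := by
    have hcg := continuous_gr e H.lipφ.continuous
    refine dct_loc H.qi (Fk := fun j y => η (gr e φ y) * (w (gr e φ y + h j • Nv e) / h j)) (B := B * L) (ρ := ρ) ?_ ?_ ?_ ?_
    · exact Eventually.of_forall fun j => ((hη.cont.comp hcg).mul ((H.lip.continuous.comp (hcg.add continuous_const)).div_const _)).aestronglyMeasurable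
    · refine Eventually.of_forall fun j y => ?_
      by_cases hy : ρ < ‖gr e φ y‖
      · rw [hη0 _ hy, zero_mul, abs_zero]; positivity
      · have h2 := hDb j (gr e φ y)
        have h3 : w (gr e φ y) = 0 := H.zero y (φ y) (hbR hy) le_rfl
        rw [h3, sub_zero] at h2
        rw [abs_mul]
        exact mul_le_mul (hB _) h2 (abs_nonneg _) hB0
    · exact Eventually.of_forall fun j y hy => by
        show η (gr e φ y) * _ = 0
        rw [hη0 _ (hy.trans_le (norm_le_gr e φ y)), zero_mul]
    · filter_upwards [H.blow_ae] with y hy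
      right
      by_cases hy' : ρ < ‖gr e φ y‖
      · simp [hη0 _ hy']
      · exact (hy (hbR hy') h hh hlim).const_mul _
  exact le_of_tendsto (((L1.const_mul (-2)).sub L2).sub L3).abs (Eventually.of_forall key)

end LSsec


def om {m : ℕ} (y : EE m) : ℝ := (1 + ‖y‖) ^ (-((m : ℝ) + 1))

lemma om_pos {m : ℕ} (y : EE m) : 0 < om y := by
  unfold om; positivity

lemma continuous_om {m : ℕ} : Continuous (om : EE m → ℝ) := by
  unfold om
  refine Continuous.rpow_const (by fun_prop) (fun x => Or.inl ?_)
  positivity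

lemma integrable_om {m : ℕ} : Integrable (om : EE m → ℝ) (mF m) := by
  unfold om
  apply integrable_one_add_norm
  simp

def omN {m : ℕ} (y : EE m) : ℝ≥0 := Real.toNNReal (om y)

lemma omN_coe {m : ℕ} (y : EE m) : ((omN y : ℝ≥0) : ℝ) = om y :=
  Real.coe_toNNReal _ (om_pos y).le

lemma measurable_omN {m : ℕ} : Measurable (omN : EE m → ℝ≥0) :=
  continuous_om.measurable.real_toNNReal

def nuF (m : ℕ) : Measure (EE m) := (mF m).withDensity (fun y => (omN y : ℝ≥0∞))

instance (m : ℕ) : IsFiniteMeasure (nuF m) :=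
  isFiniteMeasure_withDensity_ofReal (f := (om : EE m → ℝ)) integrable_om.2

lemma integral_nuF {m : ℕ} (f : EE m → ℝ) : ∫ y, f y ∂(nuF m) = ∫ y, om y * f y ∂(mF m) := by
  unfold nuF
  rw [integral_withDensity_eq_integral_smul measurable_omN]
  simp only [NNReal.smul_def, omN_coe, smul_eq_mul]

lemma integrable_nuF {m : ℕ} (f : EE m → ℝ) :
    Integrable f (nuF m) ↔ Integrable (fun y => om y * f y) (mF m) := by
  unfold nuF
  rw [integrable_withDensity_iff_integrable_smul measurable_omN]
  simp only [NNReal.smul_def, omN_coe, smul_eq_mul]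

theorem weak_lim {m : ℕ} {qk : ℕ → EE m → ℝ} {M : ℝ} (hm : ∀ k, Measurable (qk k))
    (hb : ∀ k y, |qk k y| ≤ M) :
    ∃ (σ : ℕ → ℕ) (q0 : EE m → ℝ), StrictMono σ ∧ LocallyIntegrable q0 (mF m) ∧
      ∀ b : EE m → ℝ, Continuous b → HasCompactSupport b →
        Tendsto (fun k => ∫ y, qk (σ k) y * b y ∂(mF m)) atTop (𝓝 (∫ y, q0 y * b y ∂(mF m))) := by
  have hmem : ∀ k, MemLp (qk k) 2 (nuF m) := fun k =>
    MemLp.of_bound (hm k).aestronglyMeasurable M (Eventually.of_forall fun y => by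
      simpa using hb k y)
  have hM : 0 ≤ M := (abs_nonneg _).trans (hb 0 0)
  let T : ℕ → Lp ℝ 2 (nuF m) := fun k => (hmem k).toLp _
  obtain ⟨r, hr⟩ : ∃ r, ∀ k, ‖T k‖ ≤ r := by
    refine ⟨_, fun k => Lp.norm_le_of_ae_bound hM ?_⟩
    filter_upwards [(hmem k).coeFn_toLp] with y hy
    change ‖((hmem k).toLp _ : EE m → ℝ) y‖ ≤ M
    rw [hy]; simpa using hb k y
  haveI : Fact ((2:ℝ≥0∞) ≠ ∞) := ⟨by norm_num⟩
  have hsc := WeakDual.isSeqCompact_closedBall (𝕜 := ℝ) (E := Lp ℝ 2 (nuF m)) 0 r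
  obtain ⟨a, -, σ, hσ, hlim⟩ := hsc (x := fun k => StrongDual.toWeakDual
      (InnerProductSpace.toDual ℝ _ (T k))) (fun k => by
    simp only [mem_preimage, mem_closedBall, dist_zero_right]
    exact ((InnerProductSpace.toDual ℝ _).norm_map _).trans_le (hr k))
  let q : Lp ℝ 2 (nuF m) := (InnerProductSpace.toDual ℝ _).symm (WeakDual.toStrongDual a)
  have hq : ∀ v : Lp ℝ 2 (nuF m), a v = inner ℝ q v := by
    intro v
    rw [InnerProductSpace.toDual_symm_apply]
    rfl
  have hqi : Integrable (fun y => q y) (nuF m) := (Lp.memLp q).integrable (by norm_num)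
  refine ⟨σ, fun y => q y, hσ, ?_, ?_⟩
  · have h1 := ((integrable_nuF _).1 hqi).locallyIntegrable
    have h2 : (fun y => q y) = fun y => (om y)⁻¹ * (om y * q y) := by
      funext y
      have := (om_pos y).ne'
      field_simp
    rw [h2, locallyIntegrable_iff]
    intro K hK
    exact (h1.integrableOn_isCompact hK).continuousOn_mul
      (continuous_om.inv₀ fun y => (om_pos y).ne').continuousOn hK
  · intro b hbc hbs
    have hbc' : Continuous (fun y => b y / om y) := hbc.div continuous_om fun y => (om_pos y).ne'
    have hbs' : HasCompactSupport (fun y => b y / om y) := by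
      have := hbs.mul_right (f' := fun y => (om y)⁻¹)
      simpa [div_eq_mul_inv, Pi.mul_def] using this
    have hbm : MemLp (fun y => b y / om y) 2 (nuF m) := hbc'.memLp_of_hasCompactSupport hbs'
    have key : ∀ (g : EE m → ℝ) (G : Lp ℝ 2 (nuF m)), (G =ᵐ[nuF m] g) →
        inner ℝ G (hbm.toLp _) = ∫ y, g y * b y ∂(mF m) := by
      intro g G hG
      rw [MeasureTheory.L2.inner_def]
      have : ∫ y, inner ℝ (G y) ((hbm.toLp _ : Lp ℝ 2 (nuF m)) y) ∂(nuF m) = ∫ y, g y * (b y / om y) ∂(nuF m) := by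
        apply integral_congr_ae
        filter_upwards [hG, hbm.coeFn_toLp] with y h1 h2
        rw [h1, h2]
        simp [mul_comm]
      rw [this, integral_nuF]
      congr 1; funext y
      have := (om_pos y).ne'
      field_simp
    have h3 : Tendsto (fun k => (StrongDual.toWeakDual
      (InnerProductSpace.toDual ℝ _ (T (σ k)))) (hbm.toLp _)) atTop (𝓝 (a (hbm.toLp _))) :=
      ((WeakDual.eval_continuous (𝕜 := ℝ) (hbm.toLp _)).tendsto a).comp hlim
    rw [hq, key _ q (ae_eq_refl _)] at h3
    refine h3.congr fun k => ?_
    exact key _ (T (σ k)) (hmem (σ k)).coeFn_toLp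


lemma bs_sum (v : EE n) : v = ∑ j : Fin n, v j • (bs j : EE n) := by
  have := (EuclideanSpace.basisFun (Fin n) ℝ).sum_repr v
  simpa [bs] using this.symm

lemma dd_expand (v : EE n) (w : EE n → ℝ) (x : EE n) : dd v w x = ∑ j : Fin n, v j * dd (bs j) w x := by
  unfold dd
  conv_lhs => rw [bs_sum v]
  simp [map_sum]

lemma sq_dd_le (v : EE n) (w z : EE n → ℝ) (x : EE n) :
    (dd v w x - dd v z x) ^ 2 ≤ ‖v‖ ^ 2 * (gd w w x - 2 * gd z w x + gd z z x) := by
  have h1 : dd v w x - dd v z x = ∑ j : Fin n, v j * (dd (bs j) w x - dd (bs j) z x) := by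
    rw [dd_expand v w, dd_expand v z, ← Finset.sum_sub_distrib]
    congr 1; ext j; ring
  have h2 : gd w w x - 2 * gd z w x + gd z z x = ∑ j : Fin n, (dd (bs j) w x - dd (bs j) z x) ^ 2 := by
    unfold gd
    rw [Finset.mul_sum, ← Finset.sum_sub_distrib, ← Finset.sum_add_distrib]
    congr 1; ext j; ring
  rw [h1, h2, EuclideanSpace.real_norm_sq_eq]
  exact Finset.sum_mul_sq_le_sq_mul_sq _ _ _

lemma gd_sq_nonneg (w z : EE n → ℝ) (x : EE n) : 0 ≤ gd w w x - 2 * gd z w x + gd z z x := by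
  have h2 : gd w w x - 2 * gd z w x + gd z z x = ∑ j : Fin n, (dd (bs j) w x - dd (bs j) z x) ^ 2 := by
    unfold gd
    rw [Finset.mul_sum, ← Finset.sum_sub_distrib, ← Finset.sum_add_distrib]
    congr 1; ext j; ring
  rw [h2]; positivity

lemma integrable_mul_gd2 {w z b : EE n → ℝ} {L M : ℝ≥0} (hw : LipschitzWith L w) (hz : LipschitzWith M z)
    (hb : Integrable b) : Integrable fun x => b x * gd w z x :=
  integrable_mul_bdd hb (measurable_gd w z) (gd_le hw hz)

lemma weak_conv_gd {wk : ℕ → EE n → ℝ} {w0 z b : EE n → ℝ} {L M : ℝ≥0} (hL : ∀ k, LipschitzWith L (wk k))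
    (hlim : ∀ x, Tendsto (fun k => wk k x) atTop (𝓝 (w0 x))) (hz : LipschitzWith M z) (hb : Integrable b) :
    Tendsto (fun k => ∫ x, b x * gd z (wk k) x) atTop (𝓝 (∫ x, b x * gd z w0 x)) := by
  have hi : ∀ i : Fin n, Integrable fun x => b x * dd (bs i) z x := fun i =>
    integrable_mul_bdd hb (measurable_dd _ z) (dd_le' hz i)
  have e1 : ∀ {w : EE n → ℝ}, LipschitzWith L w → ∫ x, b x * gd z w x =
      ∑ i : Fin n, ∫ x, (b x * dd (bs i) z x) * dd (bs i) w x := by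
    intro w hw
    rw [← integral_finsetSum]
    · congr 1; ext x; unfold gd; rw [Finset.mul_sum]; congr 1; ext i; ring
    · intro i _
      exact integrable_mul_bdd (hi i) (measurable_dd _ w) (dd_le' hw i)
  rw [e1 (lip_limit hL hlim)]
  simp_rw [fun k => e1 (hL k)]
  exact tendsto_finsetSum _ fun i _ => weak_conv hL hlim (hi i) _

lemma strong_conv {wk : ℕ → EE n → ℝ} {w0 : EE n → ℝ} {L : ℝ≥0} (hL : ∀ k, LipschitzWith L (wk k))
    (hlim : ∀ x, Tendsto (fun k => wk k x) atTop (𝓝 (w0 x)))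
    (hen : ∀ χ : EE n → ℝ, SC χ → Tendsto (fun k => ∫ x, χ x * gd (wk k) (wk k) x) atTop
      (𝓝 (∫ x, χ x * gd w0 w0 x)))
    {η : EE n → ℝ} (hη : SC η) (v : EE n) :
    Tendsto (fun k => ∫ x, dd v (wk k) x * gd (wk k) η x) atTop (𝓝 (∫ x, dd v w0 x * gd w0 η x)) := by
  have hL0 := lip_limit hL hlim
  obtain ⟨⟨M, hM⟩, -⟩ := hη.lc
  obtain ⟨χ, hχ1, hχ2, hχ0, hχL⟩ : ∃ χ : EE n → ℝ, SC χ ∧ (∀ x ∈ tsupport η, χ x = 1) ∧ (∀ x, 0 ≤ χ x) ∧ True := by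
    obtain ⟨B, ρ, -, hρ, -, h2, -⟩ := bdd_supp hη.cont hη.2
    let b : ContDiffBump (0 : EE n) := ⟨ρ, ρ + 1, hρ, by linarith⟩
    refine ⟨b, ⟨b.contDiff, b.hasCompactSupport⟩, fun x hx => b.one_of_mem_closedBall (ball_subset_closedBall (h2 hx)),
      fun x => b.nonneg, trivial⟩
  set D : ℕ → EE n → ℝ := fun k x => gd (wk k) (wk k) x - 2 * gd w0 (wk k) x + gd w0 w0 x with hD
  have hD0 : ∀ k x, 0 ≤ D k x := fun k x => gd_sq_nonneg _ _ _
  have hDi : ∀ k, Integrable fun x => χ x * D k x := by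
    intro k
    have a1 := integrable_mul_gd2 (hL k) (hL k) hχ1.lc.integrable
    have a2 := integrable_mul_gd2 hL0 (hL k) hχ1.lc.integrable
    have a3 := integrable_mul_gd2 hL0 hL0 hχ1.lc.integrable
    exact ((a1.sub (a2.const_mul 2)).add a3).congr (Eventually.of_forall fun x => by
      simp only [hD, Pi.add_apply, Pi.sub_apply]; ring)
  have hDl : Tendsto (fun k => ∫ x, χ x * D k x) atTop (𝓝 0) := by
    have e1 : ∀ k, ∫ x, χ x * D k x = (∫ x, χ x * gd (wk k) (wk k) x) - 2 * (∫ x, χ x * gd w0 (wk k) x)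
        + ∫ x, χ x * gd w0 w0 x := by
      intro k
      have a1 := integrable_mul_gd2 (hL k) (hL k) hχ1.lc.integrable
      have a2 := integrable_mul_gd2 hL0 (hL k) hχ1.lc.integrable
      have a3 := integrable_mul_gd2 hL0 hL0 hχ1.lc.integrable
      have a4 : Integrable fun x => χ x * gd (wk k) (wk k) x - 2 * (χ x * gd w0 (wk k) x) := a1.sub (a2.const_mul 2)
      rw [← integral_const_mul, ← integral_sub a1 (a2.const_mul 2), ← integral_add a4 a3]
      congr 1; ext x; simp only [hD]; ring
    simp_rw [e1]
    have := ((hen χ hχ1).sub ((weak_conv_gd hL hlim hL0 hχ1.lc.integrable).const_mul 2)).add_const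
      (∫ x, χ x * gd w0 w0 x)
    convert this using 2
    ring
  -- decomposition
  have hηi : ∀ i : Fin n, Integrable (dd (bs i) η) := fun i => hη.lc.integrable_dd _
  have ei : ∀ {a : EE n → ℝ}, LipschitzWith L a → ∀ i : Fin n, Integrable fun x => dd (bs i) η x * dd v a x :=
    fun ha i => integrable_mul_bdd (hηi i) (measurable_dd _ _) (dd_le ha v)
  have ei2 : ∀ {a b : EE n → ℝ}, LipschitzWith L a → LipschitzWith L b → ∀ i : Fin n, Integrable fun x =>
      dd (bs i) η x * dd v a x * dd (bs i) b x :=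
    fun ha hb i => integrable_mul_bdd (ei ha i) (measurable_dd _ _) (dd_le' hb i)
  have ei3 : ∀ {a : EE n → ℝ}, LipschitzWith L a → ∀ i : Fin n, Integrable fun x => dd (bs i) η x * dd (bs i) a x :=
    fun ha i => integrable_mul_bdd (hηi i) (measurable_dd _ _) (dd_le' ha i)
  have e1 : ∀ {w : EE n → ℝ}, LipschitzWith L w → ∫ x, dd v w x * gd w η x =
      ∑ i : Fin n, ∫ x, dd (bs i) η x * dd v w x * dd (bs i) w x := by
    intro w hw
    rw [← integral_finsetSum]
    · congr 1; ext x; unfold gd; rw [Finset.mul_sum]; congr 1; ext i; ring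
    · intro i _
      exact ei2 hw hw i
  rw [e1 hL0]
  simp_rw [fun k => e1 (hL k)]
  refine tendsto_finsetSum _ fun i _ => ?_
  set E : ℕ → EE n → ℝ := fun k x => dd (bs i) η x * ((dd v (wk k) x - dd v w0 x) * (dd (bs i) (wk k) x - dd (bs i) w0 x)) with hE
  have e2 : ∀ k x, dd (bs i) η x * dd v (wk k) x * dd (bs i) (wk k) x = E k x +
      (dd (bs i) η x * dd v w0 x * dd (bs i) (wk k) x + (dd (bs i) η x * dd (bs i) w0 x * dd v (wk k) x -
       dd (bs i) η x * dd v w0 x * dd (bs i) w0 x)) := by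
    intro k x; simp only [hE]; ring
  have hE' : ∀ k x, E k x = dd (bs i) η x * dd v (wk k) x * dd (bs i) (wk k) x - 
      (dd (bs i) η x * dd v w0 x * dd (bs i) (wk k) x + (dd (bs i) η x * dd (bs i) w0 x * dd v (wk k) x -
       dd (bs i) η x * dd v w0 x * dd (bs i) w0 x)) := by
    intro k x; rw [e2]; ring
  have i1 := fun k => ei2 hL0 (hL k) i
  have i2 := fun k => integrable_mul_bdd (ei3 hL0 i) (measurable_dd v (wk k)) (dd_le (hL k) v)
  have i3 := ei2 hL0 hL0 i
  have i4 : ∀ k, Integrable (E k) := by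
    intro k
    exact ((ei2 (hL k) (hL k) i).sub ((i1 k).add ((i2 k).sub i3))).congr (Eventually.of_forall fun x => (hE' k x).symm)
  have hEl : Tendsto (fun k => ∫ x, E k x) atTop (𝓝 0) := by
    have hb : ∀ k, ‖∫ x, E k x‖ ≤ (M * ((‖v‖ ^ 2 + 1) / 2)) * ∫ x, χ x * D k x := by
      intro k
      rw [← integral_const_mul]
      refine norm_integral_le_of_norm_le ((hDi k).const_mul _) (Eventually.of_forall fun x => ?_)
      by_cases hx : x ∈ tsupport η
      · rw [hχ2 x hx, one_mul, Real.norm_eq_abs]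
        simp only [hE]
        rw [abs_mul, mul_assoc]
        refine mul_le_mul (dd_le' hM i x) ?_ (abs_nonneg _) M.2
        have b1 := sq_dd_le v (wk k) w0 x
        have b2 := sq_dd_le (bs i) (wk k) w0 x
        have hbn : ‖(bs i : EE n)‖ = 1 := by simp [bs]
        rw [hbn] at b2
        have b3 : |(dd v (wk k) x - dd v w0 x) * (dd (bs i) (wk k) x - dd (bs i) w0 x)| ≤
          ((dd v (wk k) x - dd v w0 x) ^ 2 + (dd (bs i) (wk k) x - dd (bs i) w0 x) ^ 2) / 2 := by
          rw [abs_le]; constructor <;> nlinarith [sq_nonneg (dd v (wk k) x - dd v w0 x + (dd (bs i) (wk k) x - dd (bs i) w0 x)), sq_nonneg (dd v (wk k) x - dd v w0 x - (dd (bs i) (wk k) x - dd (bs i) w0 x))]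
        refine b3.trans ?_
        simp only [hD]
        linarith
      · simp only [hE]
        rw [dd_zero_of_notMem hx, zero_mul, norm_zero]
        have := hχ0 x
        have := hD0 k x
        positivity
    refine squeeze_zero_norm hb ?_
    simpa using hDl.const_mul (M * ((‖v‖ ^ 2 + 1) / 2))
  have e3 : ∀ k, ∫ x, dd (bs i) η x * dd v (wk k) x * dd (bs i) (wk k) x = (∫ x, E k x) +
      ((∫ x, dd (bs i) η x * dd v w0 x * dd (bs i) (wk k) x) + ((∫ x, dd (bs i) η x * dd (bs i) w0 x * dd v (wk k) x) -
       ∫ x, dd (bs i) η x * dd v w0 x * dd (bs i) w0 x)) := by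
    intro k
    have i5 : Integrable fun x => dd (bs i) η x * dd (bs i) w0 x * dd v (wk k) x -
       dd (bs i) η x * dd v w0 x * dd (bs i) w0 x := (i2 k).sub i3
    have i6 : Integrable fun x => dd (bs i) η x * dd v w0 x * dd (bs i) (wk k) x + (dd (bs i) η x * dd (bs i) w0 x * dd v (wk k) x -
       dd (bs i) η x * dd v w0 x * dd (bs i) w0 x) := (i1 k).add i5
    rw [← integral_sub (i2 k) i3, ← integral_add (i1 k) i5, ← integral_add (i4 k) i6]
    exact integral_congr_ae (Eventually.of_forall fun x => e2 k x)
  simp_rw [e3]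
  have t1 := weak_conv hL hlim (ei hL0 i) (bs i)
  have t2 := weak_conv hL hlim (ei3 hL0 i) v
  have := hEl.add (t1.add (t2.sub_const (∫ x, dd (bs i) η x * dd v w0 x * dd (bs i) w0 x)))
  convert this using 2
  have : ∫ x, dd (bs i) η x * dd (bs i) w0 x * dd v w0 x = ∫ x, dd (bs i) η x * dd v w0 x * dd (bs i) w0 x := by
    congr 1; ext x; ring
  rw [this]; ring

lemma cross_conv {wk : ℕ → EE n → ℝ} {w0 : EE n → ℝ} {L : ℝ≥0} (hL : ∀ k, LipschitzWith L (wk k))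
    (h0 : ∀ k, wk k 0 = 0)
    (hlim : ∀ x, Tendsto (fun k => wk k x) atTop (𝓝 (w0 x))) {θ : EE n → ℝ} (hθ : SC θ) (v : EE n) :
    Tendsto (fun k => ∫ x, dd v (wk k) x * (wk k x * θ x)) atTop (𝓝 (∫ x, dd v w0 x * (w0 x * θ x))) := by
  have hL0 := lip_limit hL hlim
  have hw0 : w0 0 = 0 := tendsto_nhds_unique (hlim 0) (by simp [h0])
  have hi : ∀ {a : EE n → ℝ}, Continuous a → Integrable fun x => a x * θ x := fun ha =>
    (ha.mul hθ.cont).integrable_of_hasCompactSupport hθ.2.mul_left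
  have hL2 : ∀ k, LipschitzWith (L + L) (fun x => |wk k x - w0 x|) := by
    intro k
    have := lipschitzWith_one_norm.comp ((hL k).sub hL0)
    simpa [Function.comp_def] using this
  have h1 : Tendsto (fun k => ∫ x, |wk k x - w0 x| * |θ x|) atTop (𝓝 (∫ x, (fun _ => (0 : ℝ)) x * |θ x|)) := by
    refine lip_int_conv hL2 (fun k => by simp [h0, hw0]) (fun x => ?_) (by have := hθ.cont; fun_prop) hθ.2.abs
    have := ((hlim x).sub_const (w0 x)).abs
    simpa using this
  simp only [zero_mul, integral_zero] at h1
  have h2 : Tendsto (fun k => ∫ x, (wk k x - w0 x) * θ x * dd v (wk k) x) atTop (𝓝 0) := by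
    refine squeeze_zero_norm (a := fun k => (L * ‖v‖) * ∫ x, |wk k x - w0 x| * |θ x|) (fun k => ?_)
      (by simpa using h1.const_mul (L * ‖v‖))
    rw [← integral_const_mul]
    refine norm_integral_le_of_norm_le ?_ (Eventually.of_forall fun x => ?_)
    · refine Integrable.const_mul ?_ _
      have := (hi ((hL k).continuous.sub hL0.continuous)).abs
      simpa [abs_mul] using this
    · rw [Real.norm_eq_abs, abs_mul, abs_mul, mul_comm]
      gcongr
      exact dd_le (hL k) v x
  have h3 := (weak_conv hL hlim (hi hL0.continuous) v).add h2
  rw [add_zero] at h3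
  have e : ∀ x, dd v w0 x * (w0 x * θ x) = w0 x * θ x * dd v w0 x := fun x => mul_comm _ _
  simp_rw [e]
  refine h3.congr fun k => ?_
  rw [← integral_add]
  · congr 1; ext x; ring
  · exact integrable_mul_bdd (hi hL0.continuous) (measurable_dd _ _) (dd_le (hL k) v)
  · exact integrable_mul_bdd (hi ((hL k).continuous.sub hL0.continuous)) (measurable_dd _ _) (dd_le (hL k) v)

section LSsec
variable {m : ℕ} {e : WithLp 2 (EE m × ℝ) ≃ₗᵢ[ℝ] EE n} {L K : ℝ≥0} {ε R : ℝ} {w : EE n → ℝ}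
    {φ q : EE m → ℝ} {g : EE n → ℝ}

lemma LS.energy (H : LS e L K ε R w φ q g) {η : EE n → ℝ} (hη : SC η) (hs : tsupport η ⊆ ball 0 R) :
    ∫ x, η x * gd w w x = (1 / 2) * (∫ x, w x * w x * lap η x) + ∫ x, g x * (η x * w x) := by
  have h1 := H.test (hη.lc.mul_lip H.lip) (tsupport_mul_subset_left'.trans hs)
  have h2 : ∫ y, q y * (η (gr e φ y) * w (gr e φ y)) ∂(mF m) = 0 := by
    rw [← integral_zero (EE m) ℝ (μ := mF m)]
    congr 1; ext y
    by_cases hy : gr e φ y ∈ ball 0 R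
    · rw [show w (gr e φ y) = 0 from H.zero y (φ y) hy le_rfl]; simp
    · rw [image_eq_zero_of_notMem_tsupport fun h => hy (hs h)]; simp
  have h3 := ibp2 H.lip H.lip hη
  have h4 : ∫ x, gd w (fun x => η x * w x) x = (∫ x, η x * gd w w x) + ∫ x, w x * gd w η x := by
    rw [← integral_add (integrable_mul_gd2 H.lip H.lip hη.lc.integrable) (integrable_mul_gd H.lip hη H.lip.continuous)]
    apply integral_congr_ae
    filter_upwards [H.lip.ae_differentiableAt] with x hx
    exact gd_mul (hη.diff x) hx
  rw [h2, h4] at h1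
  linarith

end LSsec


section LSsec
variable {m : ℕ} {e : WithLp 2 (EE m × ℝ) ≃ₗᵢ[ℝ] EE n} {L K : ℝ≥0}

lemma qgraph_conv {φk qk : ℕ → EE m → ℝ} {φ0 q0 : EE m → ℝ} {M : ℝ}
    (hφc : ∀ k, Continuous (φk k)) (hφ0 : Continuous φ0)
    (hφ : ∀ y, Tendsto (fun k => φk k y) atTop (𝓝 (φ0 y)))
    (hqm : ∀ k, Measurable (qk k)) (hqb : ∀ k y, |qk k y| ≤ M)
    (hq : ∀ b : EE m → ℝ, Continuous b → HasCompactSupport b →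
        Tendsto (fun k => ∫ y, qk k y * b y ∂(mF m)) atTop (𝓝 (∫ y, q0 y * b y ∂(mF m))))
    {η : EE n → ℝ} (hc : Continuous η) (hs : HasCompactSupport η) :
    Tendsto (fun k => ∫ y, qk k y * η (gr e (φk k) y) ∂(mF m)) atTop (𝓝 (∫ y, q0 y * η (gr e φ0 y) ∂(mF m))) := by
  obtain ⟨B, ρ, hB, hρ, h1, -, h3⟩ := bdd_supp hc hs
  have hcs : ∀ {φ : EE m → ℝ}, HasCompactSupport fun y => η (gr e φ y) := by
    intro φ
    refine HasCompactSupport.of_support_subset_isCompact (isCompact_closedBall 0 ρ) fun y hy => ?_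
    by_contra h
    apply hy
    rw [mem_closedBall_zero_iff, not_le] at h
    exact h3 _ (h.trans_le (norm_le_gr e _ y))
  have hcc : ∀ {φ : EE m → ℝ}, Continuous φ → Continuous fun y => η (gr e φ y) := fun h =>
    hc.comp (continuous_gr e h)
  have hintg : ∀ k {b : EE m → ℝ}, Continuous b → HasCompactSupport b → Integrable (fun y => qk k y * b y) (mF m) := by
    intro k b hb hb'
    have := (hb.integrable_of_hasCompactSupport (μ := mF m) hb').mul_bdd (c := M) (hqm k).aestronglyMeasurable
      (Eventually.of_forall (hqb k))
    exact this.congr (Eventually.of_forall fun x => by ring)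
  have t1 := hq _ (hcc hφ0) (hcs (φ := φ0))
  have t2 : Tendsto (fun k => ∫ y, qk k y * (η (gr e (φk k) y) - η (gr e φ0 y)) ∂(mF m)) atTop (𝓝 0) := by
    have t3 : Tendsto (fun k => ∫ y, (fun _ => M) y * |η (gr e (φk k) y) - η (gr e φ0 y)| ∂(mF m)) atTop
        (𝓝 (∫ y, (fun _ => M) y * (fun _ => (0:ℝ)) y ∂(mF m))) := by
      refine dct_loc (locallyIntegrable_const M) (B := 2 * B) (ρ := ρ) ?_ ?_ ?_ ?_
      · refine Eventually.of_forall fun k => Continuous.aestronglyMeasurable ?_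
        exact ((hcc (hφc k)).sub (hcc hφ0)).abs
      · refine Eventually.of_forall fun k y => ?_
        rw [abs_abs]
        exact (abs_sub _ _).trans (by linarith [h1 (gr e (φk k) y), h1 (gr e φ0 y)])
      · refine Eventually.of_forall fun k y hy => ?_
        rw [h3 _ (hy.trans_le (norm_le_gr e _ y)), h3 _ (hy.trans_le (norm_le_gr e _ y))]; simp
      · refine Eventually.of_forall fun y => Or.inr ?_
        have a1 := (hc.tendsto _).comp (gr_tendsto (e := e) (hφ y))
        have := (a1.sub_const (η (gr e φ0 y))).abs
        simpa using this
    simp only [mul_zero, integral_zero] at t3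
    refine squeeze_zero_norm (fun k => ?_) t3
    refine norm_integral_le_of_norm_le ?_ (Eventually.of_forall fun y => ?_)
    · refine Integrable.const_mul ?_ _
      exact (((hcc (hφc k)).integrable_of_hasCompactSupport hcs).sub ((hcc hφ0).integrable_of_hasCompactSupport hcs)).abs
    · rw [Real.norm_eq_abs, abs_mul]
      gcongr
      exact hqb k y
  have t4 := t1.add t2
  rw [add_zero] at t4
  refine t4.congr fun k => ?_
  have i2 : Integrable (fun y => qk k y * (η (gr e (φk k) y) - η (gr e φ0 y))) (mF m) :=
    hintg k ((hcc (hφc k)).sub (hcc hφ0)) (hcs.sub hcs)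
  rw [← integral_add (hintg k (hcc hφ0) hcs) i2]
  congr 1; ext y; ring

lemma graph_test (e : WithLp 2 (EE m × ℝ) ≃ₗᵢ[ℝ] EE n) {φ F : EE m → ℝ} (hφ : Continuous φ) (hF : LocallyIntegrable F (mF m))
    (h : ∀ η : EE n → ℝ, SC η → ∫ y, F y * η (gr e φ y) ∂(mF m) = 0) : ∀ᵐ y ∂(mF m), F y = 0 := by
  have hemb := measurableEmbedding_gr e hφ
  have h1 : ∀ᵐ x ∂((mF m).map (gr e φ)), F (hc e x) = 0 := by
    refine ae_eq_zero_of_integral_contDiff_smul_eq_zero ?_ ?_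
    · rw [locallyIntegrable_iff]
      intro S hS
      rw [hemb.integrableOn_map_iff]
      obtain ⟨ρ, hρ⟩ := hS.isBounded.subset_closedBall 0
      have h2 : gr e φ ⁻¹' S ⊆ closedBall 0 ρ := by
        intro y hy
        have := hρ hy
        rw [mem_closedBall_zero_iff] at this ⊢
        exact (norm_le_gr e φ y).trans this
      have h3 : (fun x => F (hc e x)) ∘ gr e φ = F := by
        ext y; simp [gr, hc_pt]
      rw [h3]
      exact (hF.integrableOn_isCompact (isCompact_closedBall 0 ρ)).mono_set h2
    · intro η h1 h2
      rw [hemb.integral_map, ← h η ⟨h1, h2⟩]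
      congr 1; ext y
      simp [gr, hc_pt, mul_comm]
  rw [hemb.ae_map_iff] at h1
  filter_upwards [h1] with y hy
  simpa [gr, hc_pt] using hy


lemma limit_core {εk Rk : ℕ → ℝ} {wk gk : ℕ → EE n → ℝ} {φk qk : ℕ → EE m → ℝ} {w0 : EE n → ℝ} {φ0 q0 : EE m → ℝ}
    (Hk : ∀ k, LS e L K (εk k) (Rk k) (wk k) (φk k) (qk k) (gk k))
    (hε : Tendsto εk atTop (𝓝 0)) (hR : Tendsto Rk atTop atTop) (h0 : ∀ k, wk k 0 = 0)
    (hw : ∀ x, Tendsto (fun k => wk k x) atTop (𝓝 (w0 x)))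
    (hφ : ∀ y, Tendsto (fun k => φk k y) atTop (𝓝 (φ0 y)))
    {M : ℝ} (hqm : ∀ k, Measurable (qk k)) (hqb : ∀ k y, |qk k y| ≤ M)
    (hqi : LocallyIntegrable q0 (mF m))
    (hq : ∀ b : EE m → ℝ, Continuous b → HasCompactSupport b →
        Tendsto (fun k => ∫ y, qk k y * b y ∂(mF m)) atTop (𝓝 (∫ y, q0 y * b y ∂(mF m))))
    {M' s0 : ℝ} (hs0 : 0 ≤ s0)
    (hsb : ∀ k y, |qk k y * (qk k y / (kap e * (1 + ‖fderiv ℝ (φk k) y‖ ^ 2)))| ≤ M')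
    (hsl : ∀ y, Tendsto (fun k => qk k y * (qk k y / (kap e * (1 + ‖fderiv ℝ (φk k) y‖ ^ 2)))) atTop
      (𝓝 (s0 ^ 2 / kap e)))
    {η : EE n → ℝ} (hη : SC η) :
    ∫ x, w0 x * lap η x = s0 * ∫ y, Jf (fderiv ℝ φ0 y) * η (gr e φ0 y) ∂(mF m) := by
  have hκ := kap_pos e
  have hL : ∀ k, LipschitzWith L (wk k) := fun k => (Hk k).lip
  have hL0 := lip_limit hL hw
  have hφ0 : LipschitzWith K φ0 := lip_limit (fun k => (Hk k).lipφ) hφ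
  have hqΓ : ∀ {η : EE n → ℝ}, SC η → Tendsto (fun k => ∫ y, qk k y * η (gr e (φk k) y) ∂(mF m)) atTop
      (𝓝 (∫ y, q0 y * η (gr e φ0 y) ∂(mF m))) := fun hη =>
    qgraph_conv (fun k => (Hk k).lipφ.continuous) hφ0.continuous hφ hqm hqb hq hη.cont hη.2
  have hz := LS_lim_zero' hL0.continuous (LS_lim_zero Hk hR hw hφ)
  have hw00 : w0 0 = 0 := tendsto_nhds_unique (hw 0) (by simp [h0])
  have H0 : ∀ R, LS e L K 0 R w0 φ0 q0 (fun _ => 0) := by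
    intro R
    refine ⟨hL0, fun x => ge_of_tendsto (hw x) (Eventually.of_forall fun k => (Hk k).nn x), hφ0, hqi,
      measurable_const, by simp, fun y t _ ht => hz y t ht, fun η hη _ => ?_⟩
    rw [LS_lim Hk hε hR h0 hw hη (hqΓ hη)]
    simp
  -- energy convergence
  have hen : ∀ χ : EE n → ℝ, SC χ → Tendsto (fun k => ∫ x, χ x * gd (wk k) (wk k) x) atTop
      (𝓝 (∫ x, χ x * gd w0 w0 x)) := by
    intro χ hχ
    obtain ⟨B, ρ, hB, hρ, hχ1, hχ2, hχ3⟩ := bdd_supp hχ.cont hχ.2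
    rw [(H0 ρ).energy hχ hχ2]
    have a1 : Tendsto (fun k => ∫ x, wk k x * wk k x * lap χ x) atTop (𝓝 (∫ x, w0 x * w0 x * lap χ x)) := by
      refine tendsto_integral_of_dominated_convergence (fun x => (L * ‖x‖) * (L * ‖x‖) * |lap χ x|) ?_ ?_ ?_ ?_
      · exact fun k => (((hL k).continuous.mul (hL k).continuous).mul hχ.lap.cont).aestronglyMeasurable
      · have := hχ.lap.cont
        exact Continuous.integrable_of_hasCompactSupport (by fun_prop) hχ.lap.2.abs.mul_left
      · intro k
        refine Eventually.of_forall fun x => ?_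
        have h1 := abs_le_of_lip (hL k) x
        rw [h0 k, abs_zero, zero_add] at h1
        rw [Real.norm_eq_abs, abs_mul, abs_mul]
        gcongr
      · exact Eventually.of_forall fun x => ((hw x).mul (hw x)).mul_const _
    have a2 : Tendsto (fun k => ∫ x, gk k x * (χ x * wk k x)) atTop (𝓝 0) := by
      refine squeeze_zero_norm (a := fun k => εk k * ∫ x, |χ x| * (L * ‖x‖)) (fun k => ?_)
        (by simpa using hε.mul_const _)
      rw [← integral_const_mul]
      refine norm_integral_le_of_norm_le ?_ (Eventually.of_forall fun x => ?_)
      · have := hχ.cont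
        have hci : Continuous fun x => |χ x| * (L * ‖x‖) := by fun_prop
        exact (hci.integrable_of_hasCompactSupport hχ.2.abs.mul_right).const_mul _
      · have h1 := abs_le_of_lip (hL k) x
        rw [h0 k, abs_zero, zero_add] at h1
        have h2 := (Hk k).gb x
        rw [Real.norm_eq_abs, abs_mul, abs_mul]
        exact mul_le_mul h2 (by gcongr) (by positivity) ((abs_nonneg _).trans h2)
    have a3 := (a1.const_mul (1 / 2)).add a2
    simp only [zero_mul, integral_zero]
    refine a3.congr' ?_
    filter_upwards [hR.eventually_ge_atTop ρ] with k hk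
    exact ((Hk k).energy hχ (hχ2.trans (ball_subset_ball hk))).symm
  -- Rellich identity in the limit
  have hrel : ∀ η : EE n → ℝ, SC η →
      ∫ y, q0 y * (η (gr e φ0 y) * (q0 y / (kap e * (1 + ‖fderiv ℝ φ0 y‖ ^ 2)))) ∂(mF m) =
      ∫ y, s0 ^ 2 / kap e * η (gr e φ0 y) ∂(mF m) := by
    intro η hη
    obtain ⟨B, ρ, hB, hρ, hη1, hη2, hη3⟩ := bdd_supp hη.cont hη.2
    obtain ⟨C, hC⟩ := LS.rellich (e := e) L hη hρ hη2
    have b0 := hC K 0 (ρ + 1) w0 φ0 q0 _ (H0 (ρ + 1)) le_rfl hw00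
    rw [mul_zero] at b0
    have b1 := abs_nonpos_iff.1 b0
    have t1 := ((strong_conv hL hw hen hη (Nv e)).const_mul (-2)).sub
      (cross_conv hL h0 hw hη.lap (Nv e))
    have t2 : Tendsto (fun k => ∫ y, qk k y * (η (gr e (φk k) y) *
        (qk k y / (kap e * (1 + ‖fderiv ℝ (φk k) y‖ ^ 2)))) ∂(mF m)) atTop
        (𝓝 (∫ y, s0 ^ 2 / kap e * η (gr e φ0 y) ∂(mF m))) := by
      have := dct_loc (μ := mF m) (l := atTop) (q := fun _ => (1 : ℝ)) (locallyIntegrable_const 1)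
        (Fk := fun k y => (qk k y * (qk k y / (kap e * (1 + ‖fderiv ℝ (φk k) y‖ ^ 2)))) * η (gr e (φk k) y))
        (F := fun y => s0 ^ 2 / kap e * η (gr e φ0 y)) (B := M' * B) (ρ := ρ) ?_ ?_ ?_ ?_
      · simp only [one_mul] at this
        refine this.congr fun k => ?_
        congr 1; ext y; ring
      · refine Eventually.of_forall fun k => AEStronglyMeasurable.mul ?_
          ((hη.cont.comp (continuous_gr e (Hk k).lipφ.continuous)).aestronglyMeasurable)
        have h1 := hqm k
        have h2 : Measurable fun y => fderiv ℝ (φk k) y := measurable_fderiv ℝ _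
        exact (h1.mul (h1.div ((((h2.norm.pow_const 2).const_add 1)).const_mul _))).aestronglyMeasurable
      · refine Eventually.of_forall fun k y => ?_
        rw [abs_mul]
        exact mul_le_mul (hsb k y) (hη1 _) (abs_nonneg _) ((abs_nonneg _).trans (hsb k y))
      · refine Eventually.of_forall fun k y hy => ?_
        rw [hη3 _ (hy.trans_le (norm_le_gr e _ y)), mul_zero]
      · refine Eventually.of_forall fun y => Or.inr ?_
        exact (hsl y).mul ((hη.cont.tendsto _).comp (gr_tendsto (e := e) (hφ y)))
    have t3 := tendsto_nhds_unique (t1.sub t2) (squeeze_zero_norm' (a := fun k => C * εk k) (by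
      filter_upwards [hR.eventually_ge_atTop (ρ + 1)] with k hk
      exact hC K (εk k) (Rk k) (wk k) (φk k) (qk k) _ (Hk k) hk (h0 k)) (by simpa using hε.const_mul C))
    linarith
  -- bounds for the density
  have hA : ∀ᵐ y ∂(mF m), 0 ≤ q0 y / (kap e * (1 + ‖fderiv ℝ φ0 y‖ ^ 2)) ∧
      q0 y / (kap e * (1 + ‖fderiv ℝ φ0 y‖ ^ 2)) ≤ L := by
    have := ae_all_iff.2 fun N : ℕ => (H0 N).blow_ae
    filter_upwards [this] with y hy
    obtain ⟨N, hN⟩ := exists_nat_gt ‖gr e φ0 y‖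
    have h1 := hy N (by simpa using hN) (fun j => 1 / ((j : ℝ) + 1)) (fun j => by positivity)
      tendsto_one_div_add_atTop_nhds_zero_nat
    have hpos : ∀ j : ℕ, 0 < 1 / ((j : ℝ) + 1) := fun j => by positivity
    constructor
    · refine ge_of_tendsto h1 (Eventually.of_forall fun j => ?_)
      exact div_nonneg ((H0 0).nn _) (hpos j).le
    · refine le_of_tendsto h1 (Eventually.of_forall fun j => ?_)
      rw [div_le_iff₀ (hpos j)]
      have h2 := hL0.dist_le_mul (gr e φ0 y + (1 / ((j : ℝ) + 1)) • Nv e) (gr e φ0 y)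
      rw [show w0 (gr e φ0 y) = 0 from hz y _ le_rfl, Real.dist_eq, sub_zero, dist_eq_norm, add_sub_cancel_left,
        norm_smul, norm_Nv, mul_one, Real.norm_of_nonneg (hpos j).le] at h2
      exact (le_abs_self _).trans h2
  have hAm : AEStronglyMeasurable (fun y => q0 y / (kap e * (1 + ‖fderiv ℝ φ0 y‖ ^ 2))) (mF m) := by
    have h2 : Measurable fun y => fderiv ℝ φ0 y := measurable_fderiv ℝ _
    have h3 := hqi.aestronglyMeasurable.aemeasurable
    exact (h3.div ((((h2.norm.pow_const 2).const_add 1)).const_mul _).aemeasurable).aestronglyMeasurable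
  have hFi1 : LocallyIntegrable (fun y => q0 y * (q0 y / (kap e * (1 + ‖fderiv ℝ φ0 y‖ ^ 2)))) (mF m) := by
    rw [locallyIntegrable_iff]
    intro S hS
    refine Integrable.mul_bdd (c := L) (hqi.integrableOn_isCompact hS) hAm.restrict (ae_restrict_of_ae ?_)
    filter_upwards [hA] with y hy
    rw [Real.norm_of_nonneg hy.1]; exact hy.2
  have hF : ∀ᵐ y ∂(mF m), q0 y * (q0 y / (kap e * (1 + ‖fderiv ℝ φ0 y‖ ^ 2))) - s0 ^ 2 / kap e = 0 := by
    refine graph_test e hφ0.continuous (hFi1.sub (locallyIntegrable_const _)) fun η hη => ?_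
    have hηc : Continuous fun y => η (gr e φ0 y) := hη.cont.comp (continuous_gr e hφ0.continuous)
    obtain ⟨B, ρ, hB, hρ, hη1, hη2, hη3⟩ := bdd_supp hη.cont hη.2
    have hcs : HasCompactSupport fun y => η (gr e φ0 y) := by
      refine HasCompactSupport.of_support_subset_isCompact (isCompact_closedBall 0 ρ) fun y hy => ?_
      by_contra h
      apply hy
      rw [mem_closedBall_zero_iff, not_le] at h
      exact hη3 _ (h.trans_le (norm_le_gr e _ y))
    have j1 : Integrable (fun y => q0 y * (q0 y / (kap e * (1 + ‖fderiv ℝ φ0 y‖ ^ 2))) * η (gr e φ0 y)) (mF m) := by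
      have := hFi1.integrable_smul_left_of_hasCompactSupport hηc hcs
      exact this.congr (Eventually.of_forall fun y => by simp only [smul_eq_mul]; ring)
    have j2 : Integrable (fun y => s0 ^ 2 / kap e * η (gr e φ0 y)) (mF m) :=
      (hηc.integrable_of_hasCompactSupport hcs).const_mul _
    have := hrel η hη
    have e1 : ∀ y, (q0 y * (q0 y / (kap e * (1 + ‖fderiv ℝ φ0 y‖ ^ 2))) - s0 ^ 2 / kap e) * η (gr e φ0 y) =
      q0 y * (q0 y / (kap e * (1 + ‖fderiv ℝ φ0 y‖ ^ 2))) * η (gr e φ0 y) - s0 ^ 2 / kap e * η (gr e φ0 y) := fun y => by ring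
    simp_rw [e1]
    rw [integral_sub j1 j2, ← this, sub_eq_zero]
    congr 1; ext y; ring
  rw [LS_lim Hk hε hR h0 hw hη (hqΓ hη), ← integral_const_mul]
  apply integral_congr_ae
  filter_upwards [hA, hF] with y hy1 hy2
  have hp : 0 < 1 + ‖fderiv ℝ φ0 y‖ ^ 2 := by positivity
  have hq0 : 0 ≤ q0 y := by
    have := hy1.1
    by_contra h
    push Not at h
    have := div_neg_of_neg_of_pos h (mul_pos hκ hp)
    linarith
  have hsq : q0 y ^ 2 = (s0 * Jf (fderiv ℝ φ0 y)) ^ 2 := by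
    rw [mul_pow, Jf_sq]
    field_simp at hy2
    rw [mul_zero] at hy2
    have h5 := sub_eq_zero.1 hy2
    linarith
  have := (sq_eq_sq₀ hq0 (mul_nonneg hs0 (Jf_pos _).le)).1 hsq
  rw [this]; ring

theorem limit_main {εk Rk : ℕ → ℝ} {wk gk : ℕ → EE n → ℝ} {φk qk : ℕ → EE m → ℝ} {w0 : EE n → ℝ} {φ0 : EE m → ℝ}
    (Hk : ∀ k, LS e L K (εk k) (Rk k) (wk k) (φk k) (qk k) (gk k))
    (hε : Tendsto εk atTop (𝓝 0)) (hR : Tendsto Rk atTop atTop) (h0 : ∀ k, wk k 0 = 0)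
    (hw : ∀ x, Tendsto (fun k => wk k x) atTop (𝓝 (w0 x)))
    (hφ : ∀ y, Tendsto (fun k => φk k y) atTop (𝓝 (φ0 y)))
    {M : ℝ} (hqm : ∀ k, Measurable (qk k)) (hqb : ∀ k y, |qk k y| ≤ M)
    {M' s0 : ℝ} (hs0 : 0 ≤ s0)
    (hsb : ∀ k y, |qk k y * (qk k y / (kap e * (1 + ‖fderiv ℝ (φk k) y‖ ^ 2)))| ≤ M')
    (hsl : ∀ y, Tendsto (fun k => qk k y * (qk k y / (kap e * (1 + ‖fderiv ℝ (φk k) y‖ ^ 2)))) atTop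
      (𝓝 (s0 ^ 2 / kap e)))
    {η : EE n → ℝ} (hη : SC η) :
    ∫ x, w0 x * lap η x = s0 * ∫ y, Jf (fderiv ℝ φ0 y) * η (gr e φ0 y) ∂(mF m) := by
  obtain ⟨σ, q0, hσ, hqi, hq⟩ := weak_lim hqm hqb
  have hσ' := hσ.tendsto_atTop
  exact limit_core (fun k => Hk (σ k)) (hε.comp hσ') (hR.comp hσ') (fun k => h0 _)
    (fun x => (hw x).comp hσ') (fun x => (hφ x).comp hσ') (fun k => hqm _) (fun k => hqb _) hqi hq hs0
    (fun k => hsb _) (fun y => (hsl y).comp hσ') hη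

end LSsec

/-! ### Epigraphs, positivity, integration over graphs -/

section epi
variable {m : ℕ} {e : WithLp 2 (EE m × ℝ) ≃ₗᵢ[ℝ] EE n}

/-- open epigraph -/
def epi (e : WithLp 2 (EE m × ℝ) ≃ₗᵢ[ℝ] EE n) (φ : EE m → ℝ) : Set (EE n) :=
  {x | φ (hc e x) < vc e x}

lemma isOpen_epi {φ : EE m → ℝ} (h : Continuous φ) : IsOpen (epi e φ) :=
  isOpen_lt (h.comp (continuous_hc e)) (continuous_vc e)

lemma gr_notMem_epi (φ : EE m → ℝ) (y : EE m) : gr e φ y ∉ epi e φ := by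
  simp [epi, gr]

lemma isPreconnected_epi {φ : EE m → ℝ} (h : Continuous φ) : IsPreconnected (epi e φ) := by
  have h1 : epi e φ = (fun p : EE m × ℝ => pt e p.1 (φ p.1 + p.2)) '' (univ ×ˢ Ioi 0) := by
    ext x
    constructor
    · intro hx
      refine ⟨(hc e x, vc e x - φ (hc e x)), ⟨mem_univ _, ?_⟩, ?_⟩
      · have : φ (hc e x) < vc e x := hx
        simpa using this
      · simp
    · rintro ⟨⟨y, t⟩, ⟨-, ht⟩, rfl⟩
      have : (0:ℝ) < t := ht
      simpa [epi] using this
  rw [h1]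
  refine IsPreconnected.image ?_ _ ?_
  · exact (isPreconnected_univ).prod isPreconnected_Ioi
  · exact ((continuous_pt e).comp (continuous_fst.prodMk ((h.comp continuous_fst).add continuous_snd))).continuousOn

lemma frontier_epi {φ : EE m → ℝ} (h : Continuous φ) : frontier (epi e φ) = range (gr e φ) := by
  rw [(isOpen_epi h).frontier_eq]
  ext x
  constructor
  · rintro ⟨h1, h2⟩
    have h3 : x ∈ {x | φ (hc e x) ≤ vc e x} :=
      closure_minimal (fun z hz => le_of_lt hz)
        (isClosed_le (h.comp (continuous_hc e)) (continuous_vc e)) h1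
    have h4 : vc e x = φ (hc e x) := le_antisymm (not_lt.1 h2) h3
    exact ⟨hc e x, by rw [gr, ← h4, pt_hc_vc]⟩
  · rintro ⟨y, rfl⟩
    refine ⟨?_, gr_notMem_epi φ y⟩
    have hc1 : Tendsto (fun t : ℝ => pt e y (φ y + t)) (𝓝[>] 0) (𝓝 (gr e φ y)) := by
      have : Continuous (fun t : ℝ => pt e y (φ y + t)) :=
        (continuous_pt e).comp (continuous_const.prodMk (continuous_const.add continuous_id))
      have h2 := this.tendsto 0
      simp only [add_zero] at h2
      exact h2.mono_left nhdsWithin_le_nhds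
    refine mem_closure_of_tendsto hc1 ?_
    filter_upwards [self_mem_nhdsWithin] with t ht
    have : (0:ℝ) < t := ht
    simpa [epi] using this

lemma pos_eq_epi {φ : EE m → ℝ} {w : EE n → ℝ} (h : Continuous φ) (hc0 : Continuous w)
    (hw : IsWH w (epi e φ)) (h0 : ∀ x, 0 ≤ w x) (hz : ∀ y t, t ≤ φ y → w (pt e y t) = 0)
    (hne : ∃ z, 0 < w z) : {x | 0 < w x} = epi e φ := by
  have hsub : {x | 0 < w x} ⊆ epi e φ := by
    intro x hx
    by_contra hcon
    have h1 := hz (hc e x) (vc e x) (not_lt.1 hcon)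
    rw [pt_hc_vc] at h1
    exact (ne_of_gt hx) h1
  refine hsub.antisymm ?_
  have ho : IsOpen (epi e φ ∩ {x | w x = 0}) := by
    rw [Metric.isOpen_iff]
    rintro x ⟨hx, hx0⟩
    obtain ⟨s, hs, hsV⟩ := Metric.nhds_basis_closedBall.mem_iff.1 ((isOpen_epi h).mem_nhds hx)
    exact ⟨s, hs, fun z hzz => ⟨hsV (ball_subset_closedBall hzz), wh_zero hc0 hw hs hsV h0 hx0 hzz⟩⟩
  refine IsPreconnected.subset_left_of_subset_union (isOpen_lt continuous_const hc0) ho ?_ ?_ ?_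
    (isPreconnected_epi h)
  · rw [Set.disjoint_left]
    rintro x hx ⟨-, hx'⟩
    exact (ne_of_gt hx) hx'
  · intro x hx
    rcases (h0 x).lt_or_eq with h1 | h1
    · exact Or.inl h1
    · exact Or.inr ⟨hx, h1.symm⟩
  · obtain ⟨z, hz⟩ := hne
    exact ⟨z, hsub hz, hz⟩

lemma integral_graph {φ : EE m → ℝ} {K : ℝ≥0} (hφ : LipschitzWith K φ) (F : EE n → ℝ) :
    ∫ x in range (gr e φ), F x ∂μH[(m:ℝ)] = ∫ y, Jf (fderiv ℝ φ y) * F (gr e φ y) ∂(mF m) := by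
  rw [area_graph e hφ, (measurableEmbedding_gr e hφ.continuous).integral_map]
  rw [integral_withDensity_eq_integral_toReal_smul]
  · refine integral_congr_ae (Eventually.of_forall fun y => ?_)
    simp only [smul_eq_mul]
    rw [ENNReal.toReal_ofReal (Jf_pos _).le]
  · exact (continuous_Jf.measurable.comp (measurable_fderiv ℝ φ)).ennreal_ofReal
  · exact Eventually.of_forall fun y => ENNReal.ofReal_lt_top

end epi

/-! ### The weak solution near a free boundary point as a local solution over a graph -/

lemma meas_ind {F : EE n → ℝ} {S : Set (EE n)} (hS : IsOpen S) (hF : ContinuousOn F S) :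
    Measurable (S.indicator F) := by
  classical
  rw [← piecewise_eq_indicator]
  exact hF.measurable_piecewise (continuous_zero.continuousOn) hS.measurableSet

section setup
variable {m : ℕ} {e : WithLp 2 (EE m × ℝ) ≃ₗᵢ[ℝ] EE n}

lemma frontier_local {U : Set (EE n)} {x₀ : EE n} {ρ : ℝ} {φ : EE m → ℝ} (hφ : Continuous φ)
    (hset : ∀ x ∈ ball x₀ ρ, (x ∈ U ↔ x - x₀ ∈ epi e φ)) :
    ∀ x ∈ ball x₀ ρ, (x ∈ frontier U ↔ x - x₀ ∈ range (gr e φ)) := by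
  have h1 : U ∩ ball x₀ ρ = (Homeomorph.subRight x₀) ⁻¹' (epi e φ) ∩ ball x₀ ρ := by
    ext x
    constructor
    · rintro ⟨h, h'⟩; exact ⟨(hset x h').1 h, h'⟩
    · rintro ⟨h, h'⟩; exact ⟨(hset x h').2 h, h'⟩
  have h2 : frontier U ∩ ball x₀ ρ = (Homeomorph.subRight x₀) ⁻¹' (range (gr e φ)) ∩ ball x₀ ρ := by
    rw [← frontier_inter_open_inter isOpen_ball, h1, frontier_inter_open_inter isOpen_ball,
      ← Homeomorph.preimage_frontier, frontier_epi hφ]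
  intro x hx
  have := Set.ext_iff.1 h2 x
  simpa [hx] using this

lemma surf_integral {F : Set (EE n)} {x₀ : EE n} {ρ : ℝ} {φ : EE m → ℝ} {K : ℝ≥0} (hφ : LipschitzWith K φ)
    (hF : ∀ x ∈ ball x₀ ρ, (x ∈ F ↔ x - x₀ ∈ range (gr e φ))) (hFm : MeasurableSet F)
    {Q η : EE n → ℝ} (hη : ∀ x, x ∉ ball 0 ρ → η x = 0) :
    ∫ x in F, Q x * η (x - x₀) ∂μH[(m:ℝ)] =
      ∫ y, ((ball 0 ρ).indicator (fun x => Q (x₀ + x)) (gr e φ y) * Jf (fderiv ℝ φ y)) * η (gr e φ y) ∂(mF m) := by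
  have hR : MeasurableSet (range (gr e φ)) := (measurableEmbedding_gr e hφ.continuous).measurableSet_range
  set H : EE n → ℝ := (range (gr e φ)).indicator
    (fun x => (ball 0 ρ).indicator (fun x => Q (x₀ + x)) x * η x) with hH
  have h1 : ∀ x, F.indicator (fun x => Q x * η (x - x₀)) x = H (x - x₀) := by
    intro x
    by_cases hx : x ∈ ball x₀ ρ
    · have hx' : x - x₀ ∈ ball (0 : EE n) ρ := by simpa [dist_eq_norm] using hx
      by_cases hxF : x ∈ F
      · rw [indicator_of_mem hxF, hH, indicator_of_mem ((hF x hx).1 hxF), indicator_of_mem hx']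
        simp
      · rw [indicator_of_notMem hxF, hH, indicator_of_notMem (fun h => hxF ((hF x hx).2 h))]
    · have hx' : x - x₀ ∉ ball (0 : EE n) ρ := by simpa [dist_eq_norm] using hx
      have h0 := hη _ hx'
      have : H (x - x₀) = 0 := by
        rw [hH]
        by_cases h : x - x₀ ∈ range (gr e φ)
        · rw [indicator_of_mem h, h0, mul_zero]
        · rw [indicator_of_notMem h]
      rw [this]
      by_cases hxF : x ∈ F
      · rw [indicator_of_mem hxF, h0, mul_zero]
      · rw [indicator_of_notMem hxF]
  rw [← integral_indicator hFm]
  simp_rw [h1]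
  rw [integral_sub_right_eq_self H x₀, hH, integral_indicator hR, integral_graph hφ]
  congr 1; ext y; ring

lemma init_LS {f Q u : EE n → ℝ} (hu : IsWeakSolution f Q u) (hmn : (n:ℝ) - 1 = (m:ℝ))
    (hf : ContinuousOn f (ball 0 1)) (hQ : ContinuousOn Q (ball 0 1)) {Qmin Qmax : ℝ} (hQmin : 0 < Qmin)
    (hQb : ∀ x ∈ ball (0 : EE n) 1, Qmin ≤ Q x ∧ Q x ≤ Qmax)
    {x₀ : EE n} {ρ : ℝ} (hρ : 0 < ρ) (hρ1 : closedBall x₀ ρ ⊆ ball 0 1) {φ : EE m → ℝ} {K : ℝ≥0}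
    (hφ : LipschitzWith K φ)
    (hset : ∀ x ∈ ball x₀ ρ, (x ∈ posSet u ↔ x - x₀ ∈ epi e φ)) :
    ∃ (L : ℝ≥0) (ε : ℝ) (w g : EE n → ℝ),
      LS e L K ε ρ w φ
        (fun y => (ball 0 ρ).indicator (fun x => Q (x₀ + x)) (gr e φ y) * Jf (fderiv ℝ φ y)) g ∧
      ∀ x ∈ ball (0 : EE n) ρ, w x = u (x₀ + x) := by
  have hcpt : IsCompact (closedBall x₀ ρ) := isCompact_closedBall _ _
  obtain ⟨L, hL⟩ := hu.locLip _ hcpt hρ1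
  obtain ⟨v, hv, hvu⟩ := hL.extend_real
  obtain ⟨ε, hε⟩ := hcpt.exists_bound_of_continuousOn (hf.mono hρ1)
  have hε0 : 0 ≤ ε := (norm_nonneg _).trans (hε x₀ (mem_closedBall_self hρ.le))
  have hsh : ∀ x, x ∈ ball (0 : EE n) ρ ↔ x₀ + x ∈ ball x₀ ρ := fun x => by simp
  have hcb : ∀ x, x ∈ ball (0 : EE n) ρ → x₀ + x ∈ closedBall x₀ ρ := fun x hx =>
    ball_subset_closedBall ((hsh x).1 hx)
  have hb1 : ∀ x, x ∈ ball (0 : EE n) ρ → x₀ + x ∈ ball (0 : EE n) 1 := fun x hx => hρ1 (hcb x hx)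
  have hpo : IsOpen (posSet u) := by
    have := hu.contOn.isOpen_inter_preimage isOpen_ball (isOpen_Ioi (a := (0:ℝ)))
    exact this
  set S : Set (EE n) := {x | x ∈ ball (0 : EE n) ρ ∧ x₀ + x ∈ posSet u} with hS
  have hSo : IsOpen S := isOpen_ball.inter (hpo.preimage (by fun_prop))
  set w : EE n → ℝ := fun x => max (v (x₀ + x)) 0 with hw
  have hwu : ∀ x ∈ ball (0 : EE n) ρ, w x = u (x₀ + x) := by
    intro x hx
    rw [hw]
    simp only
    rw [← hvu (hcb x hx), max_eq_left (hu.nonneg _ (hb1 x hx))]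
  have hwl : LipschitzWith L w := by
    have h1 : LipschitzWith L (fun x => v (x₀ + x)) := by
      refine LipschitzWith.of_dist_le_mul fun x y => ?_
      simpa using hv.dist_le_mul (x₀ + x) (x₀ + y)
    exact h1.max_const 0
  set g : EE n → ℝ := S.indicator (fun x => f (x₀ + x)) with hg
  have hQm : Measurable ((ball (0 : EE n) ρ).indicator (fun x => Q (x₀ + x))) :=
    meas_ind isOpen_ball (hQ.comp (by fun_prop) hb1)
  have hJm : Measurable (fun y => Jf (fderiv ℝ φ y)) :=
    continuous_Jf.measurable.comp (measurable_fderiv ℝ φ)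
  have hJb : ∀ y, Jf (fderiv ℝ φ y) ≤ Real.sqrt (1 + (K:ℝ) ^ 2) := by
    intro y
    unfold Jf
    gcongr
    exact norm_fderiv_le_of_lipschitz ℝ hφ
  have hQM : 0 ≤ Qmax := by
    have := hQb x₀ (hρ1 (mem_closedBall_self hρ.le)); linarith
  have hQi : ∀ x, |(ball (0 : EE n) ρ).indicator (fun x => Q (x₀ + x)) x| ≤ Qmax := by
    intro x
    by_cases hx : x ∈ ball (0 : EE n) ρ
    · rw [indicator_of_mem hx]
      have := hQb _ (hb1 x hx)
      rw [abs_of_pos (by linarith)]; exact this.2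
    · rw [indicator_of_notMem hx, abs_zero]; exact hQM
  refine ⟨L, ε, w, g, ⟨hwl, fun x => le_max_right _ _, hφ, ?_, ?_, ?_, ?_, ?_⟩, hwu⟩
  · have hc := locallyIntegrable_const (μ := mF m) (Qmax * Real.sqrt (1 + (K:ℝ) ^ 2))
    refine hc.mono ?_ (Eventually.of_forall fun y => ?_)
    · exact ((hQm.comp (continuous_gr e hφ.continuous).measurable).mul hJm).aestronglyMeasurable
    · rw [norm_mul, Real.norm_eq_abs, Real.norm_eq_abs, Real.norm_eq_abs, abs_of_pos (Jf_pos _)]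
      refine le_trans ?_ (le_abs_self _)
      exact mul_le_mul (hQi _) (hJb y) (Jf_pos _).le hQM
  · exact meas_ind hSo (hf.comp (by fun_prop) fun x hx => hb1 x hx.1)
  · intro x
    by_cases hx : x ∈ S
    · rw [hg, indicator_of_mem hx]
      exact hε _ (hcb x hx.1)
    · rw [hg, indicator_of_notMem hx, abs_zero]; exact hε0
  · intro y t hy ht
    rw [hwu _ hy]
    by_contra hne
    have hpos : 0 < u (x₀ + pt e y t) :=
      lt_of_le_of_ne (hu.nonneg _ (hb1 _ hy)) (Ne.symm hne)
    have h1 := (hset _ ((hsh _).1 hy)).1 ⟨hb1 _ hy, hpos⟩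
    rw [add_sub_cancel_left] at h1
    simp only [epi, mem_ofPred_eq, hc_pt, vc_pt] at h1
    linarith
  · intro η hη hs
    have hη0 : ∀ x, x ∉ ball (0 : EE n) ρ → η x = 0 := fun x hx =>
      image_eq_zero_of_notMem_tsupport fun h => hx (hs h)
    have hη' : SC (fun x => η (x - x₀)) := by
      have := hη.resc x₀ one_pos
      simpa using this
    have hts : tsupport (fun x => η (x - x₀)) ⊆ ball x₀ ρ := by
      intro x hx
      have := tsupport_resc η x₀ (h := 1)
      simp only [inv_one, one_smul] at this
      have h2 := hs (this hx)
      simpa [dist_eq_norm] using h2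
    have hball : ball x₀ ρ ⊆ ball (0 : EE n) 1 := ball_subset_closedBall.trans hρ1
    have key := hu.weakEq _ hη'.1 hη'.2 (hts.trans hball)
    rw [hmn] at key
    rw [surf_integral (e := e) (ρ := ρ) hφ ?_ (isClosed_frontier.measurableSet.inter measurableSet_ball) hη0] at key
    swap
    · intro x hx
      rw [← frontier_local hφ.continuous hset x hx]
      exact ⟨fun h => h.1, fun h => ⟨h, hball hx⟩⟩
    have e1 : ∫ x in posSet u, f x * η (x - x₀) = ∫ x, g x * η x := by
      rw [← integral_indicator hpo.measurableSet,
        ← integral_sub_right_eq_self (fun x => g x * η x) x₀]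
      congr 1; ext x
      by_cases hx : x ∈ ball x₀ ρ
      · have hx' : x - x₀ ∈ ball (0 : EE n) ρ := by simpa [dist_eq_norm] using hx
        by_cases hxF : x ∈ posSet u
        · have : x - x₀ ∈ S := ⟨hx', by simpa using hxF⟩
          rw [indicator_of_mem hxF, hg, indicator_of_mem this]
          simp
        · have : x - x₀ ∉ S := fun h => hxF (by simpa using h.2)
          rw [indicator_of_notMem hxF, hg, indicator_of_notMem this, zero_mul]
      · have hx' : x - x₀ ∉ ball (0 : EE n) ρ := by simpa [dist_eq_norm] using hx
        rw [hη0 _ hx', mul_zero]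
        by_cases hxF : x ∈ posSet u
        · rw [indicator_of_mem hxF, hη0 _ hx', mul_zero]
        · rw [indicator_of_notMem hxF]
    have e2 : ∫ x in ball (0 : EE n) 1, ⟪gradient u x, gradient (fun x => η (x - x₀)) x⟫ =
        ∫ x, gd w η x := by
      rw [← integral_indicator measurableSet_ball,
        ← integral_sub_right_eq_self (fun x => gd w η x) x₀]
      congr 1; ext x
      have h3 : gd w η (x - x₀) = gd (fun x => w (x - x₀)) (fun x => η (x - x₀)) x := by
        have := gd_comp_add (-x₀) w η x
        simp only [← sub_eq_add_neg] at this
        exact this.symm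
      rw [h3]
      by_cases hx : x ∈ ball x₀ ρ
      · rw [indicator_of_mem (hball hx), inner_gradient]
        unfold gd
        refine Finset.sum_congr rfl fun i _ => ?_
        congr 1
        unfold dd
        congr 1
        apply Filter.EventuallyEq.fderiv_eq
        filter_upwards [isOpen_ball.mem_nhds hx] with z hz
        rw [hwu _ (by simpa [dist_eq_norm] using hz)]; simp
      · have h4 : ∀ W : EE n → ℝ, gd W (fun x => η (x - x₀)) x = 0 := by
          intro W
          unfold gd
          refine Finset.sum_eq_zero fun i _ => ?_
          rw [dd_zero_of_notMem (fun h => hx (hts h)), mul_zero]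
        rw [h4]
        by_cases h : x ∈ ball (0 : EE n) 1
        · rw [indicator_of_mem h, inner_gradient, h4]
        · rw [indicator_of_notMem h]
    rw [e1, e2, ← integral_mul_lap hwl hη] at key
    exact key

end setup

/-! ### Main theorem -/

lemma fderiv_resc {m : ℕ} (φ : EE m → ℝ) {h : ℝ} (hh : 0 < h) (y : EE m) :
    fderiv ℝ (fun y => φ (h • y) / h) y = fderiv ℝ φ (h • y) := by
  have h1 : (fun y => φ (h • y) / h) = h⁻¹ • (fun y => φ (h • y)) := by
    ext y; simp [div_eq_inv_mul]
  rw [h1, fderiv_const_smul_field, Pi.smul_apply, fderiv_comp_smul, smul_smul, inv_mul_cancel₀ hh.ne', one_smul]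

lemma avg_le {X : Type*} [MeasurableSpace X] (μ : Measure X) (s : Set X) (F : X → ℝ) {C : ℝ} (hC : 0 ≤ C)
    (h : ∀ x ∈ s, |F x| ≤ C) : ⨍ x in s, F x ∂μ ≤ C := by
  rw [setAverage_eq, smul_eq_mul]
  by_cases hs : μ s < ∞
  · have h1 := norm_setIntegral_le_of_norm_le_const (f := F) (C := C) hs (fun x hx => h x hx)
    have h2 : ∫ x in s, F x ∂μ ≤ C * μ.real s := (le_abs_self _).trans h1
    rcases (measureReal_nonneg (μ := μ) (s := s)).lt_or_eq with h3 | h3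
    · rw [inv_mul_le_iff₀ h3]; linarith
    · rw [← h3]; simpa using hC
  · have : μ s = ∞ := by simpa using hs
    simp [Measure.real, this, hC]

theorem main_aux {m : ℕ} (e : WithLp 2 (EE m × ℝ) ≃ₗᵢ[ℝ] EE n) (f Q u : EE n → ℝ) (Qmin Qmax : ℝ)
    (hmn : (n:ℝ) - 1 = (m:ℝ))
    (hf : ContinuousOn f (ball 0 1)) (hQ : ContinuousOn Q (ball 0 1)) (hQmin : 0 < Qmin)
    (hQb : ∀ x ∈ ball (0 : EE n) 1, Qmin ≤ Q x ∧ Q x ≤ Qmax)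
    (hu : IsWeakSolution f Q u) (x₀ : EE n) (hx₀ : x₀ ∈ frontier (posSet u))
    {ρ : ℝ} (hρ : 0 < ρ) (hρ1 : closedBall x₀ ρ ⊆ ball 0 1) {φ : EE m → ℝ} {K : ℝ≥0}
    (hφ : LipschitzWith K φ) (hφ0 : φ 0 = 0)
    (hset : ∀ x ∈ ball x₀ ρ, (x ∈ posSet u ↔ x - x₀ ∈ epi e φ))
    (rk : ℕ → ℝ) (hrk : ∀ k, 0 < rk k) (hrk0 : Tendsto rk atTop (𝓝 0)) :
    ∃ (σ : ℕ → ℕ) (u₀ : EE n → ℝ) (L : ℝ≥0),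
      StrictMono σ ∧ (∀ x, 0 ≤ u₀ x) ∧ LipschitzWith L u₀ ∧
      (∀ S : Set (EE n), IsCompact S →
        TendstoUniformlyOn (fun k x => u (x₀ + rk (σ k) • x) / rk (σ k)) u₀ atTop S) ∧
      (0 : EE n) ∈ frontier {x | 0 < u₀ x} ∧
      ContDiffOn ℝ 2 u₀ {x | 0 < u₀ x} ∧
      (∀ x ∈ {x : EE n | 0 < u₀ x}, lap u₀ x = 0) ∧
      (∀ η : EE n → ℝ, ContDiff ℝ (⊤ : ℕ∞) η → HasCompactSupport η →
        -∫ x, ⟪gradient u₀ x, gradient η x⟫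
          = Q x₀ * ∫ x in frontier {x | 0 < u₀ x}, η x ∂(μH[(n-1:ℝ)])) := by
  obtain ⟨L, ε, w, g, H, hwu⟩ := init_LS (e := e) hu hmn hf hQ hQmin hQb hρ hρ1 hφ hset
  set Qt : EE n → ℝ := (ball 0 ρ).indicator (fun x => Q (x₀ + x)) with hQt
  have hx1 : x₀ ∈ ball (0 : EE n) 1 := hρ1 (mem_closedBall_self hρ.le)
  have hQM : 0 ≤ Qmax := by have := hQb x₀ hx1; linarith
  have hb1 : ∀ x, x ∈ ball (0 : EE n) ρ → x₀ + x ∈ ball (0 : EE n) 1 := fun x hx =>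
    hρ1 (ball_subset_closedBall (by simpa using hx))
  have hQm : Measurable Qt := meas_ind isOpen_ball (hQ.comp (by fun_prop) hb1)
  have hQi : ∀ x, |Qt x| ≤ Qmax := by
    intro x
    by_cases hx : x ∈ ball (0 : EE n) ρ
    · rw [hQt, indicator_of_mem hx]
      have := hQb _ (hb1 x hx)
      rw [abs_of_pos (by linarith)]; exact this.2
    · rw [hQt, indicator_of_notMem hx, abs_zero]; exact hQM
  have hJb : ∀ y, Jf (fderiv ℝ φ y) ≤ Real.sqrt (1 + (K:ℝ) ^ 2) := by
    intro y
    unfold Jf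
    gcongr
    exact norm_fderiv_le_of_lipschitz ℝ hφ
  have hgr0 : gr e φ 0 = 0 := by rw [gr, hφ0, pt_zero]
  have Hk : ∀ k, LS e L K (rk k * ε) (ρ / rk k) (fun x => w (rk k • x) / rk k)
      (fun y => φ (rk k • y) / rk k) (fun y => Qt (gr e φ (rk k • y)) * Jf (fderiv ℝ φ (rk k • y)))
      (fun x => rk k * g (rk k • x)) := by
    intro k
    have := H.scale 0 (hrk k) (R' := ρ / rk k) (by
      rw [hgr0, norm_zero, zero_add, mul_div_cancel₀ _ (hrk k).ne'])
    simpa only [hgr0, hφ0, zero_add, sub_zero] using this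
  have hw0 : w 0 = 0 := by
    have := H.zero 0 0 (by rw [pt_zero]; exact mem_ball_self hρ) (by rw [hφ0])
    rwa [pt_zero] at this
  obtain ⟨σ1, w0, hσ1, hw0L, hw0c⟩ := arzela (M := 0) (fun k => (Hk k).lip) (by simp [hw0])
  obtain ⟨σ2, φ0, hσ2, hφ0L, hφ0c⟩ := arzela (M := 0) (fun k => (Hk (σ1 k)).lipφ) (by simp [hφ0])
  set σ := σ1 ∘ σ2 with hσd
  have hσ : StrictMono σ := hσ1.comp hσ2
  have hr : Tendsto (fun k => rk (σ k)) atTop (𝓝 0) := hrk0.comp hσ.tendsto_atTop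
  have hwc : ∀ S : Set (EE n), IsCompact S →
      TendstoUniformlyOn (fun k x => w (rk (σ k) • x) / rk (σ k)) w0 atTop S := by
    intro S hS
    intro v hv
    exact hσ2.tendsto_atTop.eventually (hw0c S hS v hv)
  have hwp : ∀ x, Tendsto (fun k => w (rk (σ k) • x) / rk (σ k)) atTop (𝓝 (w0 x)) := fun x =>
    (hwc {x} isCompact_singleton).tendsto_at rfl
  have hφp : ∀ y, Tendsto (fun k => φ (rk (σ k) • y) / rk (σ k)) atTop (𝓝 (φ0 y)) := fun x =>
    (hφ0c {x} isCompact_singleton).tendsto_at rfl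
  have hR : Tendsto (fun k => ρ / rk (σ k)) atTop atTop := by
    have : Tendsto (fun k => rk (σ k)) atTop (𝓝[>] 0) :=
      tendsto_nhdsWithin_iff.2 ⟨hr, Eventually.of_forall fun k => hrk _⟩
    have h2 := (tendsto_inv_nhdsGT_zero.comp this).const_mul_atTop hρ
    simpa [div_eq_mul_inv] using h2
  have hagree : ∀ S : Set (EE n), IsCompact S → ∀ᶠ k in atTop,
      EqOn (fun x => w (rk (σ k) • x) / rk (σ k)) (fun x => u (x₀ + rk (σ k) • x) / rk (σ k)) S := by
    intro S hS
    obtain ⟨M, hM⟩ := hS.isBounded.exists_norm_le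
    filter_upwards [hR.eventually_gt_atTop M] with k hk x hx
    have : rk (σ k) • x ∈ ball (0 : EE n) ρ := by
      rw [mem_ball_zero_iff, norm_smul, Real.norm_of_nonneg (hrk _).le]
      rw [lt_div_iff₀ (hrk _)] at hk
      have := mul_le_mul_of_nonneg_right (hM x hx) (hrk (σ k)).le
      linarith
    simp only
    rw [hwu _ this]
  have huc : ∀ S : Set (EE n), IsCompact S →
      TendstoUniformlyOn (fun k x => u (x₀ + rk (σ k) • x) / rk (σ k)) w0 atTop S := fun S hS =>
    (hwc S hS).congr (hagree S hS)
  have hkp := kap_pos e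
  have hcalc : ∀ k y, Qt (gr e φ (rk k • y)) * Jf (fderiv ℝ φ (rk k • y)) *
      (Qt (gr e φ (rk k • y)) * Jf (fderiv ℝ φ (rk k • y)) /
        (kap e * (1 + ‖fderiv ℝ (fun y => φ (rk k • y) / rk k) y‖ ^ 2))) =
        Qt (gr e φ (rk k • y)) ^ 2 / kap e := by
    intro k y
    rw [fderiv_resc φ (hrk k), ← Jf_sq]
    have := (Jf_pos (fderiv ℝ φ (rk k • y))).ne'
    field_simp
  have hlim : ∀ y, Tendsto (fun k => Qt (gr e φ (rk (σ k) • y))) atTop (𝓝 (Q x₀)) := by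
    intro y
    have h1 : Tendsto (fun k => gr e φ (rk (σ k) • y)) atTop (𝓝 0) := by
      have h2 : Continuous (fun t : ℝ => gr e φ (t • y)) :=
        (continuous_gr e hφ.continuous).comp (by fun_prop)
      have h3 := (h2.tendsto 0).comp hr
      simpa [hgr0, Function.comp_def] using h3
    have h2 : ContinuousAt Qt 0 := by
      have h3 : ContinuousAt (fun x => Q (x₀ + x)) (0 : EE n) := by
        have h5 : ContinuousAt Q (x₀ + 0) := by
          rw [add_zero]; exact hQ.continuousAt (isOpen_ball.mem_nhds hx1)
        exact ContinuousAt.comp (g := Q) (f := fun x => x₀ + x) h5 (by fun_prop)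
      refine h3.congr ?_
      filter_upwards [ball_mem_nhds (0 : EE n) hρ] with x hx
      rw [hQt, indicator_of_mem hx]
    have h4 : Qt 0 = Q x₀ := by
      rw [hQt, indicator_of_mem (mem_ball_self hρ), add_zero]
    rw [← h4]
    exact h2.tendsto.comp h1
  have main : ∀ η : EE n → ℝ, SC η →
      ∫ x, w0 x * lap η x = Q x₀ * ∫ y, Jf (fderiv ℝ φ0 y) * η (gr e φ0 y) ∂(mF m) := by
    intro η hη
    refine limit_main (fun k => Hk (σ k)) ?_ hR ?_ hwp hφp (M := Qmax * Real.sqrt (1 + (K:ℝ) ^ 2)) ?_ ?_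
      (M' := Qmax ^ 2 / kap e) ?_ ?_ ?_ hη
    · simpa using hr.mul_const ε
    · intro k; simp [hw0]
    · intro k
      have hs : Measurable fun y : EE m => rk (σ k) • y := by fun_prop
      exact ((hQm.comp (continuous_gr e hφ.continuous).measurable).mul
        (continuous_Jf.measurable.comp (measurable_fderiv ℝ φ))).comp hs
    · intro k y
      rw [abs_mul, abs_of_pos (Jf_pos _)]
      exact mul_le_mul (hQi _) (hJb _) (Jf_pos _).le hQM
    · have := hQb x₀ hx1; linarith
    · intro k y
      rw [hcalc, abs_div, abs_of_pos hkp, abs_pow]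
      have := hQi (gr e φ (rk (σ k) • y))
      gcongr
    · intro y
      simp_rw [hcalc]
      exact ((hlim y).pow 2).div_const _
  have hz := LS_lim_zero' hw0L.continuous (LS_lim_zero (fun k => Hk (σ k)) hR hwp hφp)
  have hnn : ∀ x, 0 ≤ w0 x := fun x =>
    ge_of_tendsto (hwp x) (Eventually.of_forall fun k => (Hk (σ k)).nn x)
  have hWH : IsWH w0 (epi e φ0) := by
    intro η h1 h2 h3
    rw [main η ⟨h1, h2⟩]
    have : ∀ y, η (gr e φ0 y) = 0 := fun y =>
      image_eq_zero_of_notMem_tsupport fun h => gr_notMem_epi φ0 y (h3 h)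
    simp [this]
  have hne : ∃ z, 0 < w0 z := by
    by_contra! hcon
    have hzero : ∀ z, w0 z = 0 := fun z => le_antisymm (hcon z) (hnn z)
    obtain ⟨c, C, hc, -, hcC⟩ := hu.nondeg (ball x₀ ρ) isOpen_ball
      (closure_ball_subset_closedBall.trans hρ1)
    have h1 := huc (closedBall 0 1) (isCompact_closedBall _ _)
    rw [Metric.tendstoUniformlyOn_iff] at h1
    obtain ⟨k, hk1, hk2⟩ := ((h1 (c / 2) (by positivity)).and (hr.eventually (gt_mem_nhds hρ))).exists
    have hrp := hrk (σ k)
    have h3 := (hcC x₀ (rk (σ k)) hrp (ball_subset_ball hk2.le) hx₀).1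
    have h4 : ⨍ y in sphere x₀ (rk (σ k)), u y ∂(μH[(n-1:ℝ)]) ≤ rk (σ k) * (c / 2) := by
      refine avg_le _ _ _ (by positivity) fun y hy => ?_
      have h5 := hk1 ((rk (σ k))⁻¹ • (y - x₀)) (by
        rw [mem_closedBall_zero_iff, norm_smul, norm_inv, Real.norm_of_nonneg hrp.le,
          ← dist_eq_norm, mem_sphere.1 hy, inv_mul_cancel₀ hrp.ne'])
      rw [hzero, smul_smul, mul_inv_cancel₀ hrp.ne', one_smul, dist_zero_left, Real.norm_eq_abs,
        add_sub_cancel, abs_div, abs_of_pos hrp, div_lt_iff₀ hrp] at h5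
      linarith
    have h6 : (1 / rk (σ k)) * ⨍ y in sphere x₀ (rk (σ k)), u y ∂(μH[(n-1:ℝ)]) ≤
        (1 / rk (σ k)) * (rk (σ k) * (c / 2)) := by gcongr
    rw [one_div, inv_mul_cancel_left₀ hrp.ne'] at h6
    rw [one_div] at h3
    linarith
  have hpos := pos_eq_epi hφ0L.continuous hw0L.continuous hWH hnn hz hne
  have hφ00 : φ0 0 = 0 := by
    refine tendsto_nhds_unique (hφp 0) ?_
    simp [hφ0]
  obtain ⟨hs1, hs2⟩ := wh_smooth hw0L.continuous hWH (isOpen_epi hφ0L.continuous)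
  refine ⟨σ, w0, L, hσ, hnn, hw0L, huc, ?_, ?_, ?_, ?_⟩
  · rw [hpos, frontier_epi hφ0L.continuous]
    exact ⟨0, by rw [gr, hφ00, pt_zero]⟩
  · rw [hpos]; exact hs1
  · rw [hpos]; exact hs2
  · intro η h1 h2
    simp_rw [inner_gradient]
    rw [← integral_mul_lap hw0L ⟨h1, h2⟩, main η ⟨h1, h2⟩, hpos, frontier_epi hφ0L.continuous, hmn,
      integral_graph hφ0L]

/-- **Corollary 4.7.** If the free boundary of a weak solution is Lipschitz, then every blow-up
sequence at a free boundary point `x₀` admits a subsequence converging locally uniformly to a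
nonnegative Lipschitz function `u₀` which is a weak solution in all of `ℝⁿ` with `f ≡ 0` and
constant boundary datum `Q(x₀)`. -/
theorem blowup_limit_is_weak_solution
    (hn : 2 ≤ n) (f Q u : EuclideanSpace ℝ (Fin n) → ℝ) (Qmin Qmax : ℝ)
    (hf : ContDiffOn ℝ (⊤ : ℕ∞) f (ball 0 1))
    (hf0 : ∀ x ∈ ball (0 : EuclideanSpace ℝ (Fin n)) 1, 0 ≤ f x)
    (hQ : ContDiffOn ℝ (⊤ : ℕ∞) Q (ball 0 1)) (hQmin : 0 < Qmin)
    (hQb : ∀ x ∈ ball (0 : EuclideanSpace ℝ (Fin n)) 1, Qmin ≤ Q x ∧ Q x ≤ Qmax)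
    (hu : IsWeakSolution f Q u)
    (hLip : ∀ z ∈ frontier (posSet u) ∩ ball (0 : EuclideanSpace ℝ (Fin n)) 1,
      IsLipGraphNear (posSet u) z)
    (x₀ : EuclideanSpace ℝ (Fin n))
    (hx₀ : x₀ ∈ frontier (posSet u) ∩ ball (0 : EuclideanSpace ℝ (Fin n)) 1)
    (rk : ℕ → ℝ) (hrk : ∀ k, 0 < rk k) (hrk0 : Tendsto rk atTop (𝓝 0)) :
    ∃ (φ : ℕ → ℕ) (u₀ : EuclideanSpace ℝ (Fin n) → ℝ) (L : ℝ≥0),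
      StrictMono φ ∧ (∀ x, 0 ≤ u₀ x) ∧ LipschitzWith L u₀ ∧
      (∀ K : Set (EuclideanSpace ℝ (Fin n)), IsCompact K →
        TendstoUniformlyOn (fun k x => u (x₀ + rk (φ k) • x) / rk (φ k)) u₀ atTop K) ∧
      (0 : EuclideanSpace ℝ (Fin n)) ∈ frontier {x | 0 < u₀ x} ∧
      ContDiffOn ℝ 2 u₀ {x | 0 < u₀ x} ∧
      (∀ x ∈ {x : EuclideanSpace ℝ (Fin n) | 0 < u₀ x}, lap u₀ x = 0) ∧
      (∀ η : EuclideanSpace ℝ (Fin n) → ℝ, ContDiff ℝ (⊤ : ℕ∞) η → HasCompactSupport η →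
        -∫ x, ⟪gradient u₀ x, gradient η x⟫
          = Q x₀ * ∫ x in frontier {x | 0 < u₀ x}, η x ∂(μH[(n-1:ℝ)])) := by
  obtain ⟨r, L, e, φ, hr, hL, hφ, hφ0, hset⟩ := hLip x₀ hx₀
  have hx1 : ‖x₀‖ < 1 := by simpa using hx₀.2
  set ρ := min r ((1 - ‖x₀‖) / 2) with hρd
  have hρ : 0 < ρ := lt_min hr (by linarith)
  have hρr : ρ ≤ r := min_le_left _ _
  have hρ2 : ρ ≤ (1 - ‖x₀‖) / 2 := min_le_right _ _
  refine main_aux e f Q u Qmin Qmax ?_ hf.continuousOn hQ.continuousOn hQmin hQb hu x₀ hx₀.1 hρ ?_ hφ hφ0 ?_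
    rk hrk hrk0
  · rw [Nat.cast_sub (by omega)]; simp
  · intro x hx
    rw [mem_closedBall, dist_eq_norm] at hx
    rw [mem_ball_zero_iff]
    have : ‖x‖ ≤ ‖x - x₀‖ + ‖x₀‖ := by simpa using norm_add_le (x - x₀) x₀
    linarith
  · intro x hx
    have hxr : x ∈ ball x₀ r := ball_subset_ball hρr hx
    have h1 := Set.ext_iff.1 hset x
    constructor
    · intro h
      obtain ⟨⟨y, t, hyt, hp⟩, -⟩ := h1.1 ⟨h, hxr⟩
      have h2 : x - x₀ = pt e y t := by rw [hp, add_sub_cancel_left]; rfl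
      rw [h2]
      show φ (hc e (pt e y t)) < vc e (pt e y t)
      simpa using hyt
    · intro h
      refine (h1.2 ⟨⟨hc e (x - x₀), vc e (x - x₀), h, ?_⟩, hxr⟩).1
      have h2 : x - x₀ = pt e (hc e (x - x₀)) (vc e (x - x₀)) := (pt_hc_vc e _).symm
      have h3 : x = x₀ + pt e (hc e (x - x₀)) (vc e (x - x₀)) := by rw [← h2]; simp
      exact h3
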